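/- Let G be a connected affine algebraic group over ℂ, let q_G : G̃ → G be the covering morphism with kernel Π_G, and let A_s be a torus with trivial G-action. Then for every extension 1 → A_s → Ĝ → G → 1 of algebraic groups, the pullback extension q_G^*Ĝ of G̃ by A_s splits; equivalently, q_G^*Ĝ ≅ A_s × G̃ as an extension of G̃ by A_s. -/

import Mathlib

noncomputable section

open MvPolynomial

/-- Points of affine `n`-space over `ℂ`. -/
abbrev Pt (n : ℕ) : Type := Fin n → ℂ

/-- A subset of `ℂ^n` is an (affine) algebraic set if it is the common zero
locus of a set of polynomials. -/
def IsAlgebraicSet {n : ℕ} (V : Set (Pt n)) : Prop :=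
  ∃ S : Set (MvPolynomial (Fin n) ℂ), V = {x : Pt n | ∀ p ∈ S, eval x p = 0}

/-- A map `ℂ^n → ℂ^m` is regular (polynomial) on a subset `V ⊆ ℂ^n`. -/
def IsRegularOn {n m : ℕ} (V : Set (Pt n)) (f : Pt n → Pt m) : Prop :=
  ∃ P : Fin m → MvPolynomial (Fin n) ℂ, ∀ x ∈ V, ∀ i, f x i = eval x (P i)

def Pt.left {n m : ℕ} (z : Pt (n + m)) : Pt n := fun i => z (Fin.castAdd m i)
def Pt.right {n m : ℕ} (z : Pt (n + m)) : Pt m := fun i => z (Fin.natAdd n i)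

/-- An affine algebraic group over `ℂ`, realized as an algebraic subset of some
`ℂ^n`, with polynomial multiplication and inversion. -/
structure AffAlgGroup : Type where
  n : ℕ
  carrier : Set (Pt n)
  isAlgebraic : IsAlgebraicSet carrier
  one : Pt n
  one_mem : one ∈ carrier
  mul : Pt n → Pt n → Pt n
  inv : Pt n → Pt n
  mul_mem : ∀ {x y : Pt n}, x ∈ carrier → y ∈ carrier → mul x y ∈ carrier
  inv_mem : ∀ {x : Pt n}, x ∈ carrier → inv x ∈ carrier
  mul_assoc' : ∀ {x y z : Pt n}, x ∈ carrier → y ∈ carrier → z ∈ carrier →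
    mul (mul x y) z = mul x (mul y z)
  one_mul' : ∀ {x : Pt n}, x ∈ carrier → mul one x = x
  mul_one' : ∀ {x : Pt n}, x ∈ carrier → mul x one = x
  inv_mul' : ∀ {x : Pt n}, x ∈ carrier → mul (inv x) x = one
  mul_regular : IsRegularOn
    {z : Pt (n + n) | Pt.left z ∈ carrier ∧ Pt.right z ∈ carrier}
    (fun z => mul (Pt.left z) (Pt.right z))
  inv_regular : IsRegularOn carrier inv

namespace AffAlgGroup

/-- The group of `ℂ`-points of `G`, as a bundled group. -/
def Gp (G : AffAlgGroup) : Type := {x : Pt G.n // x ∈ G.carrier}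

instance (G : AffAlgGroup) : Group G.Gp where
  mul x y := ⟨G.mul x.1 y.1, G.mul_mem x.2 y.2⟩
  one := ⟨G.one, G.one_mem⟩
  inv x := ⟨G.inv x.1, G.inv_mem x.2⟩
  mul_assoc a b c := Subtype.ext (G.mul_assoc' a.2 b.2 c.2)
  one_mul a := Subtype.ext (G.one_mul' a.2)
  mul_one a := Subtype.ext (G.mul_one' a.2)
  inv_mul_cancel a := Subtype.ext (G.inv_mul' a.2)

/-- The Euclidean (classical) topology on the points of `G`. -/
instance (G : AffAlgGroup) : TopologicalSpace G.Gp :=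
  instTopologicalSpaceSubtype

/-- Connectedness of an affine algebraic group: the carrier cannot be divided
into two disjoint relatively (Zariski-)closed pieces. -/
def IsConnected (G : AffAlgGroup) : Prop :=
  ∀ V W : Set (Pt G.n), IsAlgebraicSet V → IsAlgebraicSet W →
    G.carrier ⊆ V ∪ W → G.carrier ∩ (V ∩ W) = ∅ →
    G.carrier ⊆ V ∨ G.carrier ⊆ W

def IsAbelianGrp (G : AffAlgGroup) : Prop :=
  ∀ x ∈ G.carrier, ∀ y ∈ G.carrier, G.mul x y = G.mul y x

/-- `G` is a torus: it is isomorphic, as an algebraic group, to `(ℂ*)^k`;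
the isomorphism and its inverse are required to be given by (Laurent)
polynomials. -/
def IsTorus (G : AffAlgGroup) : Prop :=
  ∃ (k : ℕ) (φ : (Fin k → ℂˣ) → Pt G.n),
    (∀ u, φ u ∈ G.carrier) ∧
    Function.Injective φ ∧
    (∀ x ∈ G.carrier, ∃ u, φ u = x) ∧
    φ (fun _ => 1) = G.one ∧
    (∀ u v, φ (u * v) = G.mul (φ u) (φ v)) ∧
    (∀ i : Fin G.n, ∃ P : MvPolynomial (Fin k ⊕ Fin k) ℂ,
      ∀ u, φ u i = eval (Sum.elim (fun j => (u j : ℂ)) (fun j => ((u j)⁻¹ : ℂˣ))) P) ∧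
    (∀ j : Fin k, ∃ Q : MvPolynomial (Fin G.n) ℂ, ∀ u, (u j : ℂ) = eval (φ u) Q)

end AffAlgGroup

/-- matrix entry access for a point of `ℂ^{m·m}` viewed as an `m × m` matrix -/
def matEntry {m : ℕ} (x : Pt (m * m)) (i j : Fin m) : ℂ := x (finProdFinEquiv (i, j))

/-- matrix multiplication on points of `ℂ^{m·m}` -/
def matMulPt (m : ℕ) (x y : Pt (m * m)) : Pt (m * m) :=
  fun idx => ∑ k : Fin m,
    matEntry x (finProdFinEquiv.symm idx).1 k * matEntry y k (finProdFinEquiv.symm idx).2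

/-- the identity matrix as a point of `ℂ^{m·m}` -/
def idMatPt (m : ℕ) : Pt (m * m) :=
  fun idx => if (finProdFinEquiv.symm idx).1 = (finProdFinEquiv.symm idx).2 then 1 else 0

/-- an upper triangular matrix with `1`'s on the diagonal -/
def IsUnitriangular (m : ℕ) (x : Pt (m * m)) : Prop :=
  (∀ i : Fin m, matEntry x i i = 1) ∧ (∀ i j : Fin m, j < i → matEntry x i j = 0)

/-- `G` is unipotent: it admits a faithful polynomial representation by
upper triangular unipotent matrices. -/
def AffAlgGroup.IsUnipotent (G : AffAlgGroup) : Prop :=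
  ∃ (m : ℕ) (φ : Pt G.n → Pt (m * m)),
    IsRegularOn G.carrier φ ∧
    Set.InjOn φ G.carrier ∧
    (∀ x ∈ G.carrier, IsUnitriangular m (φ x)) ∧
    (∀ x ∈ G.carrier, ∀ y ∈ G.carrier, φ (G.mul x y) = matMulPt m (φ x) (φ y))

/-- A homomorphism of affine algebraic groups: a polynomial map which is
multiplicative on points. -/
structure AlgGroupHom (G H : AffAlgGroup) : Type where
  toFun : Pt G.n → Pt H.n
  maps_to : ∀ {x : Pt G.n}, x ∈ G.carrier → toFun x ∈ H.carrier
  map_mul : ∀ {x y : Pt G.n}, x ∈ G.carrier → y ∈ G.carrier →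
    toFun (G.mul x y) = H.mul (toFun x) (toFun y)
  regular : IsRegularOn G.carrier toFun

/-- An algebraic action of `G` on `A` by group automorphisms. -/
structure AlgAction (G A : AffAlgGroup) : Type where
  act : Pt G.n → Pt A.n → Pt A.n
  maps_to : ∀ {g : Pt G.n} {a : Pt A.n}, g ∈ G.carrier → a ∈ A.carrier →
    act g a ∈ A.carrier
  act_one : ∀ {a : Pt A.n}, a ∈ A.carrier → act G.one a = a
  act_mul : ∀ {g h : Pt G.n} {a : Pt A.n}, g ∈ G.carrier → h ∈ G.carrier →
    a ∈ A.carrier → act (G.mul g h) a = act g (act h a)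
  act_map_mul : ∀ {g : Pt G.n} {a b : Pt A.n}, g ∈ G.carrier → a ∈ A.carrier →
    b ∈ A.carrier → act g (A.mul a b) = A.mul (act g a) (act g b)
  act_bij : ∀ {g : Pt G.n}, g ∈ G.carrier → ∀ a ∈ A.carrier, ∃ b ∈ A.carrier, act g b = a
  regular : IsRegularOn
    {z : Pt (G.n + A.n) | Pt.left z ∈ G.carrier ∧ Pt.right z ∈ A.carrier}
    (fun z => act (Pt.left z) (Pt.right z))

/-- the trivial action of `G` on `A` -/
def AlgAction.IsTrivial {G A : AffAlgGroup} (ρ : AlgAction G A) : Prop :=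
  ∀ g ∈ G.carrier, ∀ a ∈ A.carrier, ρ.act g a = a

/-- An extension `1 → A → E → G → 1` of affine algebraic groups inducing
(via conjugation in `E`) the action `ρ` of `G` on `A`. -/
structure AlgExtension (G A : AffAlgGroup) (ρ : AlgAction G A) : Type where
  E : AffAlgGroup
  i : AlgGroupHom A E
  q : AlgGroupHom E G
  i_inj : Set.InjOn i.toFun A.carrier
  q_surj : ∀ g ∈ G.carrier, ∃ x ∈ E.carrier, q.toFun x = g
  exact : ∀ x ∈ E.carrier, (q.toFun x = G.one ↔ ∃ a ∈ A.carrier, i.toFun a = x)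
  conj_compat : ∀ x ∈ E.carrier, ∀ a ∈ A.carrier,
    E.mul x (E.mul (i.toFun a) (E.inv x)) = i.toFun (ρ.act (q.toFun x) a)

namespace AlgExtension

variable {G A : AffAlgGroup} {ρ : AlgAction G A}

/-- An extension splits if the quotient map admits an algebraic group
theoretic section. -/
def Splits (e : AlgExtension G A ρ) : Prop :=
  ∃ σ : AlgGroupHom G e.E, ∀ g ∈ G.carrier, e.q.toFun (σ.toFun g) = g

/-- Equivalence of extensions (via a morphism over `G` and under `A`;
such a morphism is automatically an isomorphism). -/
def Equiv (e₁ e₂ : AlgExtension G A ρ) : Prop :=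
  ∃ f : AlgGroupHom e₁.E e₂.E,
    (∀ a ∈ A.carrier, f.toFun (e₁.i.toFun a) = e₂.i.toFun a) ∧
    (∀ x ∈ e₁.E.carrier, e₂.q.toFun (f.toFun x) = e₁.q.toFun x)

/-- `e₃` is a Baer sum of `e₁` and `e₂`: there is a regular map from the fiber
product `E₁ ×_G E₂` to `E₃` which is multiplicative, lies over `G` and
restricts to the multiplication `A × A → A` on the kernels.  (This
characterizes the Baer sum up to equivalence.) -/
def IsBaerSum (e₁ e₂ e₃ : AlgExtension G A ρ) : Prop :=
  ∃ h : Pt (e₁.E.n + e₂.E.n) → Pt e₃.E.n,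
    IsRegularOn {z : Pt (e₁.E.n + e₂.E.n) | Pt.left z ∈ e₁.E.carrier ∧
      Pt.right z ∈ e₂.E.carrier ∧ e₁.q.toFun (Pt.left z) = e₂.q.toFun (Pt.right z)} h ∧
    (∀ x ∈ e₁.E.carrier, ∀ y ∈ e₂.E.carrier, e₁.q.toFun x = e₂.q.toFun y →
      h (Fin.append x y) ∈ e₃.E.carrier) ∧
    (∀ x x' y y', x ∈ e₁.E.carrier → x' ∈ e₁.E.carrier → y ∈ e₂.E.carrier →
      y' ∈ e₂.E.carrier → e₁.q.toFun x = e₂.q.toFun y → e₁.q.toFun x' = e₂.q.toFun y' →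
      h (Fin.append (e₁.E.mul x x') (e₂.E.mul y y')) =
        e₃.E.mul (h (Fin.append x y)) (h (Fin.append x' y'))) ∧
    (∀ x ∈ e₁.E.carrier, ∀ y ∈ e₂.E.carrier, e₁.q.toFun x = e₂.q.toFun y →
      e₃.q.toFun (h (Fin.append x y)) = e₁.q.toFun x) ∧
    (∀ a ∈ A.carrier, ∀ b ∈ A.carrier,
      h (Fin.append (e₁.i.toFun a) (e₂.i.toFun b)) = e₃.i.toFun (A.mul a b))

end AlgExtension

/-- A realization of the abelian group `Ext_alg(G, A)` of equivalence classes
of extensions of `G` by `A` (inducing the action `ρ`), with addition given by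
the Baer sum, and zero element the class of split extensions. -/
structure IsExtGroup (G A : AffAlgGroup) (ρ : AlgAction G A)
    (Ext : Type) [AddCommGroup Ext] : Prop where
  exists_cls : ∃ cls : AlgExtension G A ρ → Ext,
    Function.Surjective cls ∧
    (∀ e₁ e₂, cls e₁ = cls e₂ ↔ Relation.EqvGen AlgExtension.Equiv e₁ e₂) ∧
    (∀ e, cls e = 0 ↔ e.Splits) ∧
    (∀ e₁ e₂ e₃, AlgExtension.IsBaerSum e₁ e₂ e₃ → cls e₁ + cls e₂ = cls e₃)

/-- The class map itself, when we need to name it. -/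
structure ExtClassMap (G A : AffAlgGroup) (ρ : AlgAction G A)
    (Ext : Type) [AddCommGroup Ext] : Type where
  cls : AlgExtension G A ρ → Ext
  surj : Function.Surjective cls
  cls_eq_iff : ∀ e₁ e₂, cls e₁ = cls e₂ ↔ Relation.EqvGen AlgExtension.Equiv e₁ e₂
  cls_eq_zero_iff : ∀ e, cls e = 0 ↔ e.Splits
  cls_baer : ∀ e₁ e₂ e₃, AlgExtension.IsBaerSum e₁ e₂ e₃ → cls e₁ + cls e₂ = cls e₃

/-- An algebraic subgroup of `G`. -/
structure AlgSubgroup (G : AffAlgGroup) : Type where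
  carrier : Set (Pt G.n)
  subset : carrier ⊆ G.carrier
  isAlgebraic : IsAlgebraicSet carrier
  one_mem : G.one ∈ carrier
  mul_mem : ∀ {x y : Pt G.n}, x ∈ carrier → y ∈ carrier → G.mul x y ∈ carrier
  inv_mem : ∀ {x : Pt G.n}, x ∈ carrier → G.inv x ∈ carrier

namespace AlgSubgroup

variable {G : AffAlgGroup}

/-- An algebraic subgroup is itself an affine algebraic group. -/
def toGrp (H : AlgSubgroup G) : AffAlgGroup where
  n := G.n
  carrier := H.carrier
  isAlgebraic := H.isAlgebraic
  one := G.one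
  one_mem := H.one_mem
  mul := G.mul
  inv := G.inv
  mul_mem := H.mul_mem
  inv_mem := H.inv_mem
  mul_assoc' hx hy hz := G.mul_assoc' (H.subset hx) (H.subset hy) (H.subset hz)
  one_mul' hx := G.one_mul' (H.subset hx)
  mul_one' hx := G.mul_one' (H.subset hx)
  inv_mul' hx := G.inv_mul' (H.subset hx)
  mul_regular := by
    obtain ⟨P, hP⟩ := G.mul_regular
    exact ⟨P, fun z hz => hP z ⟨H.subset hz.1, H.subset hz.2⟩⟩
  inv_regular := by
    obtain ⟨P, hP⟩ := G.inv_regular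
    exact ⟨P, fun x hx => hP x (H.subset hx)⟩

def IsNormal (H : AlgSubgroup G) : Prop :=
  ∀ g ∈ G.carrier, ∀ x ∈ H.carrier, G.mul g (G.mul x (G.inv g)) ∈ H.carrier

/-- `H` is the unipotent radical of `G`: the largest connected normal
unipotent algebraic subgroup. -/
def IsUnipotentRadical (H : AlgSubgroup G) : Prop :=
  H.IsNormal ∧ H.toGrp.IsConnected ∧ H.toGrp.IsUnipotent ∧
    ∀ K : AlgSubgroup G, K.IsNormal → K.toGrp.IsConnected → K.toGrp.IsUnipotent →
      K.carrier ⊆ H.carrier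

/-- `G` is reductive: its unipotent radical is trivial. -/
def _root_.AffAlgGroup.IsReductive (G : AffAlgGroup) : Prop :=
  ∀ K : AlgSubgroup G, K.IsNormal → K.toGrp.IsConnected → K.toGrp.IsUnipotent →
    K.carrier = {G.one}

end AlgSubgroup

/-- A Levi decomposition `G = G_u ⋊ G_red` of `G`:  `Gu` is the unipotent
radical and `L` is a connected reductive algebraic subgroup with
`Gu ∩ L = 1` and `Gu · L = G`. -/
structure LeviDecomposition (G : AffAlgGroup) : Type where
  Gu : AlgSubgroup G
  L : AlgSubgroup G
  Gu_radical : Gu.IsUnipotentRadical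
  L_connected : L.toGrp.IsConnected
  L_reductive : L.toGrp.IsReductive
  inter : Gu.carrier ∩ L.carrier = {G.one}
  decomp : ∀ x ∈ G.carrier, ∃ u ∈ Gu.carrier, ∃ l ∈ L.carrier, x = G.mul u l

/-- The group homomorphism on point groups induced by a morphism of algebraic
groups. -/
def AlgGroupHom.toGpHom {G H : AffAlgGroup} (f : AlgGroupHom G H) : G.Gp →* H.Gp :=
  MonoidHom.mk' (fun x => ⟨f.toFun x.1, f.maps_to x.2⟩)
    (fun a b => Subtype.ext (f.map_mul a.2 b.2))

/-- The subgroup of the point group underlying an algebraic subgroup. -/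
def AlgSubgroup.toSubgroup {G : AffAlgGroup} (H : AlgSubgroup G) : Subgroup G.Gp where
  carrier := {x : G.Gp | x.1 ∈ H.carrier}
  one_mem' := H.one_mem
  mul_mem' := fun ha hb => H.mul_mem ha hb
  inv_mem' := fun ha => H.inv_mem ha

/-- Iterated product (powers) in an algebraic group. -/
def AffAlgGroup.pow (G : AffAlgGroup) (x : Pt G.n) : ℕ → Pt G.n
  | 0 => G.one
  | k + 1 => G.mul x (G.pow x k)

/-- The inclusion homomorphism of an algebraic subgroup. -/
def AlgSubgroup.incl {A : AffAlgGroup} (H : AlgSubgroup A) : H.toGrp.Gp →* A.Gp :=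
  MonoidHom.mk' (fun x => ⟨x.1, H.subset x.2⟩) (fun _ _ => rfl)

/-! ### The canonical covering `G̃ = G_u ⋊ (Z × G̃'_red) → G` -/

/-- Data of the canonical algebraic covering `q_G : G̃ → G` attached to a Levi
decomposition `G = G_u ⋊ L`: here `Z` is the identity component of the center
of `L` (the maximal connected central algebraic subgroup), `Lder = [L, L]` is
the derived group of `L`, and `G̃ = G_u ⋊ (Z × G̃'_red)`, where `G̃'_red` is the
universal (simply connected) algebraic covering group of `Lder`. -/
structure CoveringData (G : AffAlgGroup) (LD : LeviDecomposition G) : Type where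
  /-- the identity component of the center of the Levi subgroup `L` -/
  Z : AlgSubgroup G
  Z_sub : Z.carrier ⊆ LD.L.carrier
  Z_central : ∀ z ∈ Z.carrier, ∀ l ∈ LD.L.carrier, G.mul z l = G.mul l z
  Z_connected : Z.toGrp.IsConnected
  Z_max : ∀ K : AlgSubgroup G, K.carrier ⊆ LD.L.carrier →
    (∀ z ∈ K.carrier, ∀ l ∈ LD.L.carrier, G.mul z l = G.mul l z) →
    K.toGrp.IsConnected → K.carrier ⊆ Z.carrier
  /-- the derived group `[L, L]` of the Levi subgroup -/
  Lder : AlgSubgroup G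
  Lder_sub : Lder.carrier ⊆ LD.L.carrier
  Lder_comm : ∀ x ∈ LD.L.carrier, ∀ y ∈ LD.L.carrier,
    G.mul x (G.mul y (G.mul (G.inv x) (G.inv y))) ∈ Lder.carrier
  Lder_min : ∀ K : AlgSubgroup G,
    (∀ x ∈ LD.L.carrier, ∀ y ∈ LD.L.carrier,
      G.mul x (G.mul y (G.mul (G.inv x) (G.inv y))) ∈ K.carrier) →
    Lder.carrier ⊆ K.carrier
  /-- the covering group `G̃` and the covering morphism -/
  Gt : AffAlgGroup
  qG : AlgGroupHom Gt G
  qG_surj : ∀ g ∈ G.carrier, ∃ x ∈ Gt.carrier, qG.toFun x = g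
  /-- the three factors of `G̃ = G_u ⋊ (Z × G̃'_red)` -/
  Gu' : AlgSubgroup Gt
  Zc : AlgSubgroup Gt
  Gs : AlgSubgroup Gt
  Gu'_normal : Gu'.IsNormal
  Zc_Gs_comm : ∀ z ∈ Zc.carrier, ∀ s ∈ Gs.carrier, Gt.mul z s = Gt.mul s z
  Zc_Gs_inter : Zc.carrier ∩ Gs.carrier = {Gt.one}
  decomp : ∀ x ∈ Gt.carrier, ∃ u ∈ Gu'.carrier, ∃ z ∈ Zc.carrier, ∃ s ∈ Gs.carrier,
    x = Gt.mul u (Gt.mul z s)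
  levi_inter : {x | x ∈ Gu'.carrier ∧
      ∃ z ∈ Zc.carrier, ∃ s ∈ Gs.carrier, x = Gt.mul z s} = {Gt.one}
  /-- `q_G` restricts to an isomorphism `G_u' ≅ G_u` -/
  qG_Gu'_inj : Set.InjOn qG.toFun Gu'.carrier
  qG_Gu'_img : qG.toFun '' Gu'.carrier = LD.Gu.carrier
  /-- `q_G` restricts to an isomorphism `Z_c ≅ Z` -/
  qG_Zc_inj : Set.InjOn qG.toFun Zc.carrier
  qG_Zc_img : qG.toFun '' Zc.carrier = Z.carrier
  /-- `q_G` maps `G̃'_red` onto `[L, L]`, and `G̃'_red` is connected and simply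
  connected: it is the universal algebraic covering group of `[L, L]` -/
  qG_Gs_img : qG.toFun '' Gs.carrier = Lder.carrier
  Gs_connected : Gs.toGrp.IsConnected
  Gs_simplyConnected : ∀ γ : FundamentalGroup Gs.toGrp.Gp ⟨Gt.one, Gs.one_mem⟩, γ = 1
  /-- the kernel `Π_G` of the covering is finite and central -/
  ker_finite : {x ∈ Gt.carrier | qG.toFun x = G.one}.Finite
  ker_central : ∀ x ∈ Gt.carrier, qG.toFun x = G.one →
    ∀ y ∈ Gt.carrier, Gt.mul x y = Gt.mul y x

namespace CoveringData

variable {G : AffAlgGroup} {LD : LeviDecomposition G}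

/-- The kernel `Π_G` of the covering `q_G : G̃ → G`, as a subgroup of the point
group of `G̃`. -/
def PiG (CD : CoveringData G LD) : Subgroup CD.Gt.Gp := CD.qG.toGpHom.ker

/-- The fundamental group `π₁(G'_red)` of the derived group of the Levi
subgroup, realized as the kernel of `G̃'_red → G'_red`, a subgroup of `Π_G`. -/
def pi1Gs (CD : CoveringData G LD) : Subgroup CD.Gt.Gp where
  carrier := {x : CD.Gt.Gp | x.1 ∈ CD.Gs.carrier ∧ x ∈ CD.PiG}
  one_mem' := ⟨CD.Gs.one_mem, one_mem CD.PiG⟩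
  mul_mem' := fun hx hy => ⟨CD.Gs.mul_mem hx.1 hy.1, mul_mem hx.2 hy.2⟩
  inv_mem' := fun hx => ⟨CD.Gs.inv_mem hx.1, inv_mem hx.2⟩

lemma pi1Gs_le_PiG (CD : CoveringData G LD) : CD.pi1Gs ≤ CD.PiG := fun _ hx => hx.2

/-- `ext` is (equivalent to) the pushout extension `γ_* G̃ = (A × G̃)/Γ(γ)` of
`G` by `A` along `γ : Π_G → A`:  this is characterized by the existence of a
morphism `h : G̃ → E` over `G` restricting to `γ` on `Π_G`. -/
def IsPushoutOf (CD : CoveringData G LD) {A : AffAlgGroup} {ρ : AlgAction G A}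
    (γ : ↥CD.PiG →* A.Gp) (ext : AlgExtension G A ρ) : Prop :=
  ∃ h : AlgGroupHom CD.Gt ext.E,
    (∀ x ∈ CD.Gt.carrier, ext.q.toFun (h.toFun x) = CD.qG.toFun x) ∧
    (∀ x : ↥CD.PiG, h.toFun x.1.1 = ext.i.toFun (γ x).1)

end CoveringData

set_option linter.unusedSectionVars false

/-! ### Points of finitely generated complex algebras -/

theorem exists_complexPoint (R : Type) [CommRing R] [Algebra ℂ R] [Nontrivial R]
    [Algebra.FiniteType ℂ R] : Nonempty (R →ₐ[ℂ] ℂ) := by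
  obtain ⟨m, hm⟩ := Ideal.exists_maximal R
  let : Field (R ⧸ m) := Ideal.Quotient.field m
  have : Module.Finite ℂ (R ⧸ m) := finite_of_finite_type_of_isJacobsonRing ℂ (R ⧸ m)
  let e : ℂ ≃ₐ[ℂ] (R ⧸ m) := AlgEquiv.ofBijective (Algebra.ofId ℂ (R ⧸ m))
    IsAlgClosed.algebraMap_bijective_of_isIntegral
  exact ⟨e.symm.toAlgHom.comp (Ideal.Quotient.mkₐ ℂ m)⟩

/-- A nonzero element of a finitely generated domain is nonzero at some point. -/
theorem exists_complexPoint_ne_zero {R : Type} [CommRing R] [Algebra ℂ R] [IsDomain R]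
    [Algebra.FiniteType ℂ R] {r : R} (hr : r ≠ 0) : ∃ φ : R →ₐ[ℂ] ℂ, φ r ≠ 0 := by
  have : Nontrivial (Localization.Away r) :=
    (IsLocalization.injective (Localization.Away r)
      (powers_le_nonZeroDivisors_of_noZeroDivisors hr)).nontrivial
  have : Algebra.FiniteType ℂ (Localization.Away r) :=
    inferInstance
  obtain ⟨φ⟩ := exists_complexPoint (Localization.Away r)
  refine ⟨φ.comp (IsScalarTower.toAlgHom ℂ R _), ?_⟩
  exact ((IsLocalization.Away.algebraMap_isUnit (S := Localization.Away r) r).map φ).ne_zero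

/-- A maximal ideal of a finitely generated algebra is the kernel of a point. -/
theorem exists_complexPoint_of_ne_top {R : Type} [CommRing R] [Algebra ℂ R]
    [Algebra.FiniteType ℂ R] {J : Ideal R} (hJ : J ≠ ⊤) :
    ∃ φ : R →ₐ[ℂ] ℂ, ∀ r ∈ J, φ r = 0 := by
  have : Nontrivial (R ⧸ J) := Ideal.Quotient.nontrivial_iff.mpr hJ
  obtain ⟨φ⟩ := exists_complexPoint (R ⧸ J)
  refine ⟨φ.comp (Ideal.Quotient.mkₐ ℂ J), fun r hr => ?_⟩
  have : Ideal.Quotient.mkₐ ℂ J r = 0 := Ideal.Quotient.eq_zero_iff_mem.mpr hr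
  rw [AlgHom.comp_apply, this, map_zero]

theorem algHom_eq_of_vanish {R : Type} [CommRing R] [Algebra ℂ R] (φ ψ : R →ₐ[ℂ] ℂ)
    (h : ∀ r, φ r = 0 → ψ r = 0) : ψ = φ := by
  ext r
  have := h (r - algebraMap ℂ R (φ r)) (by simp)
  simpa [sub_eq_zero] using this

/-- Generic extension of points along an injection of finitely generated algebras. -/
theorem exists_ne_zero_forall_point_extends {B C : Type} [CommRing B] [CommRing C] [Algebra ℂ B]
    [Algebra ℂ C] [IsDomain B] [IsDomain C] [Algebra.FiniteType ℂ B] [Algebra.FiniteType ℂ C]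
    (j : B →ₐ[ℂ] C) (hj : Function.Injective j) :
    ∃ b : B, b ≠ 0 ∧ ∀ φ : B →ₐ[ℂ] ℂ, φ b ≠ 0 → ∃ ψ : C →ₐ[ℂ] ℂ, ψ.comp j = φ := by
  have : IsNoetherianRing B := Algebra.FiniteType.isNoetherianRing ℂ B
  have hft : j.toRingHom.FiniteType := by
    have h : ((j : B →+* C).comp (algebraMap ℂ B)).FiniteType := by
      rw [AlgHom.comp_algebraMap]
      exact RingHom.finiteType_algebraMap.mpr inferInstance
    exact RingHom.FiniteType.of_comp_finiteType h
  have hfp : j.toRingHom.FinitePresentation := RingHom.FinitePresentation.of_finiteType.mp hft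
  obtain ⟨S, hS⟩ := PrimeSpectrum.exists_constructibleSetData_iff.mpr
    (PrimeSpectrum.isConstructible_range_comap hfp)
  have hbot : (⊥ : PrimeSpectrum B) ∈ S.toSet := by
    rw [hS]
    refine ⟨⊥, ?_⟩
    ext x
    simp [hj.eq_iff' (map_zero j)]
  rw [PrimeSpectrum.ConstructibleSetData.toSet, Set.mem_iUnion₂] at hbot
  obtain ⟨D, hD, hmem⟩ := hbot
  have h1 : D.f ≠ 0 := by
    intro h
    apply hmem.2
    simp [h]
  have h2 : Set.range D.g ⊆ {0} := by
    intro x hx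
    simpa using hmem.1 hx
  refine ⟨D.f, h1, fun φ hφ => ?_⟩
  let P : PrimeSpectrum B := ⟨RingHom.ker φ, RingHom.ker_isPrime _⟩
  have hP : P ∈ Set.range (PrimeSpectrum.comap j.toRingHom) := by
    rw [← hS, PrimeSpectrum.ConstructibleSetData.toSet, Set.mem_iUnion₂]
    refine ⟨D, hD, ?_, ?_⟩
    · intro x hx
      have := h2 hx
      rw [Set.mem_singleton_iff] at this
      simp [this]
    · intro h
      exact hφ (by simpa [P, PrimeSpectrum.mem_zeroLocus] using h)
  obtain ⟨Q, hQ⟩ := hP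
  obtain ⟨ψ, hψ⟩ := exists_complexPoint_of_ne_top Q.2.ne_top
  refine ⟨ψ, algHom_eq_of_vanish φ _ fun r hr => hψ _ ?_⟩
  have : r ∈ (PrimeSpectrum.comap j.toRingHom Q).asIdeal := by
    rw [hQ]; exact hr
  exact this

theorem exists_eval_ne_zero_of_countable (s : ℕ) (f : ℕ → MvPolynomial (Fin s) ℂ)
    (hf : ∀ i, f i ≠ 0) : ∃ y : Fin s → ℂ, ∀ i, eval y (f i) ≠ 0 := by
  induction s with
  | zero =>
    refine ⟨0, fun i h => hf i ?_⟩
    rw [eq_C_of_isEmpty (f i)] at h ⊢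
    simp only [eval_C] at h
    rw [h, C_0]
  | succ s ih =>
    obtain ⟨y, hy⟩ := ih (fun i => (finSuccEquiv ℂ s (f i)).leadingCoeff) (fun i => by
      simpa using hf i)
    let g : ℕ → Polynomial ℂ := fun i => (finSuccEquiv ℂ s (f i)).map (eval y)
    have hg : ∀ i, g i ≠ 0 := by
      intro i h
      have := congrArg (fun p => Polynomial.coeff p (finSuccEquiv ℂ s (f i)).natDegree) h
      simp only [g, Polynomial.coeff_map, Polynomial.coeff_zero] at this
      exact hy i this
    have hc : (⋃ i, {x | (g i).IsRoot x}).Countable :=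
      Set.countable_iUnion fun i => (Polynomial.finite_setOfPred_isRoot (hg i)).countable
    obtain ⟨x, hx⟩ : ∃ x, x ∉ ⋃ i, {x | (g i).IsRoot x} := by
      by_contra! h
      exact not_countable_complex (hc.mono fun x _ => h x)
    refine ⟨Fin.cons x y, fun i hi => hx ?_⟩
    rw [eval_eq_eval_mv_eval'] at hi
    exact Set.mem_iUnion.mpr ⟨i, hi⟩

/-- Countably many nonzero elements of a finitely generated domain over `ℂ` are simultaneously
nonzero at some point. -/
theorem exists_complexPoint_forall_ne_zero {R : Type} [CommRing R] [Algebra ℂ R] [IsDomain R]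
    [Algebra.FiniteType ℂ R] (f : ℕ → R) (hf : ∀ i, f i ≠ 0) :
    ∃ φ : R →ₐ[ℂ] ℂ, ∀ i, φ (f i) ≠ 0 := by
  obtain ⟨s, g, hg, h_int⟩ := exists_integral_inj_algHom_of_fg ℂ R
  algebraize [g.toRingHom]
  have : Algebra.IsIntegral (MvPolynomial (Fin s) ℂ) R := ⟨h_int⟩
  have hdvd : ∀ i, ∃ p : MvPolynomial (Fin s) ℂ, p ≠ 0 ∧ f i ∣ g p := fun i =>
    (Algebra.IsAlgebraic.isAlgebraic (R := MvPolynomial (Fin s) ℂ) (f i)).exists_nonzero_dvd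
      (mem_nonZeroDivisors_of_ne_zero (hf i))
  choose p hp hpd using hdvd
  obtain ⟨y, hy⟩ := exists_eval_ne_zero_of_countable s p hp
  have hmax : (RingHom.ker (aeval y : MvPolynomial (Fin s) ℂ →ₐ[ℂ] ℂ)).IsPrime :=
    RingHom.ker_isPrime _
  obtain ⟨Q, hQ, hQc⟩ := Ideal.exists_ideal_over_prime_of_isIntegral_of_isDomain (S := R)
    (RingHom.ker (aeval y : MvPolynomial (Fin s) ℂ →ₐ[ℂ] ℂ)) (by
      have : RingHom.ker (algebraMap (MvPolynomial (Fin s) ℂ) R) = ⊥ :=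
        (RingHom.injective_iff_ker_eq_bot _).mp hg
      rw [this]; exact bot_le)
  obtain ⟨φ, hφ⟩ := exists_complexPoint_of_ne_top hQ.ne_top
  have hcomp : φ.comp g = aeval y := algHom_eq_of_vanish _ _ fun r hr => hφ _ (by
    have : r ∈ Q.comap (algebraMap (MvPolynomial (Fin s) ℂ) R) := by rw [hQc]; exact hr
    exact this)
  refine ⟨φ, fun i hi => hy i ?_⟩
  obtain ⟨c, hc⟩ := hpd i
  have h3 : φ (g (p i)) = aeval y (p i) := DFunLike.congr_fun hcomp (p i)
  rw [hc, map_mul, hi, zero_mul] at h3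
  rw [← coe_aeval_eq_eval]
  exact h3.symm

/-- An element of an extension of a field of characteristic zero which is not in the base field
has a distinct conjugate. -/
theorem exists_ne_conjugate {K Ω : Type} [Field K] [CharZero K] [Field Ω] [IsAlgClosed Ω]
    [Algebra K Ω] (h : Ω) (hh : h ∉ Set.range (algebraMap K Ω)) :
    ∃ h' : Ω, h' ≠ h ∧ ∀ p : Polynomial K, Polynomial.aeval h p = 0 ↔ Polynomial.aeval h' p = 0 := by
  by_cases hal : IsIntegral K h
  · have hsep : (minpoly K h).Separable := (minpoly.irreducible hal).separable
    have hdeg : (minpoly K h).natDegree ≠ 1 := fun hd => hh (by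
      rw [minpoly.natDegree_eq_one_iff] at hd; exact hd)
    have hcard := Polynomial.card_rootSet_eq_natDegree hsep
      (IsAlgClosed.splits ((minpoly K h).map (algebraMap K Ω)))
    have hpos := minpoly.natDegree_pos hal
    have : 1 < Fintype.card ((minpoly K h).rootSet Ω) := by omega
    obtain ⟨h', hne⟩ := Fintype.exists_ne_of_one_lt_card this
      ⟨h, by rw [Polynomial.mem_rootSet]; exact ⟨minpoly.ne_zero hal, minpoly.aeval K h⟩⟩
    have hroot := (Polynomial.mem_rootSet.mp h'.2).2
    have hmin : minpoly K h'.1 = minpoly K h :=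
      (minpoly.eq_of_irreducible_of_monic (minpoly.irreducible hal) hroot (minpoly.monic hal)).symm
    refine ⟨h', fun e => hne (Subtype.ext e), fun p => ?_⟩
    rw [← minpoly.dvd_iff, ← minpoly.dvd_iff, hmin]
  · refine ⟨h + 1, by simp, fun p => ?_⟩
    have ht : Transcendental K h := fun h2 => hal h2.isIntegral
    have ht' : Transcendental K (h + 1) := by
      intro h2
      have := h2.sub (isAlgebraic_one (R := K))
      rw [add_sub_cancel_right] at this
      exact ht this
    rw [transcendental_iff] at ht ht'
    exact ⟨fun e => by rw [ht p e, map_zero], fun e => by rw [ht' p e, map_zero]⟩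

theorem exists_injective_to_isAlgClosed (C : Type) [CommRing C] [IsDomain C] [Algebra ℂ C] :
    ∃ (Ω : Type) (_ : Field Ω) (_ : IsAlgClosed Ω) (_ : Algebra ℂ Ω) (ι : C →ₐ[ℂ] Ω),
      Function.Injective ι := by
  refine ⟨AlgebraicClosure (FractionRing C), inferInstance, inferInstance, inferInstance,
    IsScalarTower.toAlgHom ℂ C _, ?_⟩
  have h1 : Function.Injective (algebraMap C (FractionRing C)) := IsFractionRing.injective _ _
  have h2 := FaithfulSMul.algebraMap_injective (FractionRing C) (AlgebraicClosure (FractionRing C))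
  intro x y hxy
  apply h1
  apply h2
  rw [← IsScalarTower.algebraMap_apply, ← IsScalarTower.algebraMap_apply]
  exact hxy

/-- An element of `C` constant on the fibres over `B` is a fraction of elements of `B`. -/
theorem exists_mul_mem_of_constant_on_fibres {B C : Type} [CommRing B] [CommRing C] [Algebra ℂ B]
    [Algebra ℂ C] [IsDomain B] [IsDomain C] [Algebra.FiniteType ℂ B] [Algebra.FiniteType ℂ C]
    (j : B →ₐ[ℂ] C) (hj : Function.Injective j) (h : C)
    (hc : ∀ φ φ' : C →ₐ[ℂ] ℂ, φ.comp j = φ'.comp j → φ h = φ' h) :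
    ∃ b : B, b ≠ 0 ∧ ∃ b' : B, j b * h = j b' := by
  obtain ⟨Ω, _, _, _, ι, hι⟩ := exists_injective_to_isAlgClosed C
  let ij : B →ₐ[ℂ] Ω := ι.comp j
  have hij : Function.Injective ij := hι.comp hj
  let _ : Algebra B Ω := ij.toRingHom.toAlgebra
  have hst : IsScalarTower ℂ B Ω := IsScalarTower.of_algebraMap_eq fun r => (ij.commutes r).symm
  have hfaith : FaithfulSMul B Ω := (faithfulSMul_iff_algebraMap_injective B Ω).mpr hij
  let _ : Algebra (FractionRing B) Ω := FractionRing.liftAlgebra B Ω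
  have hst2 : IsScalarTower B (FractionRing B) Ω := FractionRing.isScalarTower_liftAlgebra B Ω
  have hch : CharZero (FractionRing B) := charZero_of_injective_algebraMap
    (algebraMap ℂ (FractionRing B)).injective
  by_cases hmem : ι h ∈ Set.range (algebraMap (FractionRing B) Ω)
  · obtain ⟨x, hx⟩ := hmem
    obtain ⟨b', b, hb, rfl⟩ := IsFractionRing.div_surjective (A := B) x
    refine ⟨b, nonZeroDivisors.ne_zero hb, b', hι ?_⟩
    have hb0 : algebraMap B Ω b ≠ 0 := (map_ne_zero_iff _ hij).mpr (nonZeroDivisors.ne_zero hb)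
    rw [map_div₀, ← IsScalarTower.algebraMap_apply, ← IsScalarTower.algebraMap_apply,
      div_eq_iff hb0] at hx
    rw [map_mul, mul_comm]
    exact hx.symm
  exfalso
  obtain ⟨h', hne, hconj⟩ := exists_ne_conjugate (ι h) hmem
  have hconjB : ∀ p : Polynomial B, Polynomial.aeval (ι h) p = 0 ↔ Polynomial.aeval h' p = 0 := by
    intro p
    have := hconj (p.map (algebraMap B (FractionRing B)))
    rwa [Polynomial.aeval_map_algebraMap, Polynomial.aeval_map_algebraMap] at this
  let _ : Algebra B C := j.toRingHom.toAlgebra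
  have : IsScalarTower ℂ B C := IsScalarTower.of_algebraMap_eq fun r => (j.commutes r).symm
  let _ : Algebra C Ω := ι.toRingHom.toAlgebra
  have : IsScalarTower B C Ω := IsScalarTower.of_algebraMap_eq fun r => rfl
  let f : Polynomial B →ₐ[ℂ] C := (Polynomial.aeval h : Polynomial B →ₐ[B] C).restrictScalars ℂ
  have hf : ∀ p, ι (f p) = Polynomial.aeval (ι h) p := fun p =>
    (Polynomial.aeval_algebraMap_apply Ω h p).symm
  let D := Polynomial B ⧸ RingHom.ker f
  have : (RingHom.ker f).IsPrime := RingHom.ker_isPrime f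
  have : Algebra.FiniteType ℂ (Polynomial B) :=
    Algebra.FiniteType.trans (S := B) inferInstance inferInstance
  obtain ⟨d, hd, hext⟩ := exists_ne_zero_forall_point_extends (B := D) (Ideal.kerLiftAlg f)
    (Ideal.kerLiftAlg_injective f)
  obtain ⟨p, rfl⟩ := Ideal.Quotient.mk_surjective d
  have hp : Polynomial.aeval (ι h) p ≠ 0 := by
    rw [← hf]
    intro h0
    apply hd
    rw [Ideal.Quotient.eq_zero_iff_mem, RingHom.mem_ker]
    exact hι (by rw [h0, map_zero])
  have hp' : Polynomial.aeval h' p ≠ 0 := fun h0 => hp ((hconjB p).mpr h0)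
  let Φ : MvPolynomial (Fin 2) B →ₐ[ℂ] Ω :=
    (aeval ![ι h, h'] : MvPolynomial (Fin 2) B →ₐ[B] Ω).restrictScalars ℂ
  have : Algebra.FiniteType ℂ (MvPolynomial (Fin 2) B) :=
    Algebra.FiniteType.trans (S := B) inferInstance inferInstance
  let emb : Fin 2 → Polynomial B →ₐ[ℂ] MvPolynomial (Fin 2) B := fun k =>
    (Polynomial.aeval (X k) : Polynomial B →ₐ[B] MvPolynomial (Fin 2) B).restrictScalars ℂ
  have hΦ : ∀ k q, Φ (emb k q) = Polynomial.aeval (![ι h, h'] k) q := by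
    intro k q
    have := Polynomial.aeval_algHom_apply
      (aeval ![ι h, h'] : MvPolynomial (Fin 2) B →ₐ[B] Ω) (X k) q
    rw [aeval_X] at this
    exact this.symm
  have : Algebra.FiniteType ℂ Φ.range :=
    Algebra.FiniteType.of_surjective Φ.rangeRestrict Φ.rangeRestrict_surjective
  obtain ⟨θ, hθ⟩ := exists_complexPoint_ne_zero (R := Φ.range)
    (r := Φ.rangeRestrict (emb 0 p * emb 1 p * (X 1 - X 0))) (by
      intro h0
      have h1 := congrArg Subtype.val h0
      have h2 : Φ (emb 0 p * emb 1 p * (X 1 - X 0)) = 0 := h1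
      rw [map_mul, map_mul, hΦ, hΦ, map_sub] at h2
      have h3 : Φ (X 1) = h' := by simp [Φ]
      have h4 : Φ (X 0) = ι h := by simp [Φ]
      rw [h3, h4] at h2
      exact mul_ne_zero (mul_ne_zero hp hp') (sub_ne_zero.mpr hne) h2)
  have hker : ∀ k, ∀ q ∈ RingHom.ker f, (θ.comp Φ.rangeRestrict).comp (emb k) q = 0 := by
    intro k q hq
    have h0 : Polynomial.aeval (ι h) q = 0 := by rw [← hf, (RingHom.mem_ker).mp hq, map_zero]
    have h1 : Φ (emb k q) = 0 := by
      rw [hΦ]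
      fin_cases k
      · exact h0
      · exact (hconjB q).mp h0
    have h2 : Φ.rangeRestrict (emb k q) = 0 := Subtype.ext h1
    rw [AlgHom.comp_apply, AlgHom.comp_apply, h2, map_zero]
  rw [map_mul, map_mul, map_mul, map_mul] at hθ
  have hpt : ∀ k, ∃ ψ : C →ₐ[ℂ] ℂ, ∀ q, ψ (f q) = θ (Φ.rangeRestrict (emb k q)) := by
    intro k
    obtain ⟨ψ, hψ⟩ := hext (Ideal.Quotient.liftₐ _ ((θ.comp Φ.rangeRestrict).comp (emb k)) (hker k))
      (by
        change θ (Φ.rangeRestrict (emb k p)) ≠ 0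
        fin_cases k
        · exact left_ne_zero_of_mul (left_ne_zero_of_mul hθ)
        · exact right_ne_zero_of_mul (left_ne_zero_of_mul hθ))
    exact ⟨ψ, fun q => DFunLike.congr_fun hψ (Ideal.Quotient.mk _ q)⟩
  obtain ⟨ψ₀, h₀⟩ := hpt 0
  obtain ⟨ψ₁, h₁⟩ := hpt 1
  have hemb : ∀ k b, emb k (Polynomial.C b) = MvPolynomial.C b := by
    intro k b
    simp [emb, algebraMap_eq]
  have hfC : ∀ b, f (Polynomial.C b) = j b := by
    intro b
    simp only [f, AlgHom.restrictScalars_apply, Polynomial.aeval_C]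
    rfl
  have hagree := hc ψ₀ ψ₁ (by
    ext b
    simp only [AlgHom.comp_apply]
    rw [← hfC, h₀, h₁, hemb, hemb])
  have hfX : f Polynomial.X = h := by simp [f]
  rw [← hfX, h₀, h₁] at hagree
  apply right_ne_zero_of_mul hθ
  rw [map_sub, map_sub, sub_eq_zero]
  simpa [emb] using hagree.symm

/-! ### Affine varieties with their classical topology -/

/-- An affine variety over `ℂ`, presented by its set of points with the classical topology and
its algebra of regular functions. -/
class AffVar (X : Type) [TopologicalSpace X] where
  O : Subalgebra ℂ (X → ℂ)
  fg : O.FG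
  inducing : Topology.IsInducing (fun (x : X) (f : O) => f.1 x)
  pts : ∀ φ : O →ₐ[ℂ] ℂ, ∃ x, ∀ f : O, φ f = f.1 x
  sep : ∀ x y, (∀ f ∈ O, f x = f y) → x = y

/-- The algebra of regular functions. -/
abbrev RegFun (X : Type) [TopologicalSpace X] [AffVar X] : Subalgebra ℂ (X → ℂ) := AffVar.O

/-- Regular maps between affine varieties. -/
def IsReg {X Y : Type} [TopologicalSpace X] [AffVar X] [TopologicalSpace Y] [AffVar Y]
    (f : X → Y) : Prop :=
  ∀ h ∈ RegFun Y, h ∘ f ∈ RegFun X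

namespace AffVar

section Basic

variable {X : Type} [TopologicalSpace X] [AffVar X] {Y : Type} [TopologicalSpace Y] [AffVar Y]
  {W : Type} [TopologicalSpace W] [AffVar W]

instance : Algebra.FiniteType ℂ (RegFun X) := (Subalgebra.fg_iff_finiteType _).mp fg

instance : IsNoetherianRing (RegFun X) := Algebra.FiniteType.isNoetherianRing ℂ _

theorem continuous_of_mem {f : X → ℂ} (hf : f ∈ RegFun X) : Continuous f :=
  (continuous_apply (⟨f, hf⟩ : RegFun X)).comp inducing.continuous

theorem _root_.IsReg.continuous {f : X → Y} (hf : IsReg f) : Continuous f := by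
  rw [(inducing (X := Y)).continuous_iff, continuous_pi_iff]
  exact fun h => continuous_of_mem (hf h.1 h.2)

theorem _root_.IsReg.comp {g : Y → W} {f : X → Y} (hg : IsReg g) (hf : IsReg f) : IsReg (g ∘ f) :=
  fun h hh => hf _ (hg h hh)

theorem _root_.IsReg.id : IsReg (id : X → X) := fun _ hh => hh

theorem _root_.IsReg.const (y : Y) : IsReg (fun _ : X => y) := fun h _ =>
  (RegFun X).algebraMap_mem (h y)

/-- The homomorphism on regular functions induced by a regular map. -/
def pullback (f : X → Y) (hf : IsReg f) : RegFun Y →ₐ[ℂ] RegFun X where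
  toFun h := ⟨h.1 ∘ f, hf h.1 h.2⟩
  map_one' := rfl
  map_mul' _ _ := rfl
  map_zero' := rfl
  map_add' _ _ := rfl
  commutes' _ := rfl

/-- Evaluation at a point. -/
def evalAt (x : X) : RegFun X →ₐ[ℂ] ℂ := (Pi.evalAlgHom ℂ (fun _ : X => ℂ) x).comp (RegFun X).val

@[simp] theorem evalAt_apply (x : X) (f : RegFun X) : evalAt x f = f.1 x := rfl

theorem isReg_of_adjoin {f : X → Y} (S : Set (Y → ℂ)) (hS : RegFun Y = Algebra.adjoin ℂ S)
    (h : ∀ s ∈ S, s ∘ f ∈ RegFun X) : IsReg f := by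
  intro g hg
  rw [hS] at hg
  induction hg using Algebra.adjoin_induction with
  | mem x hx => exact h x hx
  | algebraMap r => exact (RegFun X).algebraMap_mem r
  | add x y _ _ hx hy => exact (RegFun X).add_mem hx hy
  | mul x y _ _ hx hy => exact (RegFun X).mul_mem hx hy

/-- Coordinates present the variety as a closed subset of an affine space. -/
theorem exists_isClosedEmbedding (X : Type) [TopologicalSpace X] [AffVar X] :
    ∃ (S : Finset (X → ℂ)), RegFun X = Algebra.adjoin ℂ S ∧
      Topology.IsClosedEmbedding (fun (x : X) (s : S) => s.1 x) ∧
      ∀ y : S → ℂ, (∀ p : MvPolynomial S ℂ, (∀ x : X, eval (fun s : S => s.1 x) p = 0) →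
        eval y p = 0) → ∃ x : X, (fun s : S => s.1 x) = y := by
  obtain ⟨S, hS⟩ := fg (X := X)
  let e : X → S → ℂ := fun x s => s.1 x
  have hSO : ∀ s ∈ S, s ∈ RegFun X := fun s hs => by
    rw [RegFun, ← hS]; exact Algebra.subset_adjoin hs
  have hval : ∀ (p : MvPolynomial S ℂ) (x : X),
      (aeval (fun s : S => s.1) p : X → ℂ) x = eval (e x) p := by
    intro p x
    have := comp_aeval_apply (fun s : S => s.1) (Pi.evalAlgHom ℂ (fun _ : X => ℂ) x) p
    exact this.trans (DFunLike.congr_fun (coe_aeval_eq_eval (e x)) p)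
  have hpoly : ∀ f ∈ RegFun X, ∃ p : MvPolynomial S ℂ, ∀ x, f x = eval (e x) p := by
    intro f hf
    rw [RegFun, ← hS] at hf
    have h2 : f ∈ (aeval (fun s : S => s.1) : MvPolynomial S ℂ →ₐ[ℂ] (X → ℂ)).range := by
      rw [← Algebra.adjoin_range_eq_range_aeval]
      simpa using hf
    obtain ⟨p, rfl⟩ := h2
    exact ⟨p, hval p⟩
  have hcont : Continuous e := continuous_pi fun s => continuous_of_mem (hSO s.1 s.2)
  have hind : Topology.IsInducing e := by
    refine ⟨le_antisymm (continuous_iff_le_induced.mp hcont) ?_⟩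
    rw [(inducing (X := X)).eq_induced]
    rw [← continuous_iff_le_induced]
    let _ := TopologicalSpace.induced e inferInstance
    refine continuous_pi fun f => ?_
    obtain ⟨p, hp⟩ := hpoly f.1 f.2
    have : (fun x => f.1 x) = (fun y => eval y p) ∘ e := funext hp
    rw [this]
    exact (MvPolynomial.continuous_eval p).comp continuous_induced_dom
  have hinj : Function.Injective e := by
    intro x y hxy
    refine sep x y fun f hf => ?_
    obtain ⟨p, hp⟩ := hpoly f hf
    rw [hp, hp, hxy]
  have hpts : ∀ y : S → ℂ, (∀ p : MvPolynomial S ℂ, (∀ x : X, eval (e x) p = 0) →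
        eval y p = 0) → ∃ x : X, e x = y := by
    intro y hy
    let ev : MvPolynomial S ℂ →ₐ[ℂ] RegFun X := aeval fun s : S => (⟨s.1, hSO s.1 s.2⟩ : RegFun X)
    have hev : ∀ p x, (ev p).1 x = eval (e x) p := by
      intro p x
      rw [← hval]
      have := comp_aeval_apply (fun s : S => (⟨s.1, hSO s.1 s.2⟩ : RegFun X)) (RegFun X).val p
      exact congrFun this x
    have hsurj : Function.Surjective ev := by
      intro f
      obtain ⟨p, hp⟩ := hpoly f.1 f.2
      exact ⟨p, Subtype.ext (funext fun x => by rw [hev, hp])⟩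
    have hker : ∀ p, ev p = 0 → (aeval y : MvPolynomial S ℂ →ₐ[ℂ] ℂ) p = 0 := by
      intro p hp
      rw [show (aeval y : MvPolynomial S ℂ →ₐ[ℂ] ℂ) p = eval y p from
        DFunLike.congr_fun (coe_aeval_eq_eval y) p]
      refine hy p fun x => ?_
      rw [← hev, hp]
      rfl
    let φ : RegFun X →ₐ[ℂ] ℂ := (Ideal.Quotient.liftₐ (RingHom.ker ev) (aeval y) hker).comp
      (Ideal.quotientKerAlgEquivOfSurjective hsurj).symm.toAlgHom
    have hφ : ∀ p, φ (ev p) = eval y p := by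
      intro p
      have h1 : (Ideal.quotientKerAlgEquivOfSurjective hsurj).symm (ev p)
          = Ideal.Quotient.mk (RingHom.ker ev) p := by
        rw [AlgEquiv.symm_apply_eq]; rfl
      change Ideal.Quotient.liftₐ (RingHom.ker ev) (aeval y) hker
        ((Ideal.quotientKerAlgEquivOfSurjective hsurj).symm (ev p)) = _
      rw [h1]
      exact DFunLike.congr_fun (coe_aeval_eq_eval y) p
    obtain ⟨x, hx⟩ := pts φ
    refine ⟨x, funext fun s => ?_⟩
    have h1 := hφ (MvPolynomial.X s)
    rw [hx, hev, eval_X, eval_X] at h1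
    exact h1
  refine ⟨S, hS.symm, ⟨⟨hind, hinj⟩, ?_⟩, hpts⟩
  have : Set.range e = ⋂ p ∈ {p : MvPolynomial S ℂ | ∀ x : X, eval (e x) p = 0},
      {y | eval y p = 0} := by
    ext y
    simp only [Set.mem_range, Set.mem_ofPred_eq, Set.mem_iInter]
    constructor
    · rintro ⟨x, rfl⟩ p hp
      exact hp x
    · exact hpts y
  change IsClosed (Set.range e)
  rw [this]
  exact isClosed_biInter fun p _ => isClosed_eq (MvPolynomial.continuous_eval p) continuous_const

theorem t2Space (X : Type) [TopologicalSpace X] [AffVar X] : T2Space X := by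
  obtain ⟨S, -, h, -⟩ := exists_isClosedEmbedding X
  exact h.isEmbedding.t2Space

theorem locallyCompactSpace (X : Type) [TopologicalSpace X] [AffVar X] : LocallyCompactSpace X := by
  obtain ⟨S, -, h, -⟩ := exists_isClosedEmbedding X
  exact h.locallyCompactSpace

theorem secondCountableTopology (X : Type) [TopologicalSpace X] [AffVar X] :
    SecondCountableTopology X := by
  obtain ⟨S, -, h, -⟩ := exists_isClosedEmbedding X
  exact h.isEmbedding.secondCountableTopology

theorem sigmaCompactSpace (X : Type) [TopologicalSpace X] [AffVar X] : SigmaCompactSpace X := by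
  obtain ⟨S, -, h, -⟩ := exists_isClosedEmbedding X
  exact h.sigmaCompactSpace

theorem topology_eq_iInf (X : Type) [inst : TopologicalSpace X] [AffVar X] :
    inst = ⨅ f : RegFun X, TopologicalSpace.induced f.1 inferInstance :=
  (inducing (X := X)).eq_induced.trans (induced_to_pi _)

theorem inducing_of {X : Type} [inst : TopologicalSpace X] (O : Subalgebra ℂ (X → ℂ))
    (S : Set (X → ℂ)) (hO : O = Algebra.adjoin ℂ S) (hc : ∀ s ∈ S, Continuous s)
    (h : ⨅ s : S, TopologicalSpace.induced s.1 inferInstance ≤ inst) :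
    Topology.IsInducing (fun (x : X) (f : O) => f.1 x) := by
  refine ⟨le_antisymm (continuous_iff_le_induced.mp ?_) ?_⟩
  · refine continuous_pi fun ⟨f, hf⟩ => ?_
    change Continuous f
    rw [hO] at hf
    clear hO
    induction hf using Algebra.adjoin_induction with
    | mem x hx => exact hc x hx
    | algebraMap r => exact continuous_const
    | add x y _ _ hx hy => exact hx.add hy
    | mul x y _ _ hx hy => exact hx.mul hy
  · rw [induced_to_pi]
    refine le_trans (le_iInf fun s => ?_) h
    exact iInf_le (fun f : O => TopologicalSpace.induced (fun x => f.1 x) inferInstance)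
      ⟨s.1, hO ▸ Algebra.subset_adjoin s.2⟩

/-- Affine varieties presented by generators of the algebra of regular functions. -/
abbrev ofGenerators {X : Type} [inst : TopologicalSpace X] (S : Set (X → ℂ))
    (fg : (Algebra.adjoin ℂ S).FG) (hc : ∀ s ∈ S, Continuous s)
    (htop : ⨅ s : S, TopologicalSpace.induced s.1 inferInstance ≤ inst)
    (pts : ∀ φ : Algebra.adjoin ℂ S →ₐ[ℂ] ℂ, ∃ x, ∀ s (hs : s ∈ S),
      φ ⟨s, Algebra.subset_adjoin hs⟩ = s x)
    (sep : ∀ x y, (∀ s ∈ S, s x = s y) → x = y) : AffVar X where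
  O := Algebra.adjoin ℂ S
  fg := fg
  inducing := inducing_of _ S rfl hc htop
  pts := by
    intro φ
    obtain ⟨x, hx⟩ := pts φ
    refine ⟨x, fun ⟨F, hF⟩ => ?_⟩
    induction hF using Algebra.adjoin_induction with
    | mem F hF => exact hx F hF
    | algebraMap r => exact φ.commutes r
    | add F G hF hG h1 h2 =>
      have : (⟨F + G, Subalgebra.add_mem _ hF hG⟩ : Algebra.adjoin ℂ S) =
        ⟨F, hF⟩ + ⟨G, hG⟩ := rfl
      rw [this, map_add, h1, h2]
      rfl
    | mul F G hF hG h1 h2 =>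
      have : (⟨F * G, Subalgebra.mul_mem _ hF hG⟩ : Algebra.adjoin ℂ S) =
        ⟨F, hF⟩ * ⟨G, hG⟩ := rfl
      rw [this, map_mul, h1, h2]
      rfl
  sep x y h := sep x y fun s hs => h s (Algebra.subset_adjoin hs)

end Basic

section Instances

variable {X : Type} [TopologicalSpace X] [AffVar X] {Y : Type} [TopologicalSpace Y] [AffVar Y]
  {W : Type} [TopologicalSpace W] [AffVar W]

/-- Regular functions on a product coming from the two factors. -/
def prodGens (X Y : Type) [TopologicalSpace X] [AffVar X] [TopologicalSpace Y] [AffVar Y] :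
    Set (X × Y → ℂ) :=
  {F | ∃ f ∈ RegFun X, F = f ∘ Prod.fst} ∪ {F | ∃ f ∈ RegFun Y, F = f ∘ Prod.snd}

instance instProd : AffVar (X × Y) := by
  refine ofGenerators (prodGens X Y) ?_ ?_ ?_ ?_ ?_
  · obtain ⟨S, hS⟩ := fg (X := X)
    obtain ⟨T, hT⟩ := fg (X := Y)
    have h : Algebra.adjoin ℂ (prodGens X Y) =
        Algebra.adjoin ℂ ((fun f : X → ℂ => f ∘ (Prod.fst : X × Y → X)) '' (S : Set (X → ℂ)) ∪
          (fun f : Y → ℂ => f ∘ (Prod.snd : X × Y → Y)) '' (T : Set (Y → ℂ))) := by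
      apply le_antisymm
      · refine Algebra.adjoin_le ?_
        rintro F (⟨f, hf, rfl⟩ | ⟨f, hf, rfl⟩)
        · rw [RegFun, ← hS] at hf
          induction hf using Algebra.adjoin_induction with
          | mem x hx => exact Algebra.subset_adjoin (Or.inl ⟨x, hx, rfl⟩)
          | algebraMap r => exact Subalgebra.algebraMap_mem _ r
          | add x y _ _ hx hy => exact Subalgebra.add_mem _ hx hy
          | mul x y _ _ hx hy => exact Subalgebra.mul_mem _ hx hy
        · rw [RegFun, ← hT] at hf
          induction hf using Algebra.adjoin_induction with
          | mem x hx => exact Algebra.subset_adjoin (Or.inr ⟨x, hx, rfl⟩)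
          | algebraMap r => exact Subalgebra.algebraMap_mem _ r
          | add x y _ _ hx hy => exact Subalgebra.add_mem _ hx hy
          | mul x y _ _ hx hy => exact Subalgebra.mul_mem _ hx hy
      · refine Algebra.adjoin_mono ?_
        rintro F (⟨f, hf, rfl⟩ | ⟨f, hf, rfl⟩)
        · exact Or.inl ⟨f, by rw [RegFun, ← hS]; exact Algebra.subset_adjoin hf, rfl⟩
        · exact Or.inr ⟨f, by rw [RegFun, ← hT]; exact Algebra.subset_adjoin hf, rfl⟩
    rw [h]
    exact Subalgebra.fg_def.mpr
      ⟨_, (S.finite_toSet.image _).union (T.finite_toSet.image _), rfl⟩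
  · rintro F (⟨f, hf, rfl⟩ | ⟨f, hf, rfl⟩)
    · exact (continuous_of_mem hf).comp continuous_fst
    · exact (continuous_of_mem hf).comp continuous_snd
  · refine le_inf ?_ ?_
    · refine le_trans ?_ (congrArg (TopologicalSpace.induced Prod.fst)
        (topology_eq_iInf X)).ge
      rw [induced_iInf]
      refine le_iInf fun f => ?_
      rw [induced_compose]
      exact iInf_le_of_le ⟨f.1 ∘ Prod.fst, Or.inl ⟨f.1, f.2, rfl⟩⟩ le_rfl
    · refine le_trans ?_ (congrArg (TopologicalSpace.induced Prod.snd)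
        (topology_eq_iInf Y)).ge
      rw [induced_iInf]
      refine le_iInf fun f => ?_
      rw [induced_compose]
      exact iInf_le_of_le ⟨f.1 ∘ Prod.snd, Or.inr ⟨f.1, f.2, rfl⟩⟩ le_rfl
  · intro φ
    let fst' : RegFun X →ₐ[ℂ] Algebra.adjoin ℂ (prodGens X Y) :=
      { toFun := fun h => ⟨h.1 ∘ Prod.fst, Algebra.subset_adjoin (Or.inl ⟨h.1, h.2, rfl⟩)⟩
        map_one' := rfl
        map_mul' := fun _ _ => rfl
        map_zero' := rfl
        map_add' := fun _ _ => rfl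
        commutes' := fun _ => rfl }
    let snd' : RegFun Y →ₐ[ℂ] Algebra.adjoin ℂ (prodGens X Y) :=
      { toFun := fun h => ⟨h.1 ∘ Prod.snd, Algebra.subset_adjoin (Or.inr ⟨h.1, h.2, rfl⟩)⟩
        map_one' := rfl
        map_mul' := fun _ _ => rfl
        map_zero' := rfl
        map_add' := fun _ _ => rfl
        commutes' := fun _ => rfl }
    obtain ⟨x, hx⟩ := pts (φ.comp fst')
    obtain ⟨y, hy⟩ := pts (φ.comp snd')
    refine ⟨(x, y), ?_⟩
    rintro F (⟨f, hf, rfl⟩ | ⟨f, hf, rfl⟩)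
    · exact hx ⟨f, hf⟩
    · exact hy ⟨f, hf⟩
  · rintro ⟨x, y⟩ ⟨x', y'⟩ h
    refine Prod.ext (sep _ _ fun f hf => ?_) (sep _ _ fun f hf => ?_)
    · exact h _ (Or.inl ⟨f, hf, rfl⟩)
    · exact h _ (Or.inr ⟨f, hf, rfl⟩)

theorem _root_.IsReg.fst : IsReg (Prod.fst : X × Y → X) := fun f hf =>
  Algebra.subset_adjoin (Or.inl ⟨f, hf, rfl⟩)

theorem _root_.IsReg.snd : IsReg (Prod.snd : X × Y → Y) := fun f hf =>
  Algebra.subset_adjoin (Or.inr ⟨f, hf, rfl⟩)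

theorem _root_.IsReg.prodMk {f : W → X} {g : W → Y} (hf : IsReg f) (hg : IsReg g) :
    IsReg (fun w => (f w, g w)) := by
  refine isReg_of_adjoin (prodGens X Y) rfl ?_
  rintro F (⟨h, hh, rfl⟩ | ⟨h, hh, rfl⟩)
  · exact hf h hh
  · exact hg h hh

instance instComplex : AffVar ℂ := by
  refine ofGenerators {id} (Subalgebra.fg_def.mpr ⟨{id}, Set.finite_singleton _, rfl⟩) ?_ ?_ ?_ ?_
  · rintro F rfl
    exact continuous_id
  · exact (iInf_le _ (⟨id, rfl⟩ : ({id} : Set (ℂ → ℂ)))).trans_eq induced_id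
  · exact fun φ => ⟨φ ⟨id, Algebra.subset_adjoin rfl⟩, by rintro s rfl; rfl⟩
  · exact fun x y h => h id rfl

theorem isReg_complex_iff {f : X → ℂ} : IsReg f ↔ f ∈ RegFun X :=
  ⟨fun h => h id (Algebra.subset_adjoin rfl), fun h => isReg_of_adjoin {id} rfl (by
    rintro s rfl
    exact h)⟩

end Instances

end AffVar

namespace AffVar

/-- Precomposition as a homomorphism of function algebras. -/
def precomp {X Y : Type} (e : X → Y) : (Y → ℂ) →ₐ[ℂ] (X → ℂ) :=
  AlgHom.pi fun x => Pi.evalAlgHom ℂ _ (e x)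

/-- The affine variety structure induced by an embedding with Zariski closed image. -/
abbrev ofMap {X Y : Type} [inst : TopologicalSpace X] [TopologicalSpace Y] [AffVar Y] (e : X → Y)
    (hi : Topology.IsInducing e) (hinj : Function.Injective e)
    (hcl : ∀ y, (∀ f ∈ RegFun Y, (∀ x, f (e x) = 0) → f y = 0) → ∃ x, e x = y) : AffVar X where
  O := (RegFun Y).map (precomp e)
  fg := fg.map _
  inducing := by
    refine inducing_of _ ((RegFun Y).map (precomp e) : Set (X → ℂ)) (by
      rw [Algebra.adjoin_eq]) ?_ ?_
    · rintro _ ⟨f, hf, rfl⟩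
      exact (continuous_of_mem hf).comp hi.continuous
    · refine le_trans ?_ (hi.eq_induced.trans (congrArg (TopologicalSpace.induced e)
        (topology_eq_iInf Y))).ge
      rw [induced_iInf]
      refine le_iInf fun f => ?_
      rw [induced_compose]
      exact iInf_le_of_le ⟨f.1 ∘ e, f.1, f.2, rfl⟩ le_rfl
  pts := by
    intro φ
    let r : RegFun Y →ₐ[ℂ] (RegFun Y).map (precomp e) :=
      ((precomp e).comp (RegFun Y).val).codRestrict _ fun f => ⟨f.1, f.2, rfl⟩
    obtain ⟨y, hy⟩ := pts (φ.comp r)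
    obtain ⟨x, rfl⟩ := hcl y fun f hf h0 => by
      have h1 := hy ⟨f, hf⟩
      have h2 : r ⟨f, hf⟩ = 0 := Subtype.ext (funext h0)
      rw [AlgHom.comp_apply, h2, map_zero] at h1
      exact h1.symm
    refine ⟨x, ?_⟩
    rintro ⟨_, f, hf, rfl⟩
    exact hy ⟨f, hf⟩
  sep x y h := hinj (sep _ _ fun f hf => h _ ⟨f, hf, rfl⟩)

section Pi

variable {ι : Type} [Fintype ι] {X : Type} [TopologicalSpace X] [AffVar X]

instance instPi : AffVar (ι → X) := by
  refine ofGenerators {F | ∃ (i : ι), ∃ f ∈ RegFun X, F = fun x => f (x i)} ?_ ?_ ?_ ?_ ?_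
  · obtain ⟨S, hS⟩ := fg (X := X)
    refine Subalgebra.fg_def.mpr ⟨⋃ i : ι, (fun (f : X → ℂ) (x : ι → X) => f (x i)) '' S,
      Set.finite_iUnion fun i => S.finite_toSet.image _, le_antisymm ?_ ?_⟩
    · refine Algebra.adjoin_mono ?_
      rintro F hF
      obtain ⟨i, f, hf, rfl⟩ := Set.mem_iUnion.mp hF
      exact ⟨i, f, by rw [RegFun, ← hS]; exact Algebra.subset_adjoin hf, rfl⟩
    · refine Algebra.adjoin_le ?_
      rintro F ⟨i, f, hf, rfl⟩
      rw [RegFun, ← hS] at hf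
      induction hf using Algebra.adjoin_induction with
      | mem x hx => exact Algebra.subset_adjoin (Set.mem_iUnion.mpr ⟨i, x, hx, rfl⟩)
      | algebraMap r => exact Subalgebra.algebraMap_mem _ r
      | add x y _ _ hx hy => exact Subalgebra.add_mem _ hx hy
      | mul x y _ _ hx hy => exact Subalgebra.mul_mem _ hx hy
  · rintro F ⟨i, f, hf, rfl⟩
    exact (continuous_of_mem hf).comp (continuous_apply i)
  · refine le_iInf fun i => ?_
    refine le_trans ?_ (congrArg (TopologicalSpace.induced (fun x : ι → X => x i))
        (topology_eq_iInf X)).ge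
    rw [induced_iInf]
    refine le_iInf fun f => ?_
    rw [induced_compose]
    exact iInf_le_of_le ⟨fun x => f.1 (x i), i, f.1, f.2, rfl⟩ le_rfl
  · intro φ
    let r : ι → RegFun X →ₐ[ℂ] Algebra.adjoin ℂ {F : (ι → X) → ℂ | ∃ (i : ι), ∃ f ∈ RegFun X,
        F = fun x => f (x i)} := fun i =>
      ((precomp (fun x : ι → X => x i)).comp (RegFun X).val).codRestrict _ fun f =>
        Algebra.subset_adjoin ⟨i, f.1, f.2, rfl⟩
    choose x hx using fun i => pts (φ.comp (r i))
    refine ⟨x, ?_⟩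
    rintro F ⟨i, f, hf, rfl⟩
    exact hx i ⟨f, hf⟩
  · intro x y h
    exact funext fun i => sep _ _ fun f hf => h _ ⟨i, f, hf, rfl⟩

theorem _root_.IsReg.apply (i : ι) : IsReg (fun x : ι → X => x i) := fun f hf =>
  Algebra.subset_adjoin ⟨i, f, hf, rfl⟩

theorem _root_.IsReg.pi {W : Type} [TopologicalSpace W] [AffVar W] {f : W → ι → X}
    (h : ∀ i, IsReg (fun w => f w i)) : IsReg f := by
  refine isReg_of_adjoin _ rfl ?_
  rintro F ⟨i, g, hg, rfl⟩
  exact h i g hg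

end Pi

section OfMap

variable {X Y W : Type} [TopologicalSpace X] [TopologicalSpace Y] [AffVar Y] [TopologicalSpace W]
  [AffVar W]

theorem isReg_ofMap {e : X → Y} (hi : Topology.IsInducing e) (hinj : Function.Injective e)
    (hcl : ∀ y, (∀ f ∈ RegFun Y, (∀ x, f (e x) = 0) → f y = 0) → ∃ x, e x = y) :
    letI := ofMap e hi hinj hcl
    IsReg e := fun f hf => ⟨f, hf, rfl⟩

theorem isReg_ofMap_iff {e : X → Y} (hi : Topology.IsInducing e) (hinj : Function.Injective e)
    (hcl : ∀ y, (∀ f ∈ RegFun Y, (∀ x, f (e x) = 0) → f y = 0) → ∃ x, e x = y) (g : W → X) :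
    letI := ofMap e hi hinj hcl
    IsReg g ↔ IsReg (e ∘ g) := by
  constructor
  · exact fun h f hf => h _ ⟨f, hf, rfl⟩
  · rintro h _ ⟨f, hf, rfl⟩
    exact h f hf

end OfMap

section Units

variable {M : Type} [Monoid M]

/-- A monoid whose multiplication is regular. -/
class RegMul (M : Type) [Monoid M] [TopologicalSpace M] [AffVar M] : Prop where
  mul : IsReg (fun p : M × M => p.1 * p.2)

theorem isInducing_units [TopologicalSpace M] : Topology.IsInducing (fun u : Mˣ => (u.1, (u⁻¹).1)) := by
  have h : Topology.IsInducing (fun p : M × Mᵐᵒᵖ => (p.1, MulOpposite.unop p.2)) :=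
    ((Homeomorph.refl M).prodCongr MulOpposite.opHomeomorph.symm).isInducing
  exact h.comp Units.isEmbedding_embedProduct.isInducing

variable [TopologicalSpace M] [AffVar M]

theorem units_closed [RegMul M] : ∀ y : M × M, (∀ f ∈ RegFun (M × M),
    (∀ u : Mˣ, f (u.1, (u⁻¹).1) = 0) → f y = 0) → ∃ u : Mˣ, (u.1, (u⁻¹).1) = y := by
  intro y hy
  have h1 : y.1 * y.2 = 1 := sep _ _ fun f hf => by
    have := hy ((fun p : M × M => f (p.1 * p.2)) - algebraMap ℂ (M × M → ℂ) (f 1))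
      (Subalgebra.sub_mem _ (RegMul.mul f hf) (Subalgebra.algebraMap_mem _ _))
      (fun u => by simp)
    simpa [sub_eq_zero] using this
  have h2 : y.2 * y.1 = 1 := sep _ _ fun f hf => by
    have := hy ((fun p : M × M => f (p.2 * p.1)) - algebraMap ℂ (M × M → ℂ) (f 1))
      (Subalgebra.sub_mem _ ((RegMul.mul.comp (IsReg.snd.prodMk IsReg.fst)) f hf)
        (Subalgebra.algebraMap_mem _ _))
      (fun u => by simp)
    simpa [sub_eq_zero] using this
  exact ⟨⟨y.1, y.2, h1, h2⟩, rfl⟩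

theorem units_injective {M : Type} [Monoid M] : Function.Injective (fun u : Mˣ => (u.1, (u⁻¹).1)) := fun _ _ h =>
  Units.ext (congrArg Prod.fst h)

instance instUnits [RegMul M] : AffVar Mˣ :=
  ofMap (fun u : Mˣ => (u.1, (u⁻¹).1)) isInducing_units units_injective units_closed

theorem isReg_units_val [RegMul M] : IsReg (fun u : Mˣ => u.1) :=
  IsReg.fst.comp (isReg_ofMap isInducing_units units_injective units_closed)

theorem isReg_units_inv_val [RegMul M] : IsReg (fun u : Mˣ => (u⁻¹).1) :=
  IsReg.snd.comp (isReg_ofMap isInducing_units units_injective units_closed)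

theorem isReg_units_iff [RegMul M] {W : Type} [TopologicalSpace W] [AffVar W] {g : W → Mˣ} :
    IsReg g ↔ IsReg (fun w => (g w).1) ∧ IsReg (fun w => ((g w)⁻¹).1) :=
  ⟨fun h => ⟨isReg_units_val.comp h, isReg_units_inv_val.comp h⟩, fun h =>
    (isReg_ofMap_iff isInducing_units units_injective units_closed g).mpr (h.1.prodMk h.2)⟩

end Units

section Arithmetic

variable {X : Type} [TopologicalSpace X] [AffVar X]

theorem isReg_add {f g : X → ℂ} (hf : IsReg f) (hg : IsReg g) : IsReg (fun x => f x + g x) :=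
  isReg_complex_iff.mpr
    ((RegFun X).add_mem (isReg_complex_iff.mp hf) (isReg_complex_iff.mp hg))

theorem isReg_mul {f g : X → ℂ} (hf : IsReg f) (hg : IsReg g) : IsReg (fun x => f x * g x) :=
  isReg_complex_iff.mpr
    ((RegFun X).mul_mem (isReg_complex_iff.mp hf) (isReg_complex_iff.mp hg))

theorem isReg_sum {κ : Type} (s : Finset κ) {f : κ → X → ℂ} (hf : ∀ k ∈ s, IsReg (f k)) :
    IsReg (fun x => ∑ k ∈ s, f k x) := by
  rw [isReg_complex_iff]
  have := (RegFun X).sum_mem fun k hk => isReg_complex_iff.mp (hf k hk)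
  convert this using 1
  ext x
  simp

theorem isReg_prod {κ : Type} (s : Finset κ) {f : κ → X → ℂ} (hf : ∀ k ∈ s, IsReg (f k)) :
    IsReg (fun x => ∏ k ∈ s, f k x) := by
  rw [isReg_complex_iff]
  have := (RegFun X).prod_mem fun k hk => isReg_complex_iff.mp (hf k hk)
  convert this using 1
  ext x
  simp

theorem isReg_pow {f : X → ℂ} (hf : IsReg f) (n : ℕ) : IsReg (fun x => f x ^ n) :=
  isReg_complex_iff.mpr ((RegFun X).pow_mem (isReg_complex_iff.mp hf) n)

theorem isReg_eval {σ : Type} {c : X → σ → ℂ} (hc : ∀ i, IsReg (fun x => c x i))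
    (p : MvPolynomial σ ℂ) : IsReg (fun x => eval (c x) p) := by
  induction p using MvPolynomial.induction_on with
  | C a => simpa using IsReg.const a
  | add p q hp hq => simpa using isReg_add hp hq
  | mul_X p i hp => simpa using isReg_mul hp (hc i)

/-- Regular functions on affine space are polynomials. -/
theorem exists_eq_eval_of_isReg {ι : Type} [Fintype ι] {f : (ι → ℂ) → ℂ} (hf : IsReg f) :
    ∃ p : MvPolynomial ι ℂ, ∀ x, f x = eval x p := by
  let P : MvPolynomial ι ℂ →ₐ[ℂ] ((ι → ℂ) → ℂ) := AlgHom.pi fun x => aeval x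
  have hP : ∀ p x, P p x = eval x p := fun p x => DFunLike.congr_fun (coe_aeval_eq_eval x) p
  suffices h : RegFun (ι → ℂ) ≤ P.range by
    obtain ⟨p, hp⟩ := h (isReg_complex_iff.mp hf)
    exact ⟨p, fun x => by rw [← hP]; exact (congrFun hp x).symm⟩
  refine Algebra.adjoin_le ?_
  rintro _ ⟨i, g, hg, rfl⟩
  suffices h : RegFun ℂ ≤ P.range.comap (precomp fun x : ι → ℂ => x i) from h hg
  refine Algebra.adjoin_le ?_
  rintro _ rfl
  exact ⟨MvPolynomial.X i, funext fun x => (hP _ x).trans (by rw [eval_X]; rfl)⟩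

instance : RegMul ℂ := ⟨isReg_mul IsReg.fst IsReg.snd⟩

instance (m : ℕ) : AffVar (Matrix (Fin m) (Fin m) ℂ) :=
  inferInstanceAs (AffVar (Fin m → Fin m → ℂ))

theorem isReg_entry {m : ℕ} (i j : Fin m) : IsReg (fun A : Matrix (Fin m) (Fin m) ℂ => A i j) :=
  (IsReg.apply (X := ℂ) j).comp (IsReg.apply (X := Fin m → ℂ) i)

theorem isReg_matrix {m : ℕ} {f : X → Matrix (Fin m) (Fin m) ℂ}
    (h : ∀ i j, IsReg (fun x => f x i j)) : IsReg f :=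
  IsReg.pi (X := Fin m → ℂ) fun i => IsReg.pi (X := ℂ) fun j => h i j

instance (m : ℕ) : RegMul (Matrix (Fin m) (Fin m) ℂ) := ⟨isReg_matrix fun i j => by
  simp only [Matrix.mul_apply]
  exact isReg_sum _ fun k _ => isReg_mul ((isReg_entry i k).comp IsReg.fst)
    ((isReg_entry k j).comp IsReg.snd)⟩

end Arithmetic

/-! Zariski closed subsets -/

section Zariski

variable {X : Type} [TopologicalSpace X] [AffVar X] {Y : Type} [TopologicalSpace Y] [AffVar Y]

/-- The Zariski closure. -/
def zcl (s : Set X) : Set X := {x | ∀ f ∈ RegFun X, (∀ y ∈ s, f y = 0) → f x = 0}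

/-- Zariski closed subsets. -/
def IsZar (s : Set X) : Prop := zcl s ⊆ s

theorem subset_zcl (s : Set X) : s ⊆ zcl s := fun _ hx _ _ h => h _ hx

theorem zcl_mono {s t : Set X} (h : s ⊆ t) : zcl s ⊆ zcl t := fun _ hx f hf h0 =>
  hx f hf fun y hy => h0 y (h hy)

theorem isZar_zcl (s : Set X) : IsZar (zcl s) := fun _ hx f hf h0 =>
  hx f hf fun _ hy => hy f hf h0

theorem zcl_subset {s t : Set X} (ht : IsZar t) (h : s ⊆ t) : zcl s ⊆ t :=
  (zcl_mono h).trans ht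

theorem IsZar.preimage {s : Set Y} (hs : IsZar s) {f : X → Y} (hf : IsReg f) :
    IsZar (f ⁻¹' s) := fun _ hx => hs fun h hh h0 => hx _ (hf h hh) fun _ hy => h0 _ hy

theorem isZar_setOf_eq {f g : X → Y} (hf : IsReg f) (hg : IsReg g) : IsZar {x | f x = g x} := by
  intro x hx
  refine sep _ _ fun h hh => sub_eq_zero.mp ?_
  exact hx (h ∘ f - h ∘ g) (Subalgebra.sub_mem _ (hf h hh) (hg h hh)) fun z hz => by
    have : f z = g z := hz
    simp [this]

theorem isZar_iInter {κ : Sort*} {s : κ → Set X} (h : ∀ k, IsZar (s k)) : IsZar (⋂ k, s k) := by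
  intro x hx
  rw [Set.mem_iInter]
  exact fun k => zcl_subset (h k) (Set.iInter_subset _ _) hx

theorem IsZar.inter {s t : Set X} (hs : IsZar s) (ht : IsZar t) : IsZar (s ∩ t) := fun _ hx =>
  ⟨zcl_subset hs Set.inter_subset_left hx, zcl_subset ht Set.inter_subset_right hx⟩

/-- A Zariski closed subset is an affine variety. -/
abbrev ofIsZar {s : Set X} (hs : IsZar s) : AffVar s :=
  ofMap Subtype.val Topology.IsInducing.subtypeVal Subtype.val_injective fun y hy =>
    ⟨⟨y, hs fun f hf h0 => hy f hf fun x => h0 x.1 x.2⟩, rfl⟩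

end Zariski

end AffVar

namespace AffVar

/-! Irreducible varieties -/

section Irreducible

variable {X : Type} [TopologicalSpace X] [AffVar X] {Y : Type} [TopologicalSpace Y] [AffVar Y]

/-- Irreducibility: nonempty Zariski open sets meet. -/
class Irred (X : Type) [TopologicalSpace X] [AffVar X] : Prop where
  nonempty : Nonempty X
  exists_ne_zero : ∀ f ∈ RegFun X, ∀ g ∈ RegFun X, f ≠ 0 → g ≠ 0 → ∃ x, f x ≠ 0 ∧ g x ≠ 0

instance [Irred X] : IsDomain (RegFun X) := by
  have hn : Nontrivial (RegFun X) := by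
    obtain ⟨x⟩ := Irred.nonempty (X := X)
    refine ⟨0, 1, fun h => ?_⟩
    have := congrFun (congrArg Subtype.val h) x
    simp at this
  have hz : NoZeroDivisors (RegFun X) := by
    refine ⟨fun {f g} h => ?_⟩
    by_contra! hne
    obtain ⟨x, hx, hy⟩ := Irred.exists_ne_zero f.1 f.2 g.1 g.2
      (fun h => hne.1 (Subtype.ext h)) (fun h => hne.2 (Subtype.ext h))
    have : f.1 x * g.1 x = 0 := congrFun (congrArg Subtype.val h) x
    exact mul_ne_zero hx hy this
  exact NoZeroDivisors.to_isDomain _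

theorem exists_ne_of_ne_zero {α : Type} {f : α → ℂ} (h : f ≠ 0) : ∃ x, f x ≠ 0 := by
  by_contra! hc
  exact h (funext hc)

instance [Irred X] [Irred Y] : Irred (X × Y) where
  nonempty := by
    obtain ⟨x⟩ := Irred.nonempty (X := X)
    obtain ⟨y⟩ := Irred.nonempty (X := Y)
    exact ⟨(x, y)⟩
  exists_ne_zero f hf g hg h1 h2 := by
    obtain ⟨⟨x1, y1⟩, h1⟩ := exists_ne_of_ne_zero h1
    obtain ⟨⟨x2, y2⟩, h2⟩ := exists_ne_of_ne_zero h2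
    obtain ⟨x, hx1, hx2⟩ := Irred.exists_ne_zero (fun x => f (x, y1))
      ((IsReg.id.prodMk (IsReg.const y1)) f hf) (fun x => g (x, y2))
      ((IsReg.id.prodMk (IsReg.const y2)) g hg) (fun h => h1 (congrFun h x1))
      (fun h => h2 (congrFun h x2))
    obtain ⟨y, hy1, hy2⟩ := Irred.exists_ne_zero (fun y => f (x, y))
      (((IsReg.const x).prodMk IsReg.id) f hf) (fun y => g (x, y))
      (((IsReg.const x).prodMk IsReg.id) g hg) (fun h => hx1 (congrFun h y1))
      (fun h => hx2 (congrFun h y2))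
    exact ⟨(x, y), hy1, hy2⟩

/-- The image of an irreducible variety is irreducible. -/
theorem Irred.of_surjective [Irred X] {f : X → Y} (hf : IsReg f) (hs : Function.Surjective f) :
    Irred Y where
  nonempty := (Irred.nonempty (X := X)).map f
  exists_ne_zero g hg h hh h1 h2 := by
    obtain ⟨y1, h1⟩ := exists_ne_of_ne_zero h1
    obtain ⟨y2, h2⟩ := exists_ne_of_ne_zero h2
    obtain ⟨x1, rfl⟩ := hs y1
    obtain ⟨x2, rfl⟩ := hs y2
    obtain ⟨x, hx⟩ := Irred.exists_ne_zero (g ∘ f) (hf g hg) (h ∘ f) (hf h hh)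
      (fun h => h1 (congrFun h x1)) (fun h => h2 (congrFun h x2))
    exact ⟨f x, hx⟩

/-- An irreducible variety covered by countably many Zariski closed sets is one of them. -/
theorem exists_eq_univ_of_countable_cover [Irred X] {κ : Type} [Countable κ] (s : κ → Set X)
    (hs : ∀ k, IsZar (s k)) (hcov : ∀ x, ∃ k, x ∈ s k) : ∃ k, s k = Set.univ := by
  by_contra! hne
  have h1 : ∀ k, ∃ f : RegFun X, f ≠ 0 ∧ ∀ y ∈ s k, f.1 y = 0 := by
    intro k
    obtain ⟨x, hx⟩ := (Set.ne_univ_iff_exists_notMem _).mp (hne k)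
    by_contra! hc
    refine hx (hs k fun f hf h0 => ?_)
    by_contra hfx
    obtain ⟨y, hy, hy2⟩ := hc ⟨f, hf⟩ fun h => hfx (congrFun (congrArg Subtype.val h) x)
    exact hy2 (h0 y hy)
  choose f hf0 hf using h1
  have : Nonempty κ := by
    obtain ⟨x⟩ := Irred.nonempty (X := X)
    exact ⟨(hcov x).choose⟩
  obtain ⟨e, he⟩ := exists_surjective_nat κ
  obtain ⟨φ, hφ⟩ := exists_complexPoint_forall_ne_zero (fun n => f (e n)) fun n => hf0 _
  obtain ⟨x, hx⟩ := pts φ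
  obtain ⟨k, hk⟩ := hcov x
  obtain ⟨n, rfl⟩ := he k
  exact hφ n (by rw [hx]; exact hf _ x hk)

/-- A regular map from an irreducible variety contains a nonempty open subset of the Zariski
closure of its image. -/
theorem exists_open_in_range [Irred X] {f : X → Y} (hf : IsReg f) :
    ∃ b ∈ RegFun Y, b ∘ f ≠ 0 ∧ ∀ y ∈ zcl (Set.range f), b y ≠ 0 → y ∈ Set.range f := by
  let p := pullback f hf
  have : Algebra.FiniteType ℂ p.range :=
    Algebra.FiniteType.of_surjective p.rangeRestrict p.rangeRestrict_surjective
  obtain ⟨b, hb0, hb⟩ := exists_ne_zero_forall_point_extends (B := p.range)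
    (C := RegFun X) p.range.val (fun _ _ h => Subtype.ext h)
  obtain ⟨_, ⟨b, rfl⟩⟩ := b
  refine ⟨b.1, b.2, fun h => hb0 (Subtype.ext (Subtype.ext h)), fun y hy hby => ?_⟩
  have hker : ∀ g : RegFun Y, p.rangeRestrict g = 0 → evalAt y g = 0 := by
    intro g hg
    refine hy g.1 g.2 ?_
    rintro _ ⟨x, rfl⟩
    exact congrFun (congrArg (fun r => r.1.1) hg) x
  let φ : p.range →ₐ[ℂ] ℂ := (Ideal.Quotient.liftₐ (RingHom.ker p.rangeRestrict) (evalAt y) hker).comp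
      (Ideal.quotientKerAlgEquivOfSurjective p.rangeRestrict_surjective).symm.toAlgHom
  have hφ : ∀ g, φ (p.rangeRestrict g) = g.1 y := by
    intro g
    have h1 : (Ideal.quotientKerAlgEquivOfSurjective p.rangeRestrict_surjective).symm
        (p.rangeRestrict g) = Ideal.Quotient.mk (RingHom.ker p.rangeRestrict) g := by
      rw [AlgEquiv.symm_apply_eq]; rfl
    change Ideal.Quotient.liftₐ (RingHom.ker p.rangeRestrict) (evalAt y) hker
      ((Ideal.quotientKerAlgEquivOfSurjective p.rangeRestrict_surjective).symm
        (p.rangeRestrict g)) = _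
    rw [h1]
    rfl
  obtain ⟨ψ, hψ⟩ := hb φ (by
    have := hφ b
    rw [← this] at hby
    exact hby)
  obtain ⟨x, hx⟩ := pts ψ
  refine ⟨x, sep _ _ fun g hg => ?_⟩
  have h1 : ψ (p ⟨g, hg⟩) = φ (p.rangeRestrict ⟨g, hg⟩) :=
    DFunLike.congr_fun hψ (p.rangeRestrict ⟨g, hg⟩)
  rw [hx, hφ] at h1
  exact h1

/-- Functions constant on the fibres of a surjection are fractions of regular functions. -/
theorem exists_mul_mem_of_comp_mem [Irred X] {f : X → Y} (hf : IsReg f)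
    (hs : Function.Surjective f) (g : Y → ℂ) (hg : g ∘ f ∈ RegFun X) :
    ∃ b ∈ RegFun Y, b ≠ 0 ∧ b * g ∈ RegFun Y := by
  have := Irred.of_surjective hf hs
  obtain ⟨b, hb, b', hb'⟩ := exists_mul_mem_of_constant_on_fibres (pullback f hf)
    (fun u v huv => Subtype.ext (funext fun y => by
      obtain ⟨x, rfl⟩ := hs y
      exact congrFun (congrArg Subtype.val huv) x)) ⟨g ∘ f, hg⟩ (fun φ φ' h => by
    obtain ⟨x, hx⟩ := pts φ
    obtain ⟨x', hx'⟩ := pts φ'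
    rw [hx, hx']
    have : f x = f x' := sep _ _ fun u hu => by
      have := DFunLike.congr_fun h ⟨u, hu⟩
      rw [AlgHom.comp_apply, AlgHom.comp_apply, hx, hx'] at this
      exact this
    change g (f x) = g (f x')
    rw [this])
  refine ⟨b.1, b.2, fun h => hb (Subtype.ext h), ?_⟩
  have : b.1 * g = b'.1 := funext fun y => by
    obtain ⟨x, rfl⟩ := hs y
    exact congrFun (congrArg Subtype.val hb') x
  rw [this]
  exact b'.2

/-- Regular functions on a product are sums of products. -/
theorem exists_eq_sum_mul {F : X × Y → ℂ} (hF : F ∈ RegFun (X × Y)) :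
    ∃ (n : ℕ) (a : Fin n → RegFun X) (b : Fin n → RegFun Y),
      ∀ x y, F (x, y) = ∑ k, (a k).1 x * (b k).1 y := by
  change F ∈ Algebra.adjoin ℂ (prodGens X Y) at hF
  induction hF using Algebra.adjoin_induction with
  | mem F hF =>
    rcases hF with ⟨f, hf, rfl⟩ | ⟨f, hf, rfl⟩
    · exact ⟨1, fun _ => ⟨f, hf⟩, fun _ => 1, fun x y => by simp⟩
    · exact ⟨1, fun _ => 1, fun _ => ⟨f, hf⟩, fun x y => by simp⟩
  | algebraMap r => exact ⟨1, fun _ => algebraMap _ _ r, fun _ => 1, fun x y => by simp⟩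
  | add F G _ _ h1 h2 =>
    obtain ⟨n, a, b, h1⟩ := h1
    obtain ⟨m, c, d, h2⟩ := h2
    refine ⟨n + m, Fin.append a c, Fin.append b d, fun x y => ?_⟩
    simp [Fin.sum_univ_add, h1, h2]
  | mul F G _ _ h1 h2 =>
    obtain ⟨n, a, b, h1⟩ := h1
    obtain ⟨m, c, d, h2⟩ := h2
    refine ⟨n * m, fun k => a (finProdFinEquiv.symm k).1 * c (finProdFinEquiv.symm k).2,
      fun k => b (finProdFinEquiv.symm k).1 * d (finProdFinEquiv.symm k).2, fun x y => ?_⟩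
    rw [Pi.mul_apply, h1, h2, Finset.sum_mul_sum, ← Fintype.sum_prod_type',
      ← finProdFinEquiv.symm.sum_comp]
    refine Finset.sum_congr rfl fun k _ => ?_
    simp only [MulMemClass.coe_mul, Pi.mul_apply]
    ring

end Irreducible

end AffVar

/-! ### Algebraic groups -/

/-- A group structure on an affine variety with regular operations. -/
class AlgGrp (G : Type) [Group G] [TopologicalSpace G] [AffVar G] : Prop where
  mul : IsReg (fun p : G × G => p.1 * p.2)
  inv : IsReg (fun x : G => x⁻¹)

namespace AlgGrp

open AffVar

variable {G : Type} [Group G] [TopologicalSpace G] [AffVar G] [AlgGrp G]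
  {X : Type} [TopologicalSpace X] [AffVar X]

theorem _root_.IsReg.mul {f g : X → G} (hf : IsReg f) (hg : IsReg g) :
    IsReg (fun x => f x * g x) :=
  AlgGrp.mul.comp (hf.prodMk hg)

theorem _root_.IsReg.inv {f : X → G} (hf : IsReg f) : IsReg (fun x => (f x)⁻¹) :=
  AlgGrp.inv.comp hf

theorem isReg_mul_right (g : G) : IsReg (fun x : G => x * g) := IsReg.id.mul (IsReg.const g)

theorem isReg_mul_left (g : G) : IsReg (fun x : G => g * x) := (IsReg.const g).mul IsReg.id

instance isTopologicalGroup : IsTopologicalGroup G where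
  continuous_mul := AlgGrp.mul.continuous
  continuous_inv := AlgGrp.inv.continuous

instance {H : Type} [Group H] [TopologicalSpace H] [AffVar H] [AlgGrp H] : AlgGrp (G × H) where
  mul := ((IsReg.fst.comp IsReg.fst).mul (IsReg.fst.comp IsReg.snd)).prodMk
    ((IsReg.snd.comp IsReg.fst).mul (IsReg.snd.comp IsReg.snd))
  inv := IsReg.fst.inv.prodMk IsReg.snd.inv

instance {ι : Type} [Fintype ι] : AlgGrp (ι → G) where
  mul := IsReg.pi fun i => ((IsReg.apply i).comp IsReg.fst).mul ((IsReg.apply i).comp IsReg.snd)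
  inv := IsReg.pi fun i => (IsReg.apply i).inv

instance {M : Type} [Monoid M] [TopologicalSpace M] [AffVar M] [RegMul M] : AlgGrp Mˣ where
  mul := isReg_units_iff.mpr ⟨RegMul.mul.comp ((isReg_units_val.comp IsReg.fst).prodMk
      (isReg_units_val.comp IsReg.snd)), by
    simp only [mul_inv_rev, Units.val_mul]
    exact RegMul.mul.comp ((isReg_units_inv_val.comp IsReg.snd).prodMk
      (isReg_units_inv_val.comp IsReg.fst))⟩
  inv := isReg_units_iff.mpr ⟨isReg_units_inv_val, by simpa using isReg_units_val⟩

/-- Zariski closed subgroups. -/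
class IsZarSubgroup (N : Subgroup G) : Prop where
  isZar : IsZar (N : Set G)

section Subgroup

variable (N : Subgroup G) [hN : IsZarSubgroup N]

theorem subgroup_closed : ∀ y : G, (∀ f ∈ RegFun G, (∀ x : N, f x.1 = 0) → f y = 0) →
    ∃ x : N, x.1 = y := fun y hy =>
  ⟨⟨y, hN.isZar fun f hf h0 => hy f hf fun x => h0 x.1 x.2⟩, rfl⟩

instance : AffVar N :=
  ofMap (Subtype.val : N → G) Topology.IsInducing.subtypeVal Subtype.val_injective
    (subgroup_closed N)

theorem isReg_subtype : IsReg (fun x : N => x.1) :=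
  isReg_ofMap (X := N) (e := Subtype.val) Topology.IsInducing.subtypeVal Subtype.val_injective
    (subgroup_closed N)

variable {N}

theorem isReg_subgroup_iff {f : X → N} : IsReg f ↔ IsReg (fun x => (f x).1) :=
  isReg_ofMap_iff (X := N) (e := Subtype.val) Topology.IsInducing.subtypeVal
    Subtype.val_injective (subgroup_closed N) f

instance : AlgGrp N where
  mul := isReg_subgroup_iff.mpr
    (((isReg_subtype N).comp IsReg.fst).mul ((isReg_subtype N).comp IsReg.snd))
  inv := isReg_subgroup_iff.mpr (isReg_subtype N).inv

end Subgroup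

/-! Translations of functions -/

/-- Right translation of functions. -/
def rtrans (G : Type) [Group G] : G →* Module.End ℂ (G → ℂ) where
  toFun e := LinearMap.funLeft ℂ ℂ (fun x => x * e)
  map_one' := by ext f x; simp [LinearMap.funLeft]
  map_mul' a b := by ext f x; simp [LinearMap.funLeft, mul_assoc]

@[simp] theorem rtrans_apply (e : G) (f : G → ℂ) (x : G) : rtrans G e f x = f (x * e) := rfl

/-- The span of the right translates of a family of functions. -/
def transSpan {κ : Type} (f : κ → G → ℂ) : Submodule ℂ (G → ℂ) :=
  Submodule.span ℂ (Set.range fun p : G × κ => rtrans G p.1 (f p.2))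

theorem mem_transSpan {κ : Type} (f : κ → G → ℂ) (k : κ) : f k ∈ transSpan f :=
  Submodule.subset_span ⟨(1, k), by simp⟩

theorem rtrans_mem_transSpan {κ : Type} (f : κ → G → ℂ) (e : G) {v : G → ℂ}
    (hv : v ∈ transSpan f) : rtrans G e v ∈ transSpan f := by
  suffices h : transSpan f ≤ (transSpan f).comap (rtrans G e) from h hv
  refine Submodule.span_le.mpr ?_
  rintro _ ⟨⟨g, k⟩, rfl⟩
  refine Submodule.subset_span ⟨(e * g, k), ?_⟩
  simp

/-- The translates of a regular function depend regularly on the translating element. -/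
theorem exists_rtrans_eq_sum {f : G → ℂ} (hf : f ∈ RegFun G) :
    ∃ (n : ℕ) (a b : Fin n → RegFun G), ∀ e, rtrans G e f = ∑ k, (b k).1 e • (a k).1 := by
  obtain ⟨n, a, b, h⟩ := exists_eq_sum_mul (AlgGrp.mul f hf)
  refine ⟨n, a, b, fun e => funext fun x => ?_⟩
  have := h x e
  simp only [Function.comp_apply] at this
  simp [this, mul_comm]

theorem finiteDimensional_transSpan {κ : Type} [Finite κ] {f : κ → G → ℂ}
    (hf : ∀ k, f k ∈ RegFun G) : FiniteDimensional ℂ (transSpan f) := by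
  choose n a b h using fun k => exists_rtrans_eq_sum (hf k)
  have hfin : FiniteDimensional ℂ
      (Submodule.span ℂ (Set.range fun p : Σ k, Fin (n k) => (a p.1 p.2).1)) :=
    FiniteDimensional.span_of_finite ℂ (Set.finite_range _)
  refine Submodule.finiteDimensional_of_le (S₂ := Submodule.span ℂ
    (Set.range fun p : Σ k, Fin (n k) => (a p.1 p.2).1)) (Submodule.span_le.mpr ?_)
  rintro _ ⟨⟨e, k⟩, rfl⟩
  simp only [h]
  exact Submodule.sum_mem _ fun j _ => Submodule.smul_mem _ _ (Submodule.subset_span ⟨⟨k, j⟩, rfl⟩)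

theorem transSpan_le {κ : Type} {f : κ → G → ℂ} (hf : ∀ k, f k ∈ RegFun G) :
    transSpan f ≤ Subalgebra.toSubmodule (RegFun G) := by
  refine Submodule.span_le.mpr ?_
  rintro _ ⟨⟨e, k⟩, rfl⟩
  exact isReg_mul_right e _ (hf k)

/-- The representation of `G` on the span of translates. -/
def transRep {κ : Type} (f : κ → G → ℂ) : G →* Module.End ℂ (transSpan f) where
  toFun e := (rtrans G e).restrict fun _ hv => rtrans_mem_transSpan f e hv
  map_one' := by ext v x; simp
  map_mul' a b := by ext v x; simp [mul_assoc]

@[simp] theorem transRep_apply {κ : Type} (f : κ → G → ℂ) (e : G) (v : transSpan f) (x : G) :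
    (transRep f e v).1 x = v.1 (x * e) := rfl

/-- Matrix coefficients of the representation on a span of translates are regular. -/
theorem isReg_coeff {κ : Type} {f : κ → G → ℂ} (hf : ∀ k, f k ∈ RegFun G)
    (l : Module.Dual ℂ (transSpan f)) (v : transSpan f) : IsReg (fun e => l (transRep f e v)) := by
  obtain ⟨L, hL⟩ := LinearMap.exists_extend l
  obtain ⟨n, a, b, h⟩ := exists_rtrans_eq_sum (transSpan_le hf v.2)
  have : (fun e => l (transRep f e v)) = fun e => ∑ k, (b k).1 e * L (a k).1 := by
    ext e
    rw [← hL, LinearMap.comp_apply]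
    change L (rtrans G e v.1) = _
    rw [h]
    simp
  rw [this]
  exact isReg_sum _ fun k _ => isReg_mul (isReg_complex_iff.mpr (b k).2) (IsReg.const _)

end AlgGrp

namespace AffVar

/-! Irreducibility of tori and affine lines -/

theorem exists_polynomial {f : ℂ → ℂ} (hf : f ∈ RegFun ℂ) :
    ∃ p : Polynomial ℂ, ∀ x, f x = p.eval x := by
  change f ∈ Algebra.adjoin ℂ _ at hf
  induction hf using Algebra.adjoin_induction with
  | mem f hf =>
    obtain rfl := hf
    exact ⟨Polynomial.X, fun x => by simp⟩
  | algebraMap r => exact ⟨Polynomial.C r, fun x => by simp⟩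
  | add f g _ _ hf hg =>
    obtain ⟨p, hp⟩ := hf
    obtain ⟨q, hq⟩ := hg
    exact ⟨p + q, fun x => by simp [hp, hq]⟩
  | mul f g _ _ hf hg =>
    obtain ⟨p, hp⟩ := hf
    obtain ⟨q, hq⟩ := hg
    exact ⟨p * q, fun x => by simp [hp, hq]⟩

instance : Irred ℂ where
  nonempty := ⟨0⟩
  exists_ne_zero f hf g hg h1 h2 := by
    obtain ⟨p, hp⟩ := exists_polynomial hf
    obtain ⟨q, hq⟩ := exists_polynomial hg
    by_contra! hc
    have hpq : p * q = 0 := Polynomial.funext fun x => by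
      rw [Polynomial.eval_mul, ← hp, ← hq, Polynomial.eval_zero]
      by_cases hx : f x = 0
      · simp [hx]
      · simp [hc x hx]
    rcases mul_eq_zero.mp hpq with h | h
    · exact h1 (funext fun x => by simp [hp, h])
    · exact h2 (funext fun x => by simp [hq, h])

/-- The exponential as a map to the multiplicative group. -/
def expUnit (z : ℂ) : ℂˣ := Units.mk0 (Complex.exp z) (Complex.exp_ne_zero z)

@[simp] theorem expUnit_val (z : ℂ) : (expUnit z : ℂ) = Complex.exp z := rfl

@[simp] theorem expUnit_inv_val (z : ℂ) : ((expUnit z)⁻¹ : ℂˣ).val = Complex.exp (-z) := by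
  rw [Units.val_inv_eq_inv_val, expUnit_val, Complex.exp_neg]

theorem expUnit_surjective : Function.Surjective expUnit := fun u =>
  ⟨Complex.log u, Units.ext (Complex.exp_log u.ne_zero)⟩

theorem continuous_expUnit : Continuous expUnit := by
  rw [Units.continuous_iff]
  exact ⟨Complex.continuous_exp, by
    simp only [expUnit_inv_val]
    exact Complex.continuous_exp.comp continuous_neg⟩

theorem differentiable_comp_expUnit {f : ℂˣ → ℂ} (hf : f ∈ RegFun ℂˣ) :
    Differentiable ℂ (fun z => f (expUnit z)) := by
  obtain ⟨F, hF, rfl⟩ := hf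
  obtain ⟨n, a, b, h⟩ := exists_eq_sum_mul hF
  choose p hp using fun k => exists_polynomial (a k).2
  choose q hq using fun k => exists_polynomial (b k).2
  have : (fun z => (precomp fun u : ℂˣ => (u.1, (u⁻¹).1)) F (expUnit z)) =
      fun z => ∑ k, (p k).eval (Complex.exp z) * (q k).eval (Complex.exp (-z)) := by
    ext z
    change F ((expUnit z).1, ((expUnit z)⁻¹).1) = _
    rw [h]
    refine Finset.sum_congr rfl fun k _ => ?_
    rw [hp, hq, expUnit_inv_val, expUnit_val]
  have h2 : Differentiable ℂ (fun z =>
      ∑ k, (p k).eval (Complex.exp z) * (q k).eval (Complex.exp (-z))) := by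
    refine Differentiable.fun_sum fun k _ => Differentiable.mul ?_ ?_
    · exact (p k).differentiable.comp Complex.differentiable_exp
    · exact (q k).differentiable.comp (Complex.differentiable_exp.comp differentiable_neg)
  exact this ▸ h2

instance : Irred ℂˣ where
  nonempty := ⟨1⟩
  exists_ne_zero f hf g hg h1 h2 := by
    by_contra! hc
    have key := AnalyticOnNhd.eq_zero_or_eq_zero_of_mul_eq_zero
      (f := fun z => f (expUnit z)) (g := fun z => g (expUnit z)) (U := Set.univ)
      ((differentiable_comp_expUnit hf).differentiableOn.analyticOnNhd isOpen_univ)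
      ((differentiable_comp_expUnit hg).differentiableOn.analyticOnNhd isOpen_univ)
      (fun z _ => by
        by_cases hx : f (expUnit z) = 0
        · simp [hx]
        · simp [hc _ hx]) isPreconnected_univ
    rcases key with h | h
    · refine h1 (funext fun u => ?_)
      obtain ⟨z, rfl⟩ := expUnit_surjective u
      exact h z trivial
    · refine h2 (funext fun u => ?_)
      obtain ⟨z, rfl⟩ := expUnit_surjective u
      exact h z trivial

instance : PathConnectedSpace ℂˣ := expUnit_surjective.pathConnectedSpace continuous_expUnit

instance {X : Type} [TopologicalSpace X] [AffVar X] [Irred X] (r : ℕ) : Irred (Fin r → X) := by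
  induction r with
  | zero =>
    refine ⟨inferInstance, fun f _ g _ h1 h2 => ?_⟩
    obtain ⟨x, hx⟩ := exists_ne_of_ne_zero h1
    obtain ⟨y, hy⟩ := exists_ne_of_ne_zero h2
    rw [Subsingleton.elim y x] at hy
    exact ⟨x, hx, hy⟩
  | succ r ih =>
    refine Irred.of_surjective (X := X × (Fin r → X)) (f := fun p => Fin.cons p.1 p.2)
      (IsReg.pi fun i => ?_) fun x => ⟨(x 0, Fin.tail x), Fin.cons_self_tail x⟩
    refine Fin.cases ?_ (fun j => ?_) i
    · simpa using IsReg.fst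
    · simpa [Function.comp_def] using (IsReg.apply j).comp (IsReg.snd (X := X) (Y := Fin r → X))

/-! Images of irreducible path connected varieties -/

section IsNice

variable {X : Type} [TopologicalSpace X] [AffVar X] {Y : Type} [TopologicalSpace Y] [AffVar Y]

/-- A set parametrized by an irreducible path connected variety. -/
def IsNice (s : Set X) : Prop :=
  ∃ (T : Type) (_ : TopologicalSpace T) (_ : AffVar T) (f : T → X),
    Irred T ∧ PathConnectedSpace T ∧ IsReg f ∧ Set.range f = s

theorem IsNice.of_range {T : Type} [TopologicalSpace T] [AffVar T] [Irred T] [PathConnectedSpace T]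
    {f : T → X} (hf : IsReg f) : IsNice (Set.range f) :=
  ⟨T, _, _, f, ‹_›, ‹_›, hf, rfl⟩

theorem IsNice.image {s : Set X} (hs : IsNice s) {g : X → Y} (hg : IsReg g) : IsNice (g '' s) := by
  obtain ⟨T, _, _, f, _, _, hf, rfl⟩ := hs
  rw [← Set.range_comp]
  exact .of_range (hg.comp hf)

theorem IsNice.prod {s : Set X} (hs : IsNice s) {t : Set Y} (ht : IsNice t) : IsNice (s ×ˢ t) := by
  obtain ⟨T, _, _, f, _, _, hf, rfl⟩ := hs
  obtain ⟨T', _, _, f', _, _, hf', rfl⟩ := ht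
  rw [← Set.range_prodMap]
  exact .of_range ((hf.comp IsReg.fst).prodMk (hf'.comp IsReg.snd))

theorem isNice_singleton (x : X) : IsNice {x} := by
  rw [← Set.range_const (ι := ℂ) (c := x)]
  exact .of_range (IsReg.const x)

theorem IsNice.isPathConnected {s : Set X} (hs : IsNice s) : IsPathConnected s := by
  obtain ⟨T, _, _, f, _, _, hf, rfl⟩ := hs
  exact isPathConnected_range hf.continuous

theorem IsNice.irred (hs : IsNice (Set.univ : Set X)) : Irred X := by
  obtain ⟨T, _, _, f, _, _, hf, hfs⟩ := hs
  exact Irred.of_surjective hf (Set.range_eq_univ.mp hfs)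

theorem IsNice.pathConnectedSpace (hs : IsNice (Set.univ : Set X)) : PathConnectedSpace X :=
  pathConnectedSpace_iff_univ.mpr hs.isPathConnected

/-- The ideal of functions vanishing on a set. -/
def vanIdeal (s : Set X) : Ideal (RegFun X) where
  carrier := {f | ∀ x ∈ s, f.1 x = 0}
  zero_mem' _ _ := rfl
  add_mem' ha hb x hx := by simp [ha x hx, hb x hx]
  smul_mem' c f hf x hx := by simp [hf x hx]

theorem mem_vanIdeal {s : Set X} {f : RegFun X} : f ∈ vanIdeal s ↔ ∀ x ∈ s, f.1 x = 0 := Iff.rfl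

theorem mem_zcl_iff {s : Set X} {x : X} : x ∈ zcl s ↔ ∀ f ∈ vanIdeal s, f.1 x = 0 :=
  ⟨fun h f hf => h f.1 f.2 hf, fun h f hf h0 => h ⟨f, hf⟩ h0⟩

theorem IsNice.isPrime {s : Set X} (hs : IsNice s) : (vanIdeal s).IsPrime := by
  obtain ⟨T, _, _, f, _, _, hf, rfl⟩ := hs
  have : vanIdeal (Set.range f) = RingHom.ker (pullback f hf) := by
    ext g
    rw [mem_vanIdeal, RingHom.mem_ker, Subtype.ext_iff, funext_iff]
    exact Set.forall_mem_range
  rw [this]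
  exact RingHom.ker_isPrime _

end IsNice

end AffVar

namespace AlgGrp

open AffVar Pointwise

variable {G : Type} [Group G] [TopologicalSpace G] [AffVar G] [AlgGrp G]

theorem _root_.AffVar.IsNice.mul {s t : Set G} (hs : IsNice s) (ht : IsNice t) :
    IsNice (s * t) := by
  rw [← Set.image_mul_prod]
  exact (hs.prod ht).image AlgGrp.mul

theorem _root_.AffVar.IsNice.inv {s : Set G} (hs : IsNice s) : IsNice s⁻¹ := by
  rw [← Set.image_inv_eq_inv]
  exact hs.image AlgGrp.inv

theorem zcl_mul_subset (s t : Set G) : zcl s * zcl t ⊆ zcl (s * t) := by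
  have h1 : ∀ x ∈ s, ∀ y ∈ zcl t, x * y ∈ zcl (s * t) := fun x hx =>
    zcl_subset ((isZar_zcl (s * t)).preimage (isReg_mul_left x)) fun y hy =>
      subset_zcl _ (Set.mul_mem_mul hx hy)
  rintro _ ⟨x, hx, y, hy, rfl⟩
  exact zcl_subset ((isZar_zcl (s * t)).preimage (isReg_mul_right y)) (fun x hx => h1 x hx y hy) hx

theorem zcl_inv_subset (s : Set G) : (zcl s)⁻¹ ⊆ zcl s⁻¹ := fun x hx => by
  have := zcl_subset ((isZar_zcl s⁻¹).preimage AlgGrp.inv) (s := s)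
    (fun y hy => subset_zcl _ (by simpa using hy)) hx
  simpa using this

/-- If the Zariski closure of a nice set is a group then it is the product of two copies. -/
theorem _root_.AffVar.IsNice.mul_self_eq {s : Set G} (hs : IsNice s) (N : Subgroup G)
    (hN : zcl s = N) : s * s = N := by
  refine Set.Subset.antisymm ?_ fun n hn => ?_
  · rintro _ ⟨x, hx, y, hy, rfl⟩
    have hsN : s ⊆ N := hN ▸ subset_zcl s
    exact N.mul_mem (hsN hx) (hsN hy)
  obtain ⟨T, _, _, f, _, _, hf, rfl⟩ := hs
  have hfN : ∀ t, f t ∈ N := fun t => by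
    rw [← SetLike.mem_coe, ← hN]; exact subset_zcl _ ⟨t, rfl⟩
  obtain ⟨b, hb, hb0, hbr⟩ := exists_open_in_range hf
  have hreg : IsReg (fun x : G => x⁻¹ * n) := IsReg.id.inv.mul (IsReg.const n)
  have h1 : (b ∘ fun x : G => x⁻¹ * n) ∘ f ≠ 0 := by
    intro h0
    obtain ⟨t, ht⟩ := exists_ne_of_ne_zero hb0
    have hm : n * (f t)⁻¹ ∈ zcl (Set.range f) := by
      rw [hN]; exact N.mul_mem hn (N.inv_mem (hfN t))
    have := hm _ (hreg b hb) (by rintro _ ⟨t, rfl⟩; exact congrFun h0 t)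
    simp at this
    exact ht this
  obtain ⟨t, ht, ht2⟩ := Irred.exists_ne_zero _ (hf b hb) _ (hf _ (hreg b hb)) hb0 h1
  obtain ⟨t', ht'⟩ := hbr ((f t)⁻¹ * n)
    (by rw [hN]; exact N.mul_mem (N.inv_mem (hfN t)) hn) ht2
  exact ⟨f t, ⟨t, rfl⟩, f t', ⟨t', rfl⟩, by simp [ht']⟩

/-- A subgroup which is a nice set is Zariski closed. -/
theorem _root_.AffVar.IsNice.isZar {N : Subgroup G} (hN : IsNice (N : Set G)) :
    IsZar (N : Set G) := by
  let N' : Subgroup G :=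
    { carrier := zcl (N : Set G)
      one_mem' := subset_zcl _ N.one_mem
      mul_mem' := fun ha hb => by
        have := zcl_mul_subset (N : Set G) N (Set.mul_mem_mul ha hb)
        rwa [coe_mul_coe] at this
      inv_mem' := fun {x} ha => by
        have := zcl_inv_subset (N : Set G) (a := x⁻¹) (by simpa using ha)
        rwa [inv_coe_set] at this }
  have h := hN.mul_self_eq N' rfl
  rw [coe_mul_coe] at h
  exact h.ge

variable (G) in
/-- There is a largest nice set through the identity and it is a subgroup. -/
theorem exists_core : ∃ M : Subgroup G, IsNice (M : Set G) ∧
    ∀ s : Set G, IsNice s → 1 ∈ s → s ⊆ M := by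
  obtain ⟨s, ⟨hs, hs1⟩, hmin⟩ := (InvImage.wf (fun s : Set G => (vanIdeal s).height)
    (wellFounded_lt (α := ℕ∞))).has_min {s | IsNice s ∧ 1 ∈ s} ⟨{1}, isNice_singleton 1, rfl⟩
  have hle : ∀ t, IsNice t → s ⊆ t → t ⊆ zcl s := by
    intro t ht hst x hx
    have hp := ht.isPrime
    have hp2 := hs.isPrime
    have h1 : vanIdeal t ≤ vanIdeal s := fun f hf y hy => hf y (hst hy)
    have h2 : vanIdeal t = vanIdeal s := by
      by_contra hne
      exact hmin t ⟨ht, hst hs1⟩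
        (Ideal.height_strict_mono_of_isPrime_of_isPrime (lt_of_le_of_ne h1 hne))
    refine mem_zcl_iff.mpr fun f hf => ?_
    rw [← h2] at hf
    exact hf x hx
  have hall : ∀ t, IsNice t → 1 ∈ t → t ⊆ zcl s := by
    intro t ht h1
    refine Set.Subset.trans (b := s * t) (fun x hx => ⟨1, hs1, x, hx, one_mul x⟩) (hle (s * t) (hs.mul ht) ?_)
    exact fun x hx => ⟨x, hx, 1, h1, mul_one x⟩
  let N : Subgroup G :=
    { carrier := zcl s
      one_mem' := subset_zcl _ hs1
      mul_mem' := fun ha hb => zcl_subset (isZar_zcl s)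
        (hall (s * s) (hs.mul hs) ⟨1, hs1, 1, hs1, one_mul 1⟩) (zcl_mul_subset s s
          (Set.mul_mem_mul ha hb))
      inv_mem' := fun {x} ha => zcl_subset (isZar_zcl s)
        (hall s⁻¹ hs.inv (by simpa using hs1)) (zcl_inv_subset s (by simpa using ha)) }
  refine ⟨N, ?_, hall⟩
  rw [← hs.mul_self_eq N rfl]
  exact hs.mul hs

variable (G) in
/-- The largest nice set through the identity, as a subgroup. -/
def core : Subgroup G := (exists_core G).choose

theorem isNice_core : IsNice (core G : Set G) := (exists_core G).choose_spec.1

theorem subset_core {s : Set G} (hs : IsNice s) (h1 : 1 ∈ s) : s ⊆ core G :=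
  (exists_core G).choose_spec.2 s hs h1

instance : IsZarSubgroup (core G) := ⟨isNice_core.isZar⟩

end AlgGrp

/-! ### Exponential polynomials -/

/-- The shift operator on sequences. -/
def shiftEnd : Module.End ℂ (ℕ → ℂ) := LinearMap.funLeft ℂ ℂ Nat.succ

theorem shiftEnd_apply (f : ℕ → ℂ) (k : ℕ) : shiftEnd f k = f (k + 1) := rfl

theorem expPoly_mem_maxGenEigenspace (μ : ℂ) (q : Polynomial ℂ) :
    (fun k : ℕ => μ ^ k * q.eval (k : ℂ)) ∈
      shiftEnd.maxGenEigenspace μ := by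
  rw [Module.End.mem_maxGenEigenspace]
  have key : ∀ (n : ℕ) (h : ℂ → ℂ),
      ((shiftEnd - μ • (1 : Module.End ℂ (ℕ → ℂ))) ^ n)
        (fun k : ℕ => μ ^ k * h k) = fun k : ℕ => μ ^ n * (μ ^ k * ((fwdDiff (1 : ℂ))^[n] h) k) := by
    intro n
    induction n with
    | zero => intro h; simp
    | succ n ih =>
      intro h
      rw [pow_succ', Module.End.mul_apply, ih h]
      ext k
      simp only [LinearMap.sub_apply, shiftEnd_apply, LinearMap.smul_apply,
        Module.End.one_apply, Pi.sub_apply, Pi.smul_apply, smul_eq_mul,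
        Function.iterate_succ_apply', fwdDiff]
      push_cast
      ring
  refine ⟨q.natDegree + 1, ?_⟩
  rw [key _ (fun z => q.eval z)]
  have := q.fwdDiff_iter_degree_add_one_eq_zero
  ext k
  rw [show ((fwdDiff (1 : ℂ))^[q.natDegree + 1] fun z => q.eval z) = 0 from this]
  simp

/-- Exponential polynomials with distinct nonzero bases are linearly independent. -/
theorem expPoly_eq_zero {ι : Type*} (s : Finset ι) (μ : ι → ℂ) (hμ : Set.InjOn μ s)
    (h0 : ∀ i ∈ s, μ i ≠ 0) (q : ι → Polynomial ℂ)
    (h : ∀ k : ℕ, ∑ i ∈ s, μ i ^ k * (q i).eval (k : ℂ) = 0) : ∀ i ∈ s, q i = 0 := by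
  classical
  have hind := shiftEnd.independent_maxGenEigenspace
  have hind' : iSupIndep fun i : s =>
      shiftEnd.maxGenEigenspace (μ i.1) :=
    hind.comp fun a b hab => Subtype.ext (hμ a.2 b.2 hab)
  rw [iSupIndep_iff_forall_dfinsupp] at hind'
  intro i hi
  have hzero : (fun k : ℕ => μ i ^ k * (q i).eval (k : ℂ)) = 0 := by
    let m : Π₀ j : s, shiftEnd.maxGenEigenspace (μ j.1) :=
      DFinsupp.mk Finset.univ fun j =>
        (⟨_, expPoly_mem_maxGenEigenspace (μ j.1.1) (-q j.1.1)⟩ :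
          shiftEnd.maxGenEigenspace (μ j.1.1))
    have := hind' ⟨i, hi⟩ ⟨_, expPoly_mem_maxGenEigenspace (μ i) (q i)⟩ m ?_
    · exact congrArg Subtype.val this
    · ext k
      have e1 : (DFinsupp.lsum ℕ fun j : s =>
          (shiftEnd.maxGenEigenspace (μ j.1)).subtype)
          (DFinsupp.erase ⟨i, hi⟩ m) =
          ∑ j : s, (if j = ⟨i, hi⟩ then 0 else fun k : ℕ => μ j ^ k * (-q j).eval (k : ℂ)) := by
        rw [DFinsupp.lsum_apply_apply, DFinsupp.sumAddHom_apply, DFinsupp.sum_eq_sum_fintype]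
        · refine Finset.sum_congr rfl fun j _ => ?_
          by_cases hj : j = ⟨i, hi⟩
          · simp [hj]
          · simp [DFinsupp.erase_ne hj, hj, m]
        · intro j; exact map_zero _
      rw [e1]
      have hk := h k
      rw [← Finset.sum_coe_sort] at hk
      have e2 : ∀ j : s, (if j = ⟨i, hi⟩ then 0 else fun k : ℕ => μ j ^ k * (-q j).eval (k : ℂ)) k
          = -(μ j ^ k * (q j).eval (k : ℂ)) +
            if j = ⟨i, hi⟩ then μ j ^ k * (q j).eval (k : ℂ) else 0 := by
        intro j
        split_ifs <;> simp
      rw [Finset.sum_apply, Finset.sum_congr rfl fun j _ => e2 j, Finset.sum_add_distrib,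
        Finset.sum_neg_distrib, hk]
      simp
  refine Polynomial.eq_zero_of_infinite_isRoot _ (Set.Infinite.mono ?_
    (Set.infinite_range_of_injective (Nat.cast_injective (R := ℂ))))
  rintro _ ⟨k, rfl⟩
  have := congrFun hzero k
  simpa [pow_eq_zero_iff', h0 i hi] using this

theorem exists_expPoly {V : Type*} [AddCommGroup V] [Module ℂ V] [FiniteDimensional ℂ V]
    (A : Module.End ℂ V) (hA : ∀ μ, A.HasEigenvalue μ → μ ≠ 0) (l : Module.Dual ℂ V) (v : V) :
    ∃ q : ℂ →₀ Polynomial ℂ, (∀ μ ∈ q.support, A.HasEigenvalue μ) ∧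
      ∀ k : ℕ, l ((A ^ k) v) = q.sum fun μ p => μ ^ k * p.eval (k : ℂ) := by
  classical
  have hv : v ∈ ⨆ μ, A.maxGenEigenspace μ := by
    rw [Module.End.iSup_maxGenEigenspace_eq_top]; trivial
  induction hv using Submodule.iSup_induction' with
  | mem μ v hv =>
    by_cases hv0 : v = 0
    · exact ⟨0, by simp, by simp [hv0]⟩
    have hev : A.HasEigenvalue μ := by
      refine Module.End.hasEigenvalue_iff.mpr fun hbot => hv0 ?_
      obtain ⟨n, hn⟩ := (Module.End.mem_maxGenEigenspace _ _ _).mp hv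
      have hinj : Function.Injective (A - μ • (1 : Module.End ℂ V)) := by
        rw [← LinearMap.ker_eq_bot]
        rwa [Module.End.eigenspace_def] at hbot
      have hinjn : Function.Injective ((A - μ • (1 : Module.End ℂ V)) ^ n) := by
        rw [Module.End.coe_pow]; exact hinj.iterate n
      exact hinjn (by rw [hn, map_zero])
    have hμ := hA μ hev
    obtain ⟨n, hn⟩ := (Module.End.mem_maxGenEigenspace _ _ _).mp hv
    set N := A - μ • (1 : Module.End ℂ V) with hN
    have hAN : A = N + μ • (1 : Module.End ℂ V) := by rw [hN]; abel
    have hNj : ∀ j, n ≤ j → (N ^ j) v = 0 := fun j hj => by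
      obtain ⟨d, rfl⟩ := Nat.exists_eq_add_of_le' hj
      rw [pow_add, Module.End.mul_apply, hn, map_zero]
    have hpow : ∀ k : ℕ, (A ^ k) v =
        ∑ j ∈ Finset.range n, (μ ^ k * ((μ ^ j)⁻¹ * (k.choose j : ℂ))) • (N ^ j) v := by
      intro k
      have hc : Commute N (μ • (1 : Module.End ℂ V)) := (Commute.one_right N).smul_right μ
      rw [hAN, hc.add_pow, LinearMap.sum_apply]
      have e : ∀ j ∈ Finset.range (k + 1),
          (N ^ j * (μ • (1 : Module.End ℂ V)) ^ (k - j) * (k.choose j : Module.End ℂ V)) v =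
          (μ ^ k * ((μ ^ j)⁻¹ * (k.choose j : ℂ))) • (N ^ j) v := by
        intro j hj
        have hj' : j ≤ k := by simpa [Nat.lt_succ_iff] using hj
        rw [smul_pow, one_pow, ← nsmul_one, ← Nat.cast_smul_eq_nsmul ℂ]
        simp only [mul_smul_comm, mul_one, LinearMap.smul_apply, smul_smul]
        congr 1
        rw [← mul_assoc, ← pow_sub₀ μ hμ hj', mul_comm]
      rw [Finset.sum_congr rfl e]
      rcases le_total n (k + 1) with hle | hle
      · refine (Finset.sum_subset (Finset.range_mono hle) fun j _ hj => ?_).symm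
        rw [hNj j (by simpa using hj), smul_zero]
      · refine Finset.sum_subset (Finset.range_mono hle) fun j _ hj => ?_
        rw [Nat.choose_eq_zero_of_lt (by simp at hj; omega)]
        simp
    refine ⟨Finsupp.single μ (∑ j ∈ Finset.range n, Polynomial.C (l ((N ^ j) v) * (μ ^ j)⁻¹ *
      ((j.factorial : ℂ))⁻¹) * descPochhammer ℂ j), fun ν hν => ?_, fun k => ?_⟩
    · rw [show ν = μ by simpa using Finsupp.support_single_subset hν]; exact hev
    · rw [Finsupp.sum_single_index (by simp), hpow, map_sum, Polynomial.eval_finsetSum,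
        Finset.mul_sum]
      refine Finset.sum_congr rfl fun j _ => ?_
      rw [map_smul, smul_eq_mul, Polynomial.eval_mul, Polynomial.eval_C,
        descPochhammer_eval_eq_descFactorial, Nat.descFactorial_eq_factorial_mul_choose]
      have : (j.factorial : ℂ) ≠ 0 := by exact_mod_cast j.factorial_ne_zero
      push_cast
      field_simp
  | zero => exact ⟨0, by simp, by simp⟩
  | add x y _ _ hx hy =>
    obtain ⟨q, hq, hq'⟩ := hx
    obtain ⟨r, hr, hr'⟩ := hy
    refine ⟨q + r, fun μ hμ => ?_, fun k => ?_⟩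
    · rcases Finset.mem_union.mp (Finsupp.support_add hμ) with h | h
      exacts [hq μ h, hr μ h]
    · rw [map_add, map_add, hq', hr', Finsupp.sum_add_index'] <;> simp [mul_add]

namespace AffVar

section Characters

variable {L : AddSubgroup ℂ} {r : ℕ} (b : Module.Basis (Fin r) ℤ L)

/-- The monomial on the torus attached to an element of a lattice with a chosen basis. -/
def latticeChar (η : L) (w : Fin r → ℂˣ) : ℂˣ := ∏ j, w j ^ b.repr η j

theorem latticeChar_add (η θ : L) (w : Fin r → ℂˣ) :
    latticeChar b (η + θ) w = latticeChar b η w * latticeChar b θ w := by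
  simp [latticeChar, zpow_add, Finset.prod_mul_distrib]

theorem latticeChar_zero (w : Fin r → ℂˣ) : latticeChar b 0 w = 1 := by simp [latticeChar]

theorem expUnit_add (z w : ℂ) : expUnit (z + w) = expUnit z * expUnit w :=
  Units.ext (Complex.exp_add z w)

theorem expUnit_zero : expUnit 0 = 1 := Units.ext Complex.exp_zero

/-- The exponential as a homomorphism. -/
def expHom : Multiplicative ℂ →* ℂˣ where
  toFun z := expUnit z.toAdd
  map_one' := expUnit_zero
  map_mul' z w := expUnit_add z.toAdd w.toAdd

theorem latticeChar_expUnit (η : L) (k : ℕ) :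
    latticeChar b η (fun j => expUnit (k * (b j).1)) = expUnit η.1 ^ k := by
  have h1 : ∀ (z : ℂ) (n : ℤ), expUnit z ^ n = expUnit (n * z) := fun z n => by
    have := (map_zpow expHom (Multiplicative.ofAdd z) n).symm
    rwa [← ofAdd_zsmul, zsmul_eq_mul] at this
  have h2 : ∀ (s : Finset (Fin r)) (z : Fin r → ℂ),
      ∏ j ∈ s, expUnit (z j) = expUnit (∑ j ∈ s, z j) := by
    classical
    intro s z
    induction s using Finset.induction_on with
    | empty => simp [expUnit_zero]
    | insert a s ha ih => rw [Finset.prod_insert ha, Finset.sum_insert ha, expUnit_add, ih]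
  have h3 := h1 η.1 k
  rw [zpow_natCast] at h3
  rw [h3, latticeChar, Finset.prod_congr rfl fun j _ => h1 _ _, h2]
  congr 1
  have h4 := congrArg Subtype.val (b.sum_repr η)
  simp only [AddSubgroup.val_finsetSum, AddSubgroup.coe_zsmul, zsmul_eq_mul] at h4
  conv_rhs => rw [← h4]
  rw [Finset.mul_sum]
  refine Finset.sum_congr rfl fun j _ => ?_
  push_cast
  ring

theorem isReg_latticeChar (η : L) : IsReg (latticeChar b η) := by
  have h : ∀ (s : Finset (Fin r)), IsReg (fun w : Fin r → ℂˣ => ∏ j ∈ s, w j ^ b.repr η j) := by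
    classical
    have hz : ∀ (n : ℤ) (j : Fin r), IsReg (fun w : Fin r → ℂˣ => w j ^ n) := by
      intro n j
      have hn : ∀ m : ℕ, IsReg (fun w : Fin r → ℂˣ => w j ^ m) := by
        intro m
        induction m with
        | zero => simpa using IsReg.const (1 : ℂˣ)
        | succ m ih => simpa [pow_succ] using ih.mul (IsReg.apply j)
      obtain ⟨m, rfl | rfl⟩ := n.eq_nat_or_neg
      · simpa using hn m
      · simpa using (hn m).inv
    intro s
    induction s using Finset.induction_on with
    | empty => simpa using IsReg.const (1 : ℂˣ)
    | insert a s ha ih => simpa [Finset.prod_insert ha] using (hz _ a).mul ih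
  exact h Finset.univ

/-- Exponential polynomials on `(ℂˣ)^r × ℂ` whose exponents have bounded imaginary part. -/
def expSpan (c : ℝ) : Submodule ℂ ((Fin r → ℂˣ) × ℂ → ℂ) :=
  Submodule.span ℂ {φ | ∃ (η : L) (j : ℕ), |η.1.im| ≤ c ∧
    φ = fun x => (latticeChar b η x.1 : ℂ) * x.2 ^ j}

theorem expSpan_mono {c d : ℝ} (h : c ≤ d) : expSpan b c ≤ expSpan b d :=
  Submodule.span_mono fun _ ⟨η, j, hη, e⟩ => ⟨η, j, hη.trans h, e⟩

theorem mul_mem_expSpan {c d : ℝ} {φ ψ : (Fin r → ℂˣ) × ℂ → ℂ} (hφ : φ ∈ expSpan b c)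
    (hψ : ψ ∈ expSpan b d) : φ * ψ ∈ expSpan b (c + d) := by
  suffices h : expSpan b c * expSpan b d ≤ expSpan b (c + d) from h (Submodule.mul_mem_mul hφ hψ)
  rw [expSpan, expSpan, Submodule.span_mul_span, Submodule.span_le]
  rintro _ ⟨_, ⟨η, j, hη, rfl⟩, _, ⟨θ, k, hθ, rfl⟩, rfl⟩
  refine Submodule.subset_span ⟨η + θ, j + k, ?_, ?_⟩
  · simpa using (abs_add_le _ _).trans (add_le_add hη hθ)
  · ext x
    simp only [latticeChar_add, Pi.mul_apply, Units.val_mul]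
    ring

theorem one_mem_expSpan : (1 : (Fin r → ℂˣ) × ℂ → ℂ) ∈ expSpan b 0 :=
  Submodule.subset_span ⟨0, 0, by simp, by ext x; simp [latticeChar_zero]⟩

theorem prod_pow_mem_expSpan {S : Type} {c : ℝ} {F : S → (Fin r → ℂˣ) × ℂ → ℂ}
    (hF : ∀ s, F s ∈ expSpan b c) (t : Finset S) (m : S → ℕ) :
    ∏ s ∈ t, F s ^ m s ∈ expSpan b ((∑ s ∈ t, m s : ℕ) * c) := by
  classical
  have hpow : ∀ s (n : ℕ), F s ^ n ∈ expSpan b (n * c) := by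
    intro s n
    induction n with
    | zero => simpa using one_mem_expSpan b
    | succ n ih =>
      rw [pow_succ, Nat.cast_succ, add_mul, one_mul]
      exact mul_mem_expSpan b ih (hF s)
  induction t using Finset.induction_on with
  | empty => simpa using one_mem_expSpan b
  | insert a t ha ih =>
    rw [Finset.prod_insert ha, Finset.sum_insert ha, Nat.cast_add, add_mul]
    exact mul_mem_expSpan b (hpow a _) ih

theorem exists_finsupp_of_mem_expSpan {c : ℝ} {φ : (Fin r → ℂˣ) × ℂ → ℂ}
    (hφ : φ ∈ expSpan b c) : ∃ P : L →₀ Polynomial ℂ, (∀ η ∈ P.support, |η.1.im| ≤ c) ∧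
      ∀ x, φ x = P.sum fun η p => (latticeChar b η x.1 : ℂ) * p.eval x.2 := by
  classical
  induction hφ using Submodule.span_induction with
  | mem φ hφ =>
    obtain ⟨η, j, hη, rfl⟩ := hφ
    refine ⟨Finsupp.single η (Polynomial.X ^ j), fun θ hθ => ?_, fun x => ?_⟩
    · rw [show θ = η by simpa using Finsupp.support_single_subset hθ]; exact hη
    · rw [Finsupp.sum_single_index (by simp)]; simp
  | zero => exact ⟨0, by simp, by simp⟩
  | add φ ψ _ _ hφ hψ =>
    obtain ⟨P, hP, hP'⟩ := hφ
    obtain ⟨Q, hQ, hQ'⟩ := hψ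
    refine ⟨P + Q, fun η hη => ?_, fun x => ?_⟩
    · rcases Finset.mem_union.mp (Finsupp.support_add hη) with h | h
      exacts [hP η h, hQ η h]
    · rw [Pi.add_apply, hP', hQ', Finsupp.sum_add_index'] <;> simp [mul_add]
  | smul a φ _ hφ =>
    obtain ⟨P, hP, hP'⟩ := hφ
    refine ⟨a • P, fun η hη => hP η (Finsupp.support_smul hη), fun x => ?_⟩
    rw [Pi.smul_apply, hP', Finsupp.sum_smul_index' (by simp), Finsupp.smul_sum]
    refine Finsupp.sum_congr fun η _ => ?_
    simp only [smul_eq_mul, Polynomial.eval_smul]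
    ring

theorem isReg_of_mem_expSpan {c : ℝ} {φ : (Fin r → ℂˣ) × ℂ → ℂ} (hφ : φ ∈ expSpan b c) :
    φ ∈ RegFun ((Fin r → ℂˣ) × ℂ) := by
  suffices h : expSpan b c ≤ Subalgebra.toSubmodule (RegFun ((Fin r → ℂˣ) × ℂ)) from h hφ
  refine Submodule.span_le.mpr ?_
  rintro _ ⟨η, j, -, rfl⟩
  exact mul_mem (S := Subalgebra ℂ _) (isReg_complex_iff.mp (isReg_units_val.comp
    ((isReg_latticeChar b η).comp IsReg.fst))) (pow_mem (isReg_complex_iff.mp IsReg.snd) j)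

theorem eq_zero_of_mem_expSpan {c : ℝ} (hc : c < Real.pi) {φ : (Fin r → ℂˣ) × ℂ → ℂ}
    (hφ : φ ∈ expSpan b c) (h : ∀ k : ℕ, φ (fun j => expUnit (k * (b j).1), k) = 0) : φ = 0 := by
  obtain ⟨P, hP, hP'⟩ := exists_finsupp_of_mem_expSpan b hφ
  have := expPoly_eq_zero P.support (fun η => Complex.exp η.1) ?_
    (fun η _ => Complex.exp_ne_zero _) P fun k => ?_
  · ext x
    rw [hP', Finsupp.sum, Finset.sum_congr rfl fun η hη => by rw [this η hη]]
    simp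
  · intro η hη θ hθ he
    have h1 := abs_le.mp (hP η hη)
    have h2 := abs_le.mp (hP θ hθ)
    exact Subtype.ext (Complex.exp_inj_of_neg_pi_lt_of_le_pi (by linarith) (by linarith)
      (by linarith) (by linarith) he)
  · rw [← h k, hP', Finsupp.sum]
    refine Finset.sum_congr rfl fun η _ => ?_
    rw [latticeChar_expUnit]
    simp

end Characters

theorem exists_torus_param {S : Type} [Fintype S] (D : ℕ) (δ : ℝ) (hδ : D * δ < Real.pi)
    (hδ0 : 0 ≤ δ) (q : S → ℂ →₀ Polynomial ℂ)
    (hq : ∀ s, ∀ μ ∈ (q s).support, μ ≠ 0 ∧ |(Complex.log μ).im| ≤ δ) :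
    ∃ (r : ℕ) (u : ℕ → Fin r → ℂˣ) (F : S → (Fin r → ℂˣ) × ℂ → ℂ),
      (∀ s, F s ∈ RegFun ((Fin r → ℂˣ) × ℂ)) ∧
      (∀ s (k : ℕ), F s (u k, k) = (q s).sum fun μ p => μ ^ k * p.eval (k : ℂ)) ∧
      ∀ p : MvPolynomial S ℂ, p.totalDegree ≤ D →
        (∀ k : ℕ, eval (fun s => F s (u k, k)) p = 0) → ∀ x, eval (fun s => F s x) p = 0 := by
  classical
  let lg : Set ℂ := Complex.log '' ⋃ s, ((q s).support : Set ℂ)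
  have hfin : lg.Finite := (Set.finite_iUnion fun s => (q s).support.finite_toSet).image _
  let Λ : AddSubgroup ℂ := AddSubgroup.closure lg
  have hfg : Module.Finite ℤ Λ := by
    rw [Module.Finite.iff_addGroup_fg, AddGroup.fg_iff_addSubgroup_fg]
    exact ⟨hfin.toFinset, by simp [Λ]⟩
  have hfree : Module.Free ℤ Λ := inferInstance
  let b := Module.finBasis ℤ Λ
  have hmem : ∀ s, ∀ μ ∈ (q s).support, Complex.log μ ∈ Λ := fun s μ hμ =>
    AddSubgroup.subset_closure ⟨μ, Set.mem_iUnion.mpr ⟨s, hμ⟩, rfl⟩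
  let F : S → (Fin _ → ℂˣ) × ℂ → ℂ := fun s =>
    ∑ μ ∈ (q s).support.attach, fun x =>
      (latticeChar b ⟨Complex.log μ.1, hmem s μ.1 μ.2⟩ x.1 : ℂ) * (q s μ.1).eval x.2
  have hF : ∀ s, F s ∈ expSpan b δ := fun s => by
    refine Submodule.sum_mem _ fun μ _ => ?_
    have : (fun x : (Fin _ → ℂˣ) × ℂ =>
        (latticeChar b ⟨Complex.log μ.1, hmem s μ.1 μ.2⟩ x.1 : ℂ) * (q s μ.1).eval x.2) =
        ∑ j ∈ Finset.range ((q s μ.1).natDegree + 1), (q s μ.1).coeff j • fun x =>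
          (latticeChar b ⟨Complex.log μ.1, hmem s μ.1 μ.2⟩ x.1 : ℂ) * x.2 ^ j := by
      ext x
      rw [Polynomial.eval_eq_sum_range, Finset.mul_sum, Finset.sum_apply]
      refine Finset.sum_congr rfl fun j _ => ?_
      simp only [Pi.smul_apply, smul_eq_mul]
      ring
    rw [this]
    exact Submodule.sum_mem _ fun j _ => Submodule.smul_mem _ _
      (Submodule.subset_span ⟨_, j, (hq s μ.1 μ.2).2, rfl⟩)
  refine ⟨_, fun k j => expUnit (k * (b j).1), F, fun s => isReg_of_mem_expSpan b (hF s), ?_, ?_⟩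
  · intro s k
    simp only [F, Finset.sum_apply, latticeChar_expUnit]
    rw [Finsupp.sum, ← Finset.sum_attach (q s).support]
    refine Finset.sum_congr rfl fun μ _ => ?_
    rw [Units.val_pow_eq_pow_val, expUnit_val, Complex.exp_log (hq s μ.1 μ.2).1]
  · intro p hp h
    have hmemp : (fun x => eval (fun s => F s x) p) ∈ expSpan b (D * δ) := by
      have : (fun x => eval (fun s => F s x) p) =
          ∑ m ∈ p.support, p.coeff m • ∏ s, F s ^ m s := by
        ext x
        rw [eval_eq', Finset.sum_apply]
        refine Finset.sum_congr rfl fun m _ => ?_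
        simp
      rw [this]
      refine Submodule.sum_mem _ fun m hm => Submodule.smul_mem _ _
        (expSpan_mono b ?_ (prod_pow_mem_expSpan b hF Finset.univ m))
      refine mul_le_mul_of_nonneg_right ?_ hδ0
      have := le_totalDegree hm
      rw [Finsupp.sum_fintype _ _ (by simp)] at this
      exact_mod_cast this.trans hp
    exact congrFun (eq_zero_of_mem_expSpan b hδ hmemp h)

end AffVar

namespace AlgGrp

open AffVar Topology

variable {G : Type} [Group G] [TopologicalSpace G] [AffVar G] [AlgGrp G]

theorem eventually_eigenvalue_near_one {κ : Type} [Finite κ] {f : κ → G → ℂ}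
    (hf : ∀ k, f k ∈ RegFun G) {ε : ℝ} (hε : 0 < ε) :
    ∀ᶠ g in 𝓝 (1 : G), ∀ μ, (transRep f g).HasEigenvalue μ → ‖μ - 1‖ < ε := by
  classical
  have hfd := finiteDimensional_transSpan hf
  let b := Module.finBasis ℂ (transSpan f)
  let M : G → Matrix _ _ ℂ := fun g => LinearMap.toMatrix b b (transRep f g)
  have hM : ∀ i j, Continuous fun g => M g i j := fun i j => by
    have := (isReg_coeff hf (b.coord i) (b j)).continuous
    simpa [M, LinearMap.toMatrix_apply] using this
  have hM1 : M 1 = 1 := by simp [M]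
  have hcont : ∀ k, Continuous fun g => ‖M g k k - 1‖ + ∑ j ∈ Finset.univ.erase k, ‖M g k j‖ :=
    fun k => ((hM k k).sub continuous_const).norm.add
      (continuous_finsetSum _ fun j _ => (hM k j).norm)
  have hev : ∀ᶠ g in 𝓝 (1 : G), ∀ k,
      ‖M g k k - 1‖ + ∑ j ∈ Finset.univ.erase k, ‖M g k j‖ < ε := by
    rw [Filter.eventually_all]
    intro k
    refine (hcont k).continuousAt.eventually_lt continuousAt_const ?_
    rw [hM1, Matrix.one_apply_eq, sub_self, norm_zero, zero_add, Finset.sum_eq_zero]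
    · exact hε
    · intro j hj
      rw [Matrix.one_apply_ne (Finset.ne_of_mem_erase hj).symm, norm_zero]
  filter_upwards [hev] with g hg μ hμ
  obtain ⟨v, hv⟩ := hμ.exists_hasEigenvector
  have hμ' : Module.End.HasEigenvalue (Matrix.toLin' (M g)) μ := by
    refine Module.End.hasEigenvalue_of_hasEigenvector (x := b.repr v) ⟨?_, ?_⟩
    · rw [Module.End.mem_eigenspace_iff, Matrix.toLin'_apply, LinearMap.toMatrix_mulVec_repr,
        hv.apply_eq_smul]
      simp
    · intro h
      refine hv.2 (b.repr.injective (DFunLike.coe_injective ?_))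
      simpa using h
  obtain ⟨k, hk⟩ := eigenvalue_mem_ball hμ'
  rw [mem_closedBall_iff_norm] at hk
  calc ‖μ - 1‖ = ‖(M g k k - 1) + (μ - M g k k)‖ := by ring_nf
    _ ≤ ‖M g k k - 1‖ + ‖μ - M g k k‖ := norm_add_le _ _
    _ < ε := lt_of_le_of_lt (add_le_add_right hk _) (hg k)

/-- Elements near the identity are joined to it by irreducible path connected varieties. -/
theorem eventually_isNice :
    ∀ᶠ g in 𝓝 (1 : G), ∃ s : Set G, IsNice s ∧ 1 ∈ s ∧ g ∈ s := by
  classical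
  obtain ⟨S, hS, hemb, hcl⟩ := exists_isClosedEmbedding G
  let f : S → G → ℂ := fun s => s.1
  have hf : ∀ s, f s ∈ RegFun G := fun s => by rw [hS]; exact Algebra.subset_adjoin s.2
  let I : Ideal (MvPolynomial S ℂ) :=
    ⨅ x : G, RingHom.ker (eval (fun s : S => s.1 x))
  have hI : ∀ p, p ∈ I ↔ ∀ x : G, eval (fun s : S => s.1 x) p = 0 := fun p => by
    simp [I, Submodule.mem_iInf]
  obtain ⟨gens, hgens⟩ := (inferInstance : IsNoetherianRing (MvPolynomial S ℂ)).noetherian I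
  let D : ℕ := gens.sup totalDegree
  let δ : ℝ := Real.pi / (D + 1)
  have hδ0 : 0 < δ := by positivity
  have hδ : D * δ < Real.pi := by
    have : (D + 1) * δ = Real.pi := by simp only [δ]; field_simp
    nlinarith
  have hlog : ∀ᶠ μ in 𝓝 (1 : ℂ), μ ≠ 0 ∧ |(Complex.log μ).im| ≤ δ := by
    refine (eventually_ne_nhds one_ne_zero).and ?_
    have hc : ContinuousAt (fun μ => |(Complex.log μ).im|) 1 :=
      (Complex.continuous_im.continuousAt.comp (continuousAt_clog (by simp))).abs
    exact (hc.eventually_lt continuousAt_const (by simpa using hδ0)).mono fun _ => le_of_lt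
  obtain ⟨ε, hε, hball⟩ := Metric.eventually_nhds_iff.mp hlog
  filter_upwards [eventually_eigenvalue_near_one hf hε] with g hg
  have hev : ∀ μ, (transRep f g).HasEigenvalue μ → μ ≠ 0 ∧ |(Complex.log μ).im| ≤ δ :=
    fun μ hμ => hball (by rw [dist_eq_norm]; exact hg μ hμ)
  have hfd := finiteDimensional_transSpan hf
  let l : Module.Dual ℂ (transSpan f) := (LinearMap.proj (1 : G)).comp (transSpan f).subtype
  choose q hq hq' using fun s => exists_expPoly (transRep f g) (fun μ hμ => (hev μ hμ).1) l
    ⟨f s, mem_transSpan f s⟩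
  have hcoord : ∀ s (k : ℕ), f s (g ^ k) = (q s).sum fun μ p => μ ^ k * p.eval (k : ℂ) := by
    intro s k
    rw [← hq', ← map_pow]
    change _ = f s (1 * g ^ k)
    rw [one_mul]
  obtain ⟨r, u, F, hF, hFk, hFp⟩ := exists_torus_param D δ hδ hδ0.le q
    fun s μ hμ => hev μ (hq s μ hμ)
  have hvan : ∀ p ∈ I, ∀ x, eval (fun s => F s x) p = 0 := by
    intro p hp x
    suffices h : I ≤ RingHom.ker (eval fun s => F s x) from h hp
    rw [← hgens, Submodule.span_le]
    intro p hp
    refine hFp p (Finset.le_sup (f := totalDegree) hp) (fun k => ?_) x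
    simp only [hFk, ← hcoord]
    exact (hI p).mp (by rw [← hgens]; exact Submodule.subset_span hp) (g ^ k)
  choose Φ hΦ using fun x => hcl (fun s => F s x) fun p hp => hvan p ((hI p).mpr hp) x
  have hΦreg : IsReg Φ := by
    refine isReg_of_adjoin S hS fun s hs => ?_
    have : s ∘ Φ = F ⟨s, hs⟩ := funext fun x => congrFun (hΦ x) ⟨s, hs⟩
    rw [this]
    exact hF _
  have hk : ∀ k : ℕ, Φ (u k, k) = g ^ k := fun k => hemb.injective (by
    rw [hΦ]
    ext s
    rw [hFk, ← hcoord])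
  exact ⟨_, IsNice.of_range hΦreg, ⟨_, (hk 0).trans (pow_zero g)⟩, ⟨_, (hk 1).trans (pow_one g)⟩⟩

theorem isOpen_core : IsOpen (core G : Set G) := by
  refine Subgroup.isOpen_of_mem_nhds _ (g := 1) ?_
  filter_upwards [eventually_isNice (G := G)] with g ⟨s, hs, h1, hg⟩
  exact subset_core hs h1 hg

end AlgGrp

namespace AffVar

variable {X : Type} [TopologicalSpace X] [AffVar X]

theorem IsZar.union {s t : Set X} (hs : IsZar s) (ht : IsZar t) : IsZar (s ∪ t) := by
  intro x hx
  by_contra hc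
  rw [Set.mem_union, not_or] at hc
  have h1 : ∃ f ∈ RegFun X, (∀ y ∈ s, f y = 0) ∧ f x ≠ 0 := by
    by_contra! h; exact hc.1 (hs fun f hf h0 => h f hf h0)
  have h2 : ∃ f ∈ RegFun X, (∀ y ∈ t, f y = 0) ∧ f x ≠ 0 := by
    by_contra! h; exact hc.2 (ht fun f hf h0 => h f hf h0)
  obtain ⟨f, hf, hf0, hfx⟩ := h1
  obtain ⟨g, hg, hg0, hgx⟩ := h2
  refine mul_ne_zero hfx hgx (hx (f * g) (mul_mem hf hg) ?_)
  rintro y (hy | hy)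
  · simp [hf0 y hy]
  · simp [hg0 y hy]

theorem isZar_empty : IsZar (∅ : Set X) := fun _ hx =>
  one_ne_zero (hx 1 (one_mem _) fun _ hy => absurd hy (Set.notMem_empty _))

theorem isZar_biUnion {κ : Type} {t : Set κ} (ht : t.Finite) {s : κ → Set X}
    (hs : ∀ k ∈ t, IsZar (s k)) : IsZar (⋃ k ∈ t, s k) := by
  induction t, ht using Set.Finite.induction_on with
  | empty => simpa using isZar_empty
  | insert _ _ ih =>
    rw [Set.biUnion_insert]
    exact (hs _ (Set.mem_insert _ _)).union (ih fun k hk => hs k (Set.mem_insert_of_mem _ hk))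

/-- The zero set of an ideal of regular functions. -/
def zeroSet (p : Ideal (RegFun X)) : Set X := {x | ∀ f ∈ p, f.1 x = 0}

theorem isZar_zeroSet (p : Ideal (RegFun X)) : IsZar (zeroSet p) := fun _ hx f hf =>
  hx f.1 f.2 fun _ hy => hy f hf

theorem irred_zeroSet (p : Ideal (RegFun X)) [hp : p.IsPrime] :
    let _ := ofIsZar (isZar_zeroSet p)
    Irred (zeroSet p) := by
  intro _
  have key : ∀ r : RegFun X, r ∉ p → ∃ x : zeroSet p, r.1 x.1 ≠ 0 := by
    intro r hr
    obtain ⟨φ, hφ⟩ := exists_complexPoint_ne_zero (R := RegFun X ⧸ p)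
      (r := Ideal.Quotient.mk p r) (by rwa [Ne, Ideal.Quotient.eq_zero_iff_mem])
    obtain ⟨x, hx⟩ := pts (φ.comp (Ideal.Quotient.mkₐ ℂ p))
    have hx' : ∀ f : RegFun X, φ (Ideal.Quotient.mk p f) = f.1 x := fun f => (hx f)
    refine ⟨⟨x, fun f hf => ?_⟩, ?_⟩
    · rw [← hx', Ideal.Quotient.eq_zero_iff_mem.mpr hf, map_zero]
    · rwa [← hx']
  constructor
  · obtain ⟨x, -⟩ := key 1 fun h => hp.ne_top ((Ideal.eq_top_iff_one _).mpr h)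
    exact ⟨x⟩
  · rintro _ ⟨f, hf, rfl⟩ _ ⟨g, hg, rfl⟩ h1 h2
    obtain ⟨x1, h1⟩ := exists_ne_of_ne_zero h1
    obtain ⟨x2, h2⟩ := exists_ne_of_ne_zero h2
    obtain ⟨x, hx⟩ := key (⟨f, hf⟩ * ⟨g, hg⟩) fun h => (hp.mem_or_mem h).elim
      (fun h => h1 (x1.2 _ h)) fun h => h2 (x2.2 _ h)
    exact ⟨x, left_ne_zero_of_mul hx, right_ne_zero_of_mul hx⟩

end AffVar

namespace AlgGrp

open AffVar Topology

variable {G : Type} [Group G] [TopologicalSpace G] [AffVar G] [AlgGrp G]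
  {H : Type} [Group H] [TopologicalSpace H] [AffVar H] [AlgGrp H]

variable (G) in
theorem countable_quotient_core : Countable (G ⧸ core G) := by
  have := QuotientGroup.discreteTopology (isOpen_core (G := G))
  have := secondCountableTopology G
  have : LindelofSpace (G ⧸ core G) := by
    have h := isLindelof_univ.image (QuotientGroup.continuous_mk (N := core G))
    rw [Set.image_univ, QuotientGroup.mk_surjective.range_eq] at h
    exact isLindelof_univ_iff.mp h
  exact countable_of_Lindelof_of_discrete

theorem isZar_coset (N : Subgroup G) [hN : IsZarSubgroup N] (c : G ⧸ N) :
    IsZar {x : G | (x : G ⧸ N) = c} := by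
  obtain ⟨g, rfl⟩ := QuotientGroup.mk_surjective c
  have : {x : G | (x : G ⧸ N) = g} = (fun x => g⁻¹ * x) ⁻¹' (N : Set G) := by
    ext x
    rw [Set.mem_ofPred_eq, eq_comm, QuotientGroup.eq]
    rfl
  rw [this]
  exact hN.isZar.preimage (isReg_mul_left _)

/-- An algebraic group that is connected in the Zariski topology is its own core. -/
theorem core_eq_top_of_connected (h : ∀ V W : Set G, IsZar V → IsZar W → V ∪ W = Set.univ →
    V ∩ W = ∅ → V = Set.univ ∨ W = Set.univ) : core G = ⊤ := by
  have := countable_quotient_core G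
  have hcoset : ∀ p ∈ minimalPrimes (RegFun G), ∃ c : G ⧸ core G, ∀ x ∈ zeroSet p, (x : G ⧸ core G) = c := by
    intro p hp
    have hpp : p.IsPrime := hp.1.1
    let _ := ofIsZar (isZar_zeroSet p)
    have := irred_zeroSet p
    have hreg : IsReg (Subtype.val : zeroSet p → G) := fun f hf => ⟨f, hf, rfl⟩
    obtain ⟨c, hc⟩ := exists_eq_univ_of_countable_cover
      (fun c : G ⧸ core G => {x : zeroSet p | (x.1 : G ⧸ core G) = c})
      (fun c => (isZar_coset _ c).preimage hreg) fun x => ⟨_, rfl⟩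
    exact ⟨c, fun x hx => by
      have : (⟨x, hx⟩ : zeroSet p) ∈ {x : zeroSet p | (x.1 : G ⧸ core G) = c} := by
        rw [hc]; trivial
      exact this⟩
  have hcov : ∀ x : G, ∃ p ∈ minimalPrimes (RegFun G), x ∈ zeroSet p := by
    intro x
    have : (RingHom.ker (evalAt x)).IsPrime := RingHom.ker_isPrime _
    obtain ⟨p, hp, hle⟩ := Ideal.exists_minimalPrimes_le (I := ⊥) (J := RingHom.ker (evalAt x)) bot_le
    exact ⟨p, hp, fun f hf => hle hf⟩
  have hfin : (Set.range fun x : G => (x : G ⧸ core G)).Finite := by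
    choose! c hc using hcoset
    refine ((minimalPrimes.finite_of_isNoetherianRing (RegFun G)).image c).subset ?_
    rintro _ ⟨x, rfl⟩
    obtain ⟨p, hp, hx⟩ := hcov x
    exact ⟨p, hp, (hc p hp x hx).symm⟩
  have hW := isZar_biUnion (hfin.subset (Set.sdiff_subset (t := {((1 : G) : G ⧸ core G)})))
    (s := fun c => {x : G | (x : G ⧸ core G) = c}) fun c _ => isZar_coset _ c
  have hor := h _ _ (isZar_coset (core G) ((1 : G) : G ⧸ core G)) hW (by
    ext x
    by_cases hx : (x : G ⧸ core G) = (1 : G) <;> simp [hx]) (by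
    ext x
    simp only [Set.mem_inter_iff, Set.mem_ofPred_eq, Set.mem_iUnion, Set.mem_empty_iff_false,
      iff_false, not_and, not_exists]
    rintro hx c ⟨-, hc⟩ hxc
    exact hc (hxc.symm.trans hx))
  rcases hor with h | h
  · refine (Subgroup.eq_top_iff' _).mpr fun x => ?_
    have : x ∈ {x : G | (x : G ⧸ core G) = (1 : G)} := by rw [h]; trivial
    rw [Set.mem_ofPred_eq, eq_comm, QuotientGroup.eq] at this
    simpa using this
  · have : (1 : G) ∈ (Set.univ : Set G) := trivial
    rw [← h] at this
    simp at this

theorem isNice_univ (hG : core G = ⊤) : IsNice (Set.univ : Set G) := by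
  have := isNice_core (G := G)
  rwa [hG] at this

theorem core_eq_top (h : IsNice (Set.univ : Set G)) : core G = ⊤ :=
  (Subgroup.eq_top_iff' _).mpr fun _ => subset_core h trivial trivial

variable (G) in
theorem core_core : core (core G) = ⊤ := by
  obtain ⟨T, _, _, f, _, _, hf, hr⟩ := isNice_core (G := G)
  refine core_eq_top ⟨T, _, _, fun t => ⟨f t, hr.subset (Set.mem_range_self t)⟩, ‹_›, ‹_›,
    isReg_subgroup_iff.mpr hf, ?_⟩
  refine Set.eq_univ_of_forall fun x => ?_
  have : x.1 ∈ Set.range f := hr.superset x.2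
  obtain ⟨t, ht⟩ := this
  exact ⟨t, Subtype.ext ht⟩

/-- A surjective homomorphism onto a connected group remains surjective on the core. -/
theorem exists_mem_core (f : H →* G) (hf : IsReg f) (hs : Function.Surjective f)
    (hG : core G = ⊤) (g : G) : ∃ h ∈ core H, f h = g := by
  have hirr : Irred G := (isNice_univ hG).irred
  have hN : IsNice (((core H).map f : Subgroup G) : Set G) := by
    rw [Subgroup.coe_map]; exact (isNice_core (G := H)).image hf
  have hz : IsZarSubgroup ((core H).map f) := ⟨hN.isZar⟩
  have hc : Countable (G ⧸ (core H).map f) := by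
    have := countable_quotient_core H
    let φ : H ⧸ core H → G ⧸ (core H).map f := Quotient.lift (fun h => (f h : G ⧸ (core H).map f))
      fun a b hab => by
        rw [QuotientGroup.eq, ← map_inv, ← map_mul]
        exact Subgroup.mem_map_of_mem f (QuotientGroup.leftRel_apply.mp hab)
    refine Function.Surjective.countable (f := φ) fun c => ?_
    obtain ⟨g, rfl⟩ := QuotientGroup.mk_surjective c
    obtain ⟨h, rfl⟩ := hs g
    exact ⟨(h : H ⧸ core H), rfl⟩
  obtain ⟨c, hc⟩ := exists_eq_univ_of_countable_cover _ (isZar_coset ((core H).map f))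
    fun x => ⟨_, rfl⟩
  have h1 : (1 : G) ∈ {x : G | (x : G ⧸ (core H).map f) = c} := by rw [hc]; trivial
  have hg : g ∈ {x : G | (x : G ⧸ (core H).map f) = c} := by rw [hc]; trivial
  have := QuotientGroup.eq.mp (Eq.trans h1 (Eq.symm hg))
  rw [inv_one, one_mul] at this
  exact Subgroup.mem_map.mp this

theorem core_eq_top_of_injective (f : H →* G) (hf : IsReg f) (hi : Function.Injective f)
    (hs : Function.Surjective f) (hG : core G = ⊤) : core H = ⊤ := by
  refine (Subgroup.eq_top_iff' _).mpr fun x => ?_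
  obtain ⟨h, hh, he⟩ := exists_mem_core f hf hs hG (f x)
  rwa [← hi he]

/-- A homomorphism is regular as soon as it is regular after pulling back along a surjective
regular map from an irreducible variety. -/
theorem isReg_of_comp {T : Type} [TopologicalSpace T] [AffVar T] [Irred T] {f : T → G}
    (hf : IsReg f) (hs : Function.Surjective f) (s : G →* H) (h : IsReg (s ∘ f)) : IsReg s := by
  classical
  have hirr : Irred G := Irred.of_surjective hf hs
  intro φ hφ
  obtain ⟨n, a, c, hac⟩ := exists_eq_sum_mul (AlgGrp.mul φ hφ)
  choose b hb hb0 hab using fun k => exists_mul_mem_of_comp_mem hf hs ((a k).1 ∘ s)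
    (h (a k).1 (a k).2)
  let J : Ideal (RegFun G) :=
    { carrier := {u | ∀ g, u.1 * (fun x => φ (s x * g)) ∈ RegFun G}
      add_mem' := fun hu hv g => by
        rw [Subalgebra.coe_add, add_mul]; exact add_mem (hu g) (hv g)
      zero_mem' := fun g => by simp [zero_mem]
      smul_mem' := fun r u hu g => by
        rw [smul_eq_mul, Subalgebra.coe_mul, mul_assoc]; exact mul_mem r.2 (hu g) }
  let B : RegFun G := ∏ k, ⟨b k, hb k⟩
  have hB0 : B ≠ 0 := Finset.prod_ne_zero_iff.mpr fun k _ h => hb0 k (congrArg Subtype.val h)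
  have hBa : ∀ k, B.1 * ((a k).1 ∘ s) ∈ RegFun G := by
    intro k
    have : B = (∏ j ∈ Finset.univ.erase k, ⟨b j, hb j⟩) * ⟨b k, hb k⟩ :=
      (Finset.prod_erase_mul _ _ (Finset.mem_univ k)).symm
    rw [this, Subalgebra.coe_mul, mul_assoc]
    exact mul_mem (Subtype.mem _) (hab k)
  have hBJ : B ∈ J := by
    intro g
    have : (B.1 * fun x => φ (s x * g)) = ∑ k, (c k).1 g • (B.1 * ((a k).1 ∘ s)) := by
      ext x
      have := hac (s x) g
      simp only [Function.comp_apply] at this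
      rw [Pi.mul_apply, this, Finset.mul_sum, Finset.sum_apply]
      refine Finset.sum_congr rfl fun k _ => ?_
      simp only [Pi.smul_apply, Pi.mul_apply, Function.comp_apply, smul_eq_mul]
      ring
    rw [this]
    exact sum_mem fun k _ => (RegFun G).smul_mem (hBa k) _
  have hJ : J = ⊤ := by
    by_contra hJ
    obtain ⟨ψ, hψ⟩ := exists_complexPoint_of_ne_top hJ
    obtain ⟨x0, hx0⟩ := pts ψ
    obtain ⟨x1, hx1⟩ := exists_ne_of_ne_zero (f := B.1) fun h => hB0 (Subtype.ext h)
    let B' : RegFun G := ⟨_, isReg_mul_right (x0⁻¹ * x1) B.1 B.2⟩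
    have hB' : B' ∈ J := fun g => by
      have := isReg_mul_right (x0⁻¹ * x1) _ (hBJ (s (x0⁻¹ * x1)⁻¹ * g))
      convert this using 1
      ext x
      simp [B', ← mul_assoc]
    have := hψ B' hB'
    rw [hx0] at this
    simp only [B', Function.comp_apply, mul_inv_cancel_left] at this
    exact hx1 this
  have := (hJ ▸ Submodule.mem_top : (1 : RegFun G) ∈ J) 1
  simpa [Function.comp_def] using this

end AlgGrp

namespace AlgGrp

open AffVar

variable {G H : Type} [Group G] [TopologicalSpace G] [AffVar G] [AlgGrp G]
  [Group H] [TopologicalSpace H] [AffVar H] [AlgGrp H]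

/-- A surjective homomorphism with finite kernel from a path connected group onto a simply
connected group is injective. -/
theorem injective_of_finite_ker [PathConnectedSpace H] (f : H →* G) (hf : IsReg f)
    (hs : Function.Surjective f) (hk : (f.ker : Set H).Finite)
    (hπ : ∀ γ : Path (1 : G) 1, γ.Homotopic (Path.refl 1)) : Function.Injective f := by
  have := t2Space H
  have := t2Space G
  have := sigmaCompactSpace H
  have := locallyCompactSpace G
  have hq : Topology.IsQuotientMap f :=
    (f.isOpenMap_of_sigmaCompact hs hf.continuous).isQuotientMap hf.continuous hs
  have hcov : IsCoveringMap f :=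
    (hq.isQuotientCoveringMap_of_isDiscrete_ker_monoidHom hk.isDiscrete).isCoveringMap
  refine (injective_iff_map_eq_one f).mpr fun x hx => ?_
  let γ : Path (1 : H) x := PathConnectedSpace.somePath 1 x
  have hγ := hπ ((γ.map hf.continuous).cast f.map_one.symm hx.symm)
  have hlift := (hcov.homotopicRel_iff_comp (f₀ := γ.toContinuousMap)
    (f₁ := ContinuousMap.const _ (1 : H)) (S := {0, 1}) ⟨0, by simp, by simp⟩).mpr (by
      have e1 : (ContinuousMap.mk f hcov.continuous).comp γ.toContinuousMap =
        ((γ.map hf.continuous).cast f.map_one.symm hx.symm).toContinuousMap := rfl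
      have e2 : (ContinuousMap.mk f hcov.continuous).comp (ContinuousMap.const _ (1 : H)) =
        (Path.refl (1 : G)).toContinuousMap := by
        ext t; simp
      rw [e1, e2]
      exact hγ)
  obtain ⟨F⟩ := hlift
  have h0 := F.eq_fst 1 (x := 1) (by simp)
  have h1 := F.apply_one 1
  rw [h0] at h1
  simpa using h1

/-- A surjective homomorphism with finite kernel onto a connected and simply connected group
splits. -/
theorem exists_section_of_finite_ker (hG : core G = ⊤) (f : H →* G) (hf : IsReg f)
    (hs : Function.Surjective f) (hk : (f.ker : Set H).Finite)
    (hπ : ∀ γ : Path (1 : G) 1, γ.Homotopic (Path.refl 1)) :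
    ∃ s : G →* H, IsReg s ∧ ∀ x, f (s x) = x := by
  have hn := isNice_univ (core_core H)
  have := hn.pathConnectedSpace
  have := hn.irred
  let f0 : core H →* G := f.comp (core H).subtype
  have hf0 : IsReg f0 := hf.comp (isReg_subtype _)
  have hs0 : Function.Surjective f0 := fun g => by
    obtain ⟨h, hh, he⟩ := exists_mem_core f hf hs hG g
    exact ⟨⟨h, hh⟩, he⟩
  have hk0 : (f0.ker : Set (core H)).Finite :=
    Set.Finite.preimage (f := (Subtype.val : core H → H)) Subtype.val_injective.injOn hk
  have hi0 := injective_of_finite_ker f0 hf0 hs0 hk0 hπ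
  let E := MulEquiv.ofBijective f0 ⟨hi0, hs0⟩
  refine ⟨(core H).subtype.comp E.symm.toMonoidHom, isReg_of_comp hf0 hs0 _ ?_, fun x => ?_⟩
  · convert isReg_subtype (core H) using 1
    ext x
    exact congrArg Subtype.val (E.symm_apply_apply x)
  · exact E.apply_symm_apply x

/-- A continuous map from a path connected space whose values lie in a finite set is
constant. -/
theorem eq_of_mem_finite {X : Type} [TopologicalSpace X] [PathConnectedSpace X] {f : X → G}
    (hf : Continuous f) {s : Set G} (hs : s.Finite) (h : ∀ x, f x ∈ s) (x y : X) :
    f x = f y := by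
  have := t2Space G
  exact isPreconnected_univ.constant_of_mapsTo hs.isDiscrete hf.continuousOn (fun x _ => h x)
    trivial trivial

end AlgGrp

namespace AlgGrp

open AffVar

/-- The algebra of functions spanned by the characters of a monoid. -/
def charAlg (A : Type) [Monoid A] : Subalgebra ℂ (A → ℂ) :=
  Algebra.adjoin ℂ (Set.range fun χ : A →* ℂ => (χ : A → ℂ))

theorem charAlg_le_span (A : Type) [Monoid A] {f : A → ℂ} (hf : f ∈ charAlg A) :
    f ∈ Submodule.span ℂ (Set.range fun χ : A →* ℂ => (χ : A → ℂ)) := by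
  have h : Submonoid.closure (Set.range fun χ : A →* ℂ => (χ : A → ℂ)) ≤
      { carrier := Set.range fun χ : A →* ℂ => (χ : A → ℂ)
        mul_mem' := by rintro _ _ ⟨χ, rfl⟩ ⟨ψ, rfl⟩; exact ⟨χ * ψ, rfl⟩
        one_mem' := ⟨1, rfl⟩ } := Submonoid.closure_le.mpr subset_rfl
  have : f ∈ Subalgebra.toSubmodule (charAlg A) := hf
  rw [charAlg, Algebra.adjoin_eq_span] at this
  exact Submodule.span_mono h this

/-- The Laurent coefficient functional attached to a character. -/
theorem exists_charCoeff {A : Type} [Monoid A] (χ : A →* ℂ) :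
    ∃ l : (A → ℂ) →ₗ[ℂ] ℂ, l χ = 1 ∧
      ∀ f ∈ charAlg A, ∀ a, l (fun x => f (x * a)) = χ a * l f := by
  classical
  have hli := linearIndependent_monoidHom A ℂ
  obtain ⟨l, hl⟩ := LinearMap.exists_extend
    ((Module.Basis.span hli).constr ℂ fun ψ : A →* ℂ => if ψ = χ then (1 : ℂ) else 0)
  have hl' : ∀ ψ : A →* ℂ, l ψ = if ψ = χ then (1 : ℂ) else 0 := by
    intro ψ
    have h1 := LinearMap.congr_fun hl (Module.Basis.span hli ψ)
    rw [Module.Basis.constr_basis] at h1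
    rw [← h1, LinearMap.comp_apply, Submodule.subtype_apply, Module.Basis.span_apply]
  refine ⟨l, by rw [hl', if_pos rfl], fun f hf a => ?_⟩
  let R : (A → ℂ) →ₗ[ℂ] (A → ℂ) :=
    { toFun := fun f x => f (x * a), map_add' := fun _ _ => rfl, map_smul' := fun _ _ => rfl }
  change (l ∘ₗ R) f = (χ a • l) f
  refine LinearMap.eqOn_span (s := Set.range fun ψ : A →* ℂ => (ψ : A → ℂ)) ?_
    (charAlg_le_span A hf)
  rintro _ ⟨ψ, rfl⟩
  have : R ψ = ψ a • (ψ : A → ℂ) := by ext x; simp [R, mul_comm]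
  simp only [LinearMap.comp_apply, this, map_smul, LinearMap.smul_apply, hl', smul_eq_mul]
  split_ifs with h
  · rw [h]
  · simp

/-- The standard torus. -/
abbrev Torus (k : ℕ) : Type := Fin k → ℂˣ

/-- A coordinate of the standard torus. -/
def Torus.coord {k : ℕ} (j : Fin k) : Torus k →* ℂ :=
  (Units.coeHom ℂ).comp (Pi.evalMonoidHom _ j)

@[simp] theorem Torus.coord_apply {k : ℕ} (j : Fin k) (a : Torus k) :
    Torus.coord j a = (a j : ℂ) := rfl

theorem Torus.regFun_le_charAlg (k : ℕ) : RegFun (Torus k) ≤ charAlg (Torus k) := by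
  have key : ∀ (c : Torus k →* ℂ), ∀ f ∈ RegFun ℂ, f ∘ c ∈ charAlg (Torus k) := by
    intro c f hf
    have : RegFun ℂ ≤ (charAlg (Torus k)).comap (precomp c) := by
      refine Algebra.adjoin_le ?_
      rintro _ rfl
      exact Algebra.subset_adjoin ⟨c, rfl⟩
    exact this hf
  refine Algebra.adjoin_le ?_
  rintro _ ⟨j, _, ⟨f, hf, rfl⟩, rfl⟩
  have : RegFun (ℂ × ℂ) ≤ (charAlg (Torus k)).comap
      (precomp fun a : Torus k => ((a j).1, ((a j)⁻¹).1)) := by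
    refine Algebra.adjoin_le ?_
    rintro _ (⟨f, hf, rfl⟩ | ⟨f, hf, rfl⟩)
    · exact key (Torus.coord j) f hf
    · exact key ((Torus.coord j).comp invMonoidHom) f hf
  exact this hf

theorem Torus.isReg_coord {k : ℕ} (j : Fin k) : IsReg (Torus.coord (k := k) j) :=
  isReg_units_val.comp (IsReg.apply j)

/-- A central extension of an algebraic group by a torus. -/
structure TorusExt (k : ℕ) (E G : Type) [Group E] [TopologicalSpace E] [AffVar E]
    [Group G] [TopologicalSpace G] [AffVar G] where
  i : Torus k →* E
  q : E →* G
  isReg_i : IsReg i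
  isReg_q : IsReg q
  injective : Function.Injective i
  surjective : Function.Surjective q
  exact : ∀ x, q x = 1 ↔ ∃ a, i a = x
  central : ∀ a x, i a * x = x * i a

namespace TorusExt

variable {k : ℕ} {E G : Type} [Group E] [TopologicalSpace E] [AffVar E] [AlgGrp E]
    [Group G] [TopologicalSpace G] [AffVar G] [AlgGrp G] (X : TorusExt k E G)

theorem q_i (a : Torus k) : X.q (X.i a) = 1 := (X.exact _).mpr ⟨a, rfl⟩

/-- A regular function restricting to a given coordinate of the torus. -/
theorem exists_extend_coord (j : Fin k) : ∃ Q ∈ RegFun E, ∀ a, Q (X.i a) = a j := by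
  have hz : IsZarSubgroup X.q.ker := ⟨isZar_setOf_eq X.isReg_q (IsReg.const 1)⟩
  let i' : Torus k →* X.q.ker := X.i.codRestrict _ X.q_i
  have hi' : IsReg i' := isReg_subgroup_iff.mpr X.isReg_i
  have hs' : Function.Surjective i' := fun x => by
    obtain ⟨a, ha⟩ := (X.exact x.1).mp x.2
    exact ⟨a, Subtype.ext ha⟩
  have hb' : Function.Bijective i' := ⟨fun a b h => X.injective (congrArg Subtype.val h), hs'⟩
  let e := MulEquiv.ofBijective i' hb'
  have he : IsReg e.symm.toMonoidHom := isReg_of_comp hi' hs' _ (by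
    convert IsReg.id (X := Torus k) using 1
    ext1 a
    exact e.symm_apply_apply a)
  obtain ⟨Q, hQ, hQe⟩ := isReg_complex_iff.mp ((Torus.isReg_coord j).comp he)
  refine ⟨Q, hQ, fun a => (congrFun hQe (i' a)).trans ?_⟩
  exact congrArg (fun b : Torus k => (b j : ℂ)) (e.symm_apply_apply a)

theorem exists_eigenfunction (j : Fin k) : ∃ f ∈ RegFun E, f 1 = 1 ∧
    ∀ x a, f (x * X.i a) = a j * f x := by
  obtain ⟨Q, hQ, hQi⟩ := X.exists_extend_coord j
  obtain ⟨l, hl1, hl⟩ := exists_charCoeff (Torus.coord j)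
  have hF : IsReg fun p : E × Torus k => p.1 * X.i p.2 :=
    IsReg.fst.mul (X.isReg_i.comp IsReg.snd)
  obtain ⟨n, b, c, hbc⟩ := exists_eq_sum_mul (hF Q hQ)
  have hchar : ∀ x, (fun a => Q (x * X.i a)) ∈ charAlg (Torus k) := fun x =>
    Torus.regFun_le_charAlg k (((isReg_mul_left x).comp X.isReg_i) Q hQ)
  refine ⟨fun x => l fun a => Q (x * X.i a), ?_, ?_, fun x a => ?_⟩
  · rw [← isReg_complex_iff]
    have : (fun x => l fun a => Q (x * X.i a)) = fun x => ∑ m, (b m).1 x * l (c m).1 := by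
      ext x
      have : (fun a => Q (x * X.i a)) = ∑ m, (b m).1 x • (c m).1 := by
        ext a
        simpa using hbc x a
      rw [this, map_sum]
      simp
    rw [this]
    exact isReg_sum _ fun m _ => isReg_mul (isReg_complex_iff.mpr (b m).2) (IsReg.const _)
  · simp only [one_mul, hQi]
    exact hl1
  · have := hl _ (hchar x) a
    rw [Torus.coord_apply] at this
    rw [← this]
    refine congrArg l (funext fun b => ?_)
    rw [mul_assoc, ← map_mul, mul_comm a b]

/-- A regular function spanning a representation on which the torus acts through a
coordinate. -/
def eigenfunction (j : Fin k) : Unit → E → ℂ := fun _ => (X.exists_eigenfunction j).choose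

theorem eigenfunction_mem (j : Fin k) (u : Unit) : X.eigenfunction j u ∈ RegFun E :=
  (X.exists_eigenfunction j).choose_spec.1

theorem eigenfunction_one (j : Fin k) (u : Unit) : X.eigenfunction j u 1 = 1 :=
  (X.exists_eigenfunction j).choose_spec.2.1

theorem eigenfunction_mul (j : Fin k) (u : Unit) (x : E) (a : Torus k) :
    X.eigenfunction j u (x * X.i a) = a j * X.eigenfunction j u x :=
  (X.exists_eigenfunction j).choose_spec.2.2 x a

/-- The representation spanned by an eigenfunction. -/
abbrev rep (j : Fin k) : E →* Module.End ℂ (transSpan (X.eigenfunction j)) :=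
  transRep (X.eigenfunction j)

instance (j : Fin k) : FiniteDimensional ℂ (transSpan (X.eigenfunction j)) :=
  finiteDimensional_transSpan (X.eigenfunction_mem j)

instance (j : Fin k) : Nontrivial (transSpan (X.eigenfunction j)) := by
  refine ⟨⟨_, mem_transSpan _ ()⟩, 0, fun h => ?_⟩
  exact one_ne_zero ((X.eigenfunction_one j ()).symm.trans (congrFun (congrArg Subtype.val h) 1))

theorem rep_i (j : Fin k) (a : Torus k) : X.rep j (X.i a) = (a j : ℂ) • 1 := by
  ext v x
  rw [transRep_apply]
  change v.1 (x * X.i a) = a j * v.1 x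
  obtain ⟨v, hv⟩ := v
  change v (x * X.i a) = a j * v x
  induction hv using Submodule.span_induction generalizing x with
  | mem w hw =>
    obtain ⟨⟨e, u⟩, rfl⟩ := hw
    simp only [rtrans_apply]
    rw [mul_assoc, X.central, ← mul_assoc, X.eigenfunction_mul]
  | zero => simp
  | add v w _ _ hv hw => simp only [Pi.add_apply, hv, hw]; ring
  | smul c v _ hv => simp only [Pi.smul_apply, hv, smul_eq_mul]; ring

/-- The degree with which the determinant character restricts to the torus. -/
def deg (j : Fin k) : ℕ := Module.finrank ℂ (transSpan (X.eigenfunction j))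

theorem deg_pos (j : Fin k) : 0 < X.deg j := Module.finrank_pos

/-- The determinant character attached to a coordinate of the torus. -/
def char (j : Fin k) : E →* ℂ := LinearMap.det.comp (X.rep j)

theorem char_i (j : Fin k) (a : Torus k) : X.char j (X.i a) = (a j : ℂ) ^ X.deg j := by
  rw [char, MonoidHom.comp_apply, rep_i, LinearMap.det_smul, map_one, mul_one, deg]

theorem isReg_char (j : Fin k) : IsReg (X.char j) := by
  classical
  let b := Module.finBasis ℂ (transSpan (X.eigenfunction j))
  have : (X.char j : E → ℂ) = fun x => ∑ σ : Equiv.Perm (Fin (Module.finrank ℂ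
      (transSpan (X.eigenfunction j)))), (Equiv.Perm.sign σ : ℂ) *
        ∏ m, b.coord (σ m) (X.rep j x (b m)) := by
    ext x
    rw [char, MonoidHom.comp_apply, ← LinearMap.det_toMatrix b, Matrix.det_apply']
    simp [LinearMap.toMatrix_apply]
  rw [this]
  exact isReg_sum _ fun σ _ => isReg_mul (IsReg.const _) (isReg_prod _ fun m _ =>
    isReg_coeff (X.eigenfunction_mem j) _ _)

/-- The kernel of all determinant characters on the torus is finite. -/
theorem finite_torsion : {x : E | X.q x = 1 ∧ ∀ j, X.char j x = 1}.Finite := by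
  have h : {a : Torus k | ∀ j, (a j : ℂ) ^ X.deg j = 1}.Finite := by
    have : {a : Torus k | ∀ j, (a j : ℂ) ^ X.deg j = 1} =
        Set.univ.pi fun j => {u : ℂˣ | (u : ℂ) ^ X.deg j = 1} := by ext a; simp
    rw [this]
    refine Set.Finite.pi fun j => ?_
    have hf : {z : ℂ | z ^ X.deg j = 1}.Finite := by
      refine ((Polynomial.nthRootsFinset (X.deg j) (1 : ℂ)).finite_toSet).subset fun z hz => ?_
      exact (Polynomial.mem_nthRootsFinset (X.deg_pos j) 1).mpr hz
    exact hf.preimage Units.val_injective.injOn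
  refine (h.image X.i).subset ?_
  rintro x ⟨hx, hc⟩
  obtain ⟨a, rfl⟩ := (X.exact x).mp hx
  exact ⟨a, fun j => by rw [← X.char_i, hc], rfl⟩

end TorusExt

end AlgGrp

/-- A commuting family of endomorphisms has a common eigenvector. -/
theorem Module.End.exists_common_eigenvector {V ι : Type} [AddCommGroup V] [Module ℂ V]
    [FiniteDimensional ℂ V] [Nontrivial V] (T : ι → Module.End ℂ V)
    (hT : ∀ i j, T i * T j = T j * T i) : ∃ v ≠ 0, ∀ i, ∃ c : ℂ, T i v = c • v := by
  let P : Submodule ℂ V → Prop := fun W => W ≠ ⊥ ∧ ∀ i, ∀ w ∈ W, T i w ∈ W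
  have hwf : WellFounded ((· < ·) : Submodule ℂ V → Submodule ℂ V → Prop) := wellFounded_lt
  obtain ⟨W, ⟨hW0, hWT⟩, hmin⟩ := hwf.has_min {W | P W}
    ⟨⊤, top_ne_bot, fun _ _ _ => Submodule.mem_top⟩
  obtain ⟨v, hvW, hv⟩ := Submodule.exists_mem_ne_zero_of_ne_bot hW0
  refine ⟨v, hv, fun i => ?_⟩
  have hnt : Nontrivial W := Submodule.nontrivial_iff_ne_bot.mpr hW0
  obtain ⟨c, hc⟩ := Module.End.exists_eigenvalue ((T i).restrict (hWT i))
  obtain ⟨w, hw⟩ := hc.exists_hasEigenvector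
  refine ⟨c, ?_⟩
  have hW' : P (W ⊓ (T i).eigenspace c) := by
    refine ⟨?_, ?_⟩
    · refine (Submodule.ne_bot_iff _).mpr ⟨w.1, ⟨w.2, ?_⟩, fun h => hw.2 (Subtype.ext h)⟩
      exact Module.End.mem_eigenspace_iff.mpr (congrArg Subtype.val hw.apply_eq_smul)
    · rintro j x ⟨hxW, hx⟩
      refine ⟨hWT j x hxW, Module.End.mem_eigenspace_iff.mpr ?_⟩
      rw [← Module.End.mul_apply, hT, Module.End.mul_apply, Module.End.mem_eigenspace_iff.mp hx,
        map_smul]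
  have hle : W ≤ W ⊓ (T i).eigenspace c := by
    by_contra hlt
    exact hmin _ hW' (lt_of_le_not_ge inf_le_left hlt)
  exact Module.End.mem_eigenspace_iff.mp (hle hvW).2

namespace AlgGrp

namespace TorusExt

open AffVar

variable {k : ℕ} {E G H : Type} [Group E] [TopologicalSpace E] [AffVar E] [AlgGrp E]
    [Group G] [TopologicalSpace G] [AffVar G] [AlgGrp G]
    [Group H] [TopologicalSpace H] [AffVar H] [AlgGrp H] (X : TorusExt k E G)

theorem char_ne_zero (j : Fin k) (x : E) : X.char j x ≠ 0 :=
  ((Group.isUnit x).map (X.char j)).ne_zero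

/-- Continuous families which agree over the base and on all determinant characters agree as
soon as they agree at one point. -/
theorem eq_of_eq_at {T : Type} [TopologicalSpace T] [PathConnectedSpace T] {f g : T → E}
    (hf : Continuous f) (hg : Continuous g) (hq : ∀ t, X.q (f t) = X.q (g t))
    (hc : ∀ t j, X.char j (f t) = X.char j (g t)) {t₀ : T} (h₀ : f t₀ = g t₀) (t : T) :
    f t = g t := by
  have hmem : ∀ t, f t * (g t)⁻¹ ∈ {x : E | X.q x = 1 ∧ ∀ j, X.char j x = 1} := by
    intro t
    refine ⟨by rw [map_mul, map_inv, hq, mul_inv_cancel], fun j => ?_⟩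
    rw [map_mul, hc, ← map_mul, mul_inv_cancel, map_one]
  have : f t * (g t)⁻¹ = f t₀ * (g t₀)⁻¹ :=
    eq_of_mem_finite (hf.mul hg.inv) X.finite_torsion hmem t t₀
  rw [h₀, mul_inv_cancel] at this
  exact mul_inv_eq_one.mp this

/-- The pullback of the extension along a homomorphism. -/
def pullback (p : H →* G) : Subgroup (H × E) :=
  MonoidHom.eqLocus (X.q.comp (MonoidHom.snd H E)) (p.comp (MonoidHom.fst H E))

theorem mem_pullback {p : H →* G} {w : H × E} : w ∈ X.pullback p ↔ X.q w.2 = p w.1 := Iff.rfl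

theorem isZarSubgroup_pullback {p : H →* G} (hp : IsReg p) : IsZarSubgroup (X.pullback p) :=
  ⟨isZar_setOf_eq (X.isReg_q.comp IsReg.snd) (hp.comp IsReg.fst)⟩

theorem exists_lift_of_simplyConnected (hH : core H = ⊤) {p : H →* G} (hp : IsReg p)
    (hπ : ∀ γ : Path (1 : H) 1, γ.Homotopic (Path.refl 1)) :
    ∃ s : H →* E, IsReg s ∧ (∀ x, X.q (s x) = p x) ∧ ∀ x j, X.char j (s x) = 1 := by
  let K : Subgroup (H × E) := X.pullback p ⊓ ⨅ j, ((X.char j).comp (MonoidHom.snd H E)).ker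
  have hK : ∀ w, w ∈ K ↔ X.q w.2 = p w.1 ∧ ∀ j, X.char j w.2 = 1 := fun w => by
    simp only [K, Subgroup.mem_inf, Subgroup.mem_iInf]
    rfl
  have hz : IsZarSubgroup K := by
    refine ⟨?_⟩
    have : (K : Set (H × E)) = (X.pullback p : Set (H × E)) ∩ ⋂ j, {w | X.char j w.2 = 1} := by
      ext w
      rw [SetLike.mem_coe, hK, Set.mem_inter_iff, Set.mem_iInter]
      rfl
    rw [this]
    exact (X.isZarSubgroup_pullback hp).isZar.inter (isZar_iInter fun j =>
      isZar_setOf_eq ((X.isReg_char j).comp IsReg.snd) (IsReg.const 1))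
  let f : K →* H := (MonoidHom.fst H E).comp K.subtype
  have hf : IsReg f := IsReg.fst.comp (isReg_subtype K)
  have hs : Function.Surjective f := by
    intro x
    obtain ⟨e, he⟩ := X.surjective (p x)
    choose z hz using fun j => IsAlgClosed.exists_pow_nat_eq (X.char j e)⁻¹ (X.deg_pos j)
    have hz0 : ∀ j, z j ≠ 0 := fun j h => by
      have := hz j
      rw [h, zero_pow (X.deg_pos j).ne'] at this
      exact inv_ne_zero (X.char_ne_zero j e) this.symm
    let a : Torus k := fun j => Units.mk0 (z j) (hz0 j)
    refine ⟨⟨(x, e * X.i a), (hK _).mpr ⟨?_, fun j => ?_⟩⟩, rfl⟩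
    · rw [map_mul, X.q_i, mul_one, he]
    · rw [map_mul, X.char_i]
      change _ * z j ^ _ = 1
      rw [hz, mul_inv_cancel₀ (X.char_ne_zero j e)]
  have hk : (f.ker : Set K).Finite := by
    refine Set.Finite.of_finite_image (f := fun w : K => w.1.2)
      (X.finite_torsion.subset ?_) ?_
    · rintro _ ⟨w, hw, rfl⟩
      have h1 : w.1.1 = 1 := hw
      have := (hK w.1).mp w.2
      rw [h1, map_one] at this
      exact this
    · intro v hv w hw h
      exact Subtype.ext (Prod.ext (Eq.trans (b := 1) hv (Eq.symm hw)) h)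
  obtain ⟨s, hs, hfs⟩ := exists_section_of_finite_ker hH f hf hs hk hπ
  refine ⟨(MonoidHom.snd H E).comp (K.subtype.comp s),
    IsReg.snd.comp ((isReg_subtype K).comp hs), fun x => ?_, fun x => ((hK _).mp (s x).2).2⟩
  exact (((hK _).mp (s x).2).1).trans (congrArg p (hfs x))

/-- The pullback of the extension along a homomorphism from a connected commutative group is
commutative. -/
theorem pullback_comm (hH : core H = ⊤) {p : H →* G} (hp : IsReg p)
    (hc : ∀ x y : H, x * y = y * x) (v w : X.pullback p) : v * w = w * v := by
  have hz := X.isZarSubgroup_pullback hp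
  let P := X.pullback p
  have hn := (isNice_univ (core_core P)).pathConnectedSpace
  have hval : IsReg fun c : core P => c.1.1.2 :=
    IsReg.snd.comp ((isReg_subtype P).comp (isReg_subtype (core P)))
  have hcore : ∀ c d : core P, c * d = d * c := by
    intro c d
    refine Subtype.ext (Subtype.ext (Prod.ext (hc _ _) ?_))
    refine X.eq_of_eq_at (T := core P × core P) (f := fun t => t.1.1.1.2 * t.2.1.1.2)
      (g := fun t => t.2.1.1.2 * t.1.1.1.2) (t₀ := 1) ?_ ?_ ?_ ?_ ?_ (c, d)
    · exact (hval.continuous.comp continuous_fst).mul (hval.continuous.comp continuous_snd)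
    · exact (hval.continuous.comp continuous_snd).mul (hval.continuous.comp continuous_fst)
    · intro t
      rw [map_mul, map_mul, X.mem_pullback.mp t.1.1.2, X.mem_pullback.mp t.2.1.2, ← map_mul, hc,
        map_mul]
    · intro t j
      rw [map_mul, map_mul, mul_comm]
    · rfl
  let f : P →* H := (MonoidHom.fst H E).comp P.subtype
  have hf : IsReg f := IsReg.fst.comp (isReg_subtype P)
  have hs : Function.Surjective f := fun x => by
    obtain ⟨e, he⟩ := X.surjective (p x)
    exact ⟨⟨(x, e), he⟩, rfl⟩
  have hdec : ∀ w : P, ∃ c : core P, ∃ a, w.1.2 = c.1.1.2 * X.i a := by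
    intro w
    obtain ⟨c, hcP, hcw⟩ := exists_mem_core f hf hs hH (f w)
    have h1 : X.q (c.1.2⁻¹ * w.1.2) = 1 := by
      rw [map_mul, map_inv, X.mem_pullback.mp c.2, X.mem_pullback.mp w.2]
      exact inv_mul_eq_one.mpr (congrArg p hcw)
    obtain ⟨a, ha⟩ := (X.exact _).mp h1
    exact ⟨⟨c, hcP⟩, a, by rw [ha, mul_inv_cancel_left]⟩
  refine Subtype.ext (Prod.ext (hc _ _) ?_)
  obtain ⟨c, a, hv⟩ := hdec v
  obtain ⟨d, b, hw⟩ := hdec w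
  have hcd : c.1.1.2 * d.1.1.2 = d.1.1.2 * c.1.1.2 :=
    congrArg (fun t : core P => t.1.1.2) (hcore c d)
  change v.1.2 * w.1.2 = w.1.2 * v.1.2
  rw [hv, hw, mul_assoc, ← mul_assoc (X.i a), X.central a, mul_assoc d.1.1.2,
    mul_assoc d.1.1.2, ← mul_assoc (X.i b), X.central b, mul_assoc c.1.1.2, ← mul_assoc,
    ← mul_assoc, hcd, X.central b]
  simp only [mul_assoc]

theorem exists_lift_of_comm (hH : core H = ⊤) {p : H →* G} (hp : IsReg p)
    (hc : ∀ x y : H, x * y = y * x) : ∃ s : H →* E, IsReg s ∧ ∀ x, X.q (s x) = p x := by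
  have hz := X.isZarSubgroup_pullback hp
  let P := X.pullback p
  let f : P →* H := (MonoidHom.fst H E).comp P.subtype
  have hf : IsReg f := IsReg.fst.comp (isReg_subtype P)
  have hs : Function.Surjective f := fun x => by
    obtain ⟨e, he⟩ := X.surjective (p x)
    exact ⟨⟨(x, e), he⟩, rfl⟩
  let r : P →* E := (MonoidHom.snd H E).comp P.subtype
  have hr : IsReg r := IsReg.snd.comp (isReg_subtype P)
  choose v hv0 c hcv using fun j => Module.End.exists_common_eigenvector
    (fun w : P => X.rep j (r w)) fun w w' => by
      rw [← map_mul, ← map_mul, X.pullback_comm hH hp hc, map_mul r, map_mul (X.rep j)]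
  have hcu : ∀ j w d, X.rep j (r w) (v j) = d • v j → c j w = d := fun j w d h =>
    smul_left_injective ℂ (hv0 j) ((hcv j w).symm.trans h)
  let ψ : Fin k → P →* ℂ := fun j =>
    { toFun := c j
      map_one' := hcu j 1 1 (by simp)
      map_mul' := fun w w' => hcu j _ _ (by
        rw [map_mul, map_mul, Module.End.mul_apply, hcv, map_smul, hcv, smul_smul, mul_comm]) }
  have hψ : ∀ j, IsReg (ψ j) := by
    intro j
    obtain ⟨l, hl⟩ := Module.Projective.exists_dual_ne_zero ℂ (hv0 j)
    have : (ψ j : P → ℂ) = fun w => l (X.rep j (r w) (v j)) * (l (v j))⁻¹ := by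
      ext w
      rw [hcv, map_smul, smul_eq_mul, mul_inv_cancel_right₀ hl]
      rfl
    rw [this]
    exact isReg_mul ((isReg_coeff (X.eigenfunction_mem j) l (v j)).comp hr) (IsReg.const _)
  let Ψ : P →* Torus k := MonoidHom.pi fun j => (ψ j).toHomUnits
  have hΨ : IsReg Ψ := IsReg.pi fun j => isReg_units_iff.mpr ⟨hψ j, by
    have : (fun w => ((Ψ w j)⁻¹ : ℂˣ).1) = fun w => ψ j w⁻¹ := by
      ext w
      rw [← Pi.inv_apply, ← map_inv]
      rfl
    rw [this]
    exact (hψ j).comp IsReg.id.inv⟩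
  let s' : P →* E :=
    { toFun := fun w => r w * X.i (Ψ w)⁻¹
      map_one' := by simp
      map_mul' := fun w w' => by
        rw [map_mul, map_mul, mul_inv, map_mul, mul_assoc, mul_assoc, ← mul_assoc (X.i _),
          X.central _ (r w'), mul_assoc] }
  have hs' : IsReg s' := hr.mul (X.isReg_i.comp hΨ.inv)
  have hker : f.ker ≤ s'.ker := by
    intro w hw
    have hw1 : w.1.1 = 1 := hw
    have hq : X.q (r w) = 1 := by
      have := X.mem_pullback.mp w.2
      rwa [hw1, map_one] at this
    obtain ⟨a, ha⟩ := (X.exact _).mp hq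
    have : Ψ w = a := by
      funext j
      refine Units.ext (hcu j w (a j) ?_)
      rw [← ha, X.rep_i]
      rfl
    change r w * X.i (Ψ w)⁻¹ = 1
    rw [this, ← ha, ← map_mul, mul_inv_cancel, map_one]
  let s : H →* E := f.liftOfSurjective hs ⟨s', hker⟩
  have hsf : ∀ w, s (f w) = s' w := fun w => f.liftOfRightInverse_comp_apply _ _ ⟨s', hker⟩ w
  refine ⟨s, ?_, fun x => ?_⟩
  · have hirr := (isNice_univ (core_core P)).irred
    refine isReg_of_comp (T := core P) (f := fun c => f c.1) (hf.comp (isReg_subtype _))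
      (fun x => ?_) s ?_
    · obtain ⟨c, hcP, hcx⟩ := exists_mem_core f hf hs hH x
      exact ⟨⟨c, hcP⟩, hcx⟩
    · have : (s ∘ fun c : core P => f c.1) = fun c => s' c.1 := funext fun c => hsf c.1
      rw [this]
      exact hs'.comp (isReg_subtype _)
  · obtain ⟨w, rfl⟩ := hs x
    rw [hsf]
    change X.q (r w * X.i (Ψ w)⁻¹) = _
    rw [map_mul, X.q_i, mul_one]
    exact X.mem_pullback.mp w.2

end TorusExt

end AlgGrp

namespace AlgGrp

namespace TorusExt

open AffVar

variable {k : ℕ} {E G H : Type} [Group E] [TopologicalSpace E] [AffVar E] [AlgGrp E]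
    [Group G] [TopologicalSpace G] [AffVar G] [AlgGrp G]
    [Group H] [TopologicalSpace H] [AffVar H] [AlgGrp H] (X : TorusExt k E G)

/-- Lifts to the extension of connected subgroups are equivariant for conjugation. -/
theorem lift_conj {p : H →* G} {U L : Subgroup H} [IsZarSubgroup U] [IsZarSubgroup L]
    [hU : U.Normal] (hUc : core U = ⊤) (hLc : core L = ⊤)
    {sU : U →* E} {sL : L →* E} (hsU : IsReg sU) (hsL : IsReg sL)
    (hqU : ∀ x, X.q (sU x) = p x) (hqL : ∀ x, X.q (sL x) = p x)
    (hχ : ∀ x j, X.char j (sU x) = 1) (l : L) (u : U) :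
    sL l * sU u = sU ⟨l * u * (l : H)⁻¹, hU.conj_mem u u.2 l⟩ * sL l := by
  have := (isNice_univ hUc).pathConnectedSpace
  have := (isNice_univ hLc).pathConnectedSpace
  have hl : IsReg fun t : L × U => t.1.1 := (isReg_subtype L).comp IsReg.fst
  have hu : IsReg fun t : L × U => t.2.1 := (isReg_subtype U).comp IsReg.snd
  have hconj : IsReg fun t : L × U => (⟨t.1 * t.2 * (t.1 : H)⁻¹, hU.conj_mem t.2 t.2.2 t.1⟩ : U) :=
    isReg_subgroup_iff.mpr ((hl.mul hu).mul hl.inv)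
  have hsL' : Continuous fun t : L × U => sL t.1 := (hsL.comp IsReg.fst).continuous
  refine X.eq_of_eq_at (T := L × U) (f := fun t => sL t.1 * sU t.2)
    (g := fun t => sU ⟨t.1 * t.2 * (t.1 : H)⁻¹, hU.conj_mem t.2 t.2.2 t.1⟩ * sL t.1)
    (hsL'.mul (hsU.comp IsReg.snd).continuous) ((hsU.comp hconj).continuous.mul hsL')
    (fun t => ?_) (fun t j => ?_) (t₀ := 1) ?_ (l, u)
  · simp only [map_mul, hqU, hqL]
    simp
  · simp only [map_mul, hχ, one_mul, mul_one]
  · simp only [Prod.fst_one, Prod.snd_one, map_one, one_mul]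
    have : (⟨(1 : L) * (1 : U) * ((1 : L) : H)⁻¹, hU.conj_mem _ (1 : U).2 (1 : L)⟩ : U) = 1 :=
      Subtype.ext (by simp)
    rw [this, map_one, one_mul]

/-- Lifts to the extension of commuting connected subgroups commute. -/
theorem lift_comm {p : H →* G} {S L : Subgroup H} [IsZarSubgroup S] [IsZarSubgroup L]
    (hSc : core S = ⊤) (hLc : core L = ⊤) (hSL : ∀ x ∈ L, ∀ y ∈ S, x * y = y * x)
    {sS : S →* E} {sL : L →* E} (hsS : IsReg sS) (hsL : IsReg sL)
    (hqS : ∀ x, X.q (sS x) = p x) (hqL : ∀ x, X.q (sL x) = p x) (l : L) (t : S) :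
    sL l * sS t = sS t * sL l := by
  have := (isNice_univ hSc).pathConnectedSpace
  have := (isNice_univ hLc).pathConnectedSpace
  have h1 : Continuous fun t : L × S => sL t.1 := (hsL.comp IsReg.fst).continuous
  have h2 : Continuous fun t : L × S => sS t.2 := (hsS.comp IsReg.snd).continuous
  refine X.eq_of_eq_at (T := L × S) (f := fun t => sL t.1 * sS t.2)
    (g := fun t => sS t.2 * sL t.1) (h1.mul h2) (h2.mul h1)
    (fun t => ?_) (fun t j => ?_) (t₀ := 1) ?_ (l, t)
  · simp only [map_mul, hqS, hqL]
    rw [← map_mul, ← map_mul, hSL _ t.1.2 _ t.2.2]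
  · simp only [map_mul, mul_comm]
  · simp

/-- Lifts to the extension of the factors of a decomposition `H = U ⋊ (Z × S)` assemble to a lift
of `H`. -/
theorem exists_lift_of_decomp {p : H →* G} {U Z S : Subgroup H} [IsZarSubgroup U]
    [IsZarSubgroup Z] [IsZarSubgroup S] [hU : U.Normal]
    (hUc : core U = ⊤) (hZc : core Z = ⊤) (hSc : core S = ⊤)
    (hZS : ∀ x ∈ Z, ∀ y ∈ S, x * y = y * x)
    (hdec : ∀ x : H, ∃ u : U, ∃ z : Z, ∃ t : S, x = u * (z * t))
    (hinter : ∀ (u : U) (z : Z) (t : S), (u : H) = z * t → u = 1)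
    (hinter' : ∀ (z : Z) (t : S), (z : H) = t → z = 1)
    {sU : U →* E} {sZ : Z →* E} {sS : S →* E} (hsU : IsReg sU) (hsZ : IsReg sZ) (hsS : IsReg sS)
    (hqU : ∀ x, X.q (sU x) = p x) (hqZ : ∀ x, X.q (sZ x) = p x) (hqS : ∀ x, X.q (sS x) = p x)
    (hχ : ∀ x j, X.char j (sU x) = 1) :
    ∃ s : H →* E, IsReg s ∧ ∀ x, X.q (s x) = p x := by
  choose u z t hx using hdec
  have huniq : ∀ (a : U) (b : Z) (c : S) (a' : U) (b' : Z) (c' : S),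
      (a : H) * (b * c) = a' * (b' * c') → a = a' ∧ b = b' ∧ c = c' := by
    intro a b c a' b' c' h
    have h1 : ((a'⁻¹ * a : U) : H) = ((b' * b⁻¹ : Z) : H) * ((c' * c⁻¹ : S) : H) := by
      have hcomm : ((b : H))⁻¹ * ((c' : H) * (c : H)⁻¹) = (c' : H) * (c : H)⁻¹ * (b : H)⁻¹ :=
        hZS _ (inv_mem b.2) _ (mul_mem c'.2 (inv_mem c.2))
      simp only [Subgroup.coe_mul, Subgroup.coe_inv]
      rw [mul_assoc (b' : H), hcomm, inv_mul_eq_iff_eq_mul]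
      have : (a : H) = a' * ((b' : H) * c') * ((b : H) * c)⁻¹ := eq_mul_inv_of_mul_eq h
      rw [this, mul_inv_rev]
      simp only [mul_assoc]
    have ha : a = a' := (inv_mul_eq_one.mp (hinter _ _ _ h1)).symm
    subst ha
    have h2 : (b : H) * c = b' * c' := mul_left_cancel h
    have hb : b'⁻¹ * b = 1 := hinter' _ (c' * c⁻¹) (by
      simp only [Subgroup.coe_mul, Subgroup.coe_inv]
      rw [inv_mul_eq_iff_eq_mul, ← mul_assoc]
      exact eq_mul_inv_of_mul_eq h2)
    have hb' : b = b' := (inv_mul_eq_one.mp hb).symm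
    subst hb'
    exact ⟨rfl, rfl, Subtype.ext (mul_left_cancel h2)⟩
  let F : H → E := fun x => sU (u x) * (sZ (z x) * sS (t x))
  have hF : ∀ (a : U) (b : Z) (c : S), F (a * (b * c)) = sU a * (sZ b * sS c) := by
    intro a b c
    obtain ⟨ha, hb, hc⟩ := huniq _ _ _ _ _ _ (hx (a * (b * c)))
    simp only [F]
    rw [← ha, ← hb, ← hc]
  let s : H →* E := MonoidHom.mk' F (by
    intro x y
    obtain ⟨v, hv⟩ : ∃ v : U, v = ⟨t x * u y * (t x : H)⁻¹, hU.conj_mem _ (u y).2 (t x)⟩ := ⟨_, rfl⟩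
    obtain ⟨w, hw⟩ : ∃ w : U, w = ⟨z x * v * (z x : H)⁻¹, hU.conj_mem _ v.2 (z x)⟩ := ⟨_, rfl⟩
    have e1 := X.lift_conj hUc hSc hsU hsS hqU hqS hχ (t x) (u y)
    have e2 := X.lift_conj hUc hZc hsU hsZ hqU hqZ hχ (z x) v
    have e3 := X.lift_comm hSc hZc hZS hsS hsZ hqS hqZ (z y) (t x)
    rw [← hv] at e1
    rw [← hw] at e2
    have e : x * y = ((u x * w : U) : H) * (((z x * z y : Z) : H) * ((t x * t y : S) : H)) := by
      have hc := hZS _ (z y).2 _ (t x).2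
      conv_lhs => rw [hx x, hx y]
      simp only [Subgroup.coe_mul, hv, hw]
      have : (z y : H) * (t x * t y) = t x * (z y * t y) := by
        rw [← mul_assoc, hc, mul_assoc]
      rw [mul_assoc (z x : H) (z y : H), this]
      group
    conv_lhs => rw [e]
    rw [hF, map_mul, map_mul, map_mul]
    simp only [F]
    calc _ = sU (u x) * (sU w * sZ (z x)) * (sZ (z y) * sS (t x)) * sS (t y) := by
          simp only [mul_assoc]
      _ = sU (u x) * (sZ (z x) * sU v) * (sS (t x) * sZ (z y)) * sS (t y) := by rw [← e2, e3]
      _ = sU (u x) * sZ (z x) * (sU v * sS (t x)) * sZ (z y) * sS (t y) := by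
          simp only [mul_assoc]
      _ = _ := by rw [← e1]; simp only [mul_assoc])
  have hs : ∀ (a : U) (b : Z) (c : S), s (a * (b * c)) = sU a * (sZ b * sS c) := hF
  refine ⟨s, ?_, fun x => ?_⟩
  · have := (isNice_univ hUc).irred
    have := (isNice_univ hZc).irred
    have := (isNice_univ hSc).irred
    refine isReg_of_comp (T := U × (Z × S)) (f := fun w : U × (Z × S) => (w.1 : H) * ((w.2.1 : H) * w.2.2)) ?_
      (fun x => ⟨(u x, z x, t x), (hx x).symm⟩) s ?_
    · exact ((isReg_subtype U).comp IsReg.fst).mul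
        (((isReg_subtype Z).comp (IsReg.fst.comp IsReg.snd)).mul
          ((isReg_subtype S).comp (IsReg.snd.comp IsReg.snd)))
    · have : (s ∘ fun w : U × (Z × S) => (w.1 : H) * (w.2.1 * w.2.2)) =
          fun w => sU w.1 * (sZ w.2.1 * sS w.2.2) := funext fun w => hs _ _ _
      rw [this]
      exact (hsU.comp IsReg.fst).mul ((hsZ.comp (IsReg.fst.comp IsReg.snd)).mul
          (hsS.comp (IsReg.snd.comp IsReg.snd)))
  · rw [hx x, hs, map_mul, map_mul, map_mul, map_mul, hqU, hqZ, hqS]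

end TorusExt

end AlgGrp

/-! ### Unipotent groups are simply connected -/

namespace AffVar

section Matrix

variable {X : Type} [TopologicalSpace X] [AffVar X] {m : ℕ}

theorem isReg_matrix_mul {f g : X → Matrix (Fin m) (Fin m) ℂ} (hf : IsReg f) (hg : IsReg g) :
    IsReg (fun x => f x * g x) :=
  RegMul.mul.comp (hf.prodMk hg)

theorem isReg_matrix_pow {f : X → Matrix (Fin m) (Fin m) ℂ} (hf : IsReg f) (n : ℕ) :
    IsReg (fun x => f x ^ n) := by
  induction n with
  | zero => simpa using IsReg.const (1 : Matrix (Fin m) (Fin m) ℂ)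
  | succ n ih => simpa only [pow_succ] using isReg_matrix_mul ih hf

theorem isReg_matrix_smul {c : X → ℂ} {f : X → Matrix (Fin m) (Fin m) ℂ} (hc : IsReg c)
    (hf : IsReg f) : IsReg (fun x => c x • f x) :=
  isReg_matrix fun i j => isReg_mul hc ((isReg_entry i j).comp hf)

theorem isReg_matrix_sum {κ : Type} (s : Finset κ) {f : κ → X → Matrix (Fin m) (Fin m) ℂ}
    (hf : ∀ k ∈ s, IsReg (f k)) : IsReg (fun x => ∑ k ∈ s, f k x) :=
  isReg_matrix fun i j => by
    simp only [Matrix.sum_apply]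
    exact isReg_sum s fun k hk => (isReg_entry i j).comp (hf k hk)

theorem isReg_matrix_sub {f g : X → Matrix (Fin m) (Fin m) ℂ} (hf : IsReg f) (hg : IsReg g) :
    IsReg (fun x => f x - g x) :=
  isReg_matrix fun i j => by
    have := isReg_add ((isReg_entry i j).comp hf)
      (isReg_mul (IsReg.const (-1 : ℂ)) ((isReg_entry i j).comp hg))
    simpa [sub_eq_add_neg] using this

theorem isReg_polynomial_eval (p : Polynomial ℂ) : IsReg (fun x : ℂ => p.eval x) := by
  simp only [Polynomial.eval_eq_sum_range]
  exact isReg_sum _ fun k _ => isReg_mul (IsReg.const _) (isReg_pow IsReg.id k)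

/-- The natural numbers are Zariski dense in the line. -/
theorem IsZar.eq_univ_of_natCast {s : Set ℂ} (hs : IsZar s) (h : ∀ n : ℕ, (n : ℂ) ∈ s) :
    s = Set.univ := by
  refine Set.eq_univ_of_forall fun x => hs fun f hf h0 => ?_
  obtain ⟨p, hp⟩ := exists_polynomial hf
  have : p = 0 := Polynomial.eq_zero_of_infinite_isRoot p
    ((Set.infinite_range_of_injective Nat.cast_injective).mono (by
      rintro _ ⟨n, rfl⟩
      rw [Set.mem_ofPred_eq, Polynomial.IsRoot, ← hp]
      exact h0 _ (h n)))
  rw [hp, this, Polynomial.eval_zero]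

end Matrix

end AffVar

namespace AlgGrp

open AffVar

section Power

variable {m : ℕ}

/-- The complex power of a unipotent matrix. -/
def cpow (A : Matrix (Fin m) (Fin m) ℂ) (r : ℂ) : Matrix (Fin m) (Fin m) ℂ :=
  ∑ j ∈ Finset.range m, ((descPochhammer ℂ j).eval r / (j.factorial : ℂ)) • (A - 1) ^ j

theorem cpow_natCast {A : Matrix (Fin m) (Fin m) ℂ} (hA : (A - 1) ^ m = 0) (n : ℕ) :
    cpow A n = A ^ n := by
  have h1 : ∀ j, (descPochhammer ℂ j).eval (n : ℂ) / (j.factorial : ℂ) = n.choose j := by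
    intro j
    rw [descPochhammer_eval_eq_descFactorial, Nat.descFactorial_eq_factorial_mul_choose,
      Nat.cast_mul, mul_div_cancel_left₀ _ (Nat.cast_ne_zero.mpr j.factorial_ne_zero)]
  have h2 : cpow A n = ∑ j ∈ Finset.range (m + (n + 1)), (n.choose j : ℂ) • (A - 1) ^ j := by
    simp only [cpow, h1]
    refine Finset.sum_subset (Finset.range_mono (by lia)) fun j _ hj => ?_
    rw [pow_eq_zero_of_le (by simpa using hj) hA, smul_zero]
  rw [h2]
  have h3 : A ^ n = ∑ j ∈ Finset.range (n + 1), (n.choose j : ℂ) • (A - 1) ^ j := by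
    conv_lhs => rw [← sub_add_cancel A 1, (Commute.one_right (A - 1)).add_pow]
    refine Finset.sum_congr rfl fun j _ => ?_
    rw [one_pow, mul_one, Nat.cast_smul_eq_nsmul, nsmul_eq_mul']
  rw [h3]
  refine (Finset.sum_subset (Finset.range_mono (by lia)) fun j _ hj => ?_).symm
  rw [Nat.choose_eq_zero_of_lt (by simpa using hj), Nat.cast_zero, zero_smul]

theorem isReg_cpow {X : Type} [TopologicalSpace X] [AffVar X]
    {f : X → Matrix (Fin m) (Fin m) ℂ} {c : X → ℂ} (hf : IsReg f) (hc : IsReg c) :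
    IsReg (fun x => cpow (f x) (c x)) := by
  refine isReg_matrix_sum _ fun j _ => isReg_matrix_smul ?_
    (isReg_matrix_pow (isReg_matrix_sub hf (IsReg.const 1)) j)
  simp only [div_eq_mul_inv]
  exact isReg_mul ((isReg_polynomial_eval _).comp hc) (IsReg.const _)

/-- The inverse of a unipotent matrix. -/
def uinv (A : Matrix (Fin m) (Fin m) ℂ) : Matrix (Fin m) (Fin m) ℂ :=
  ∑ i ∈ Finset.range m, (1 - A) ^ i

theorem isReg_uinv {X : Type} [TopologicalSpace X] [AffVar X]
    {f : X → Matrix (Fin m) (Fin m) ℂ} (hf : IsReg f) : IsReg (fun x => uinv (f x)) :=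
  isReg_matrix_sum _ fun j _ => isReg_matrix_pow (isReg_matrix_sub (IsReg.const 1) hf) j

theorem one_sub_pow_eq_zero {A : Matrix (Fin m) (Fin m) ℂ} (hA : (A - 1) ^ m = 0) :
    (1 - A) ^ m = 0 := by
  rw [← neg_sub, neg_pow, hA, mul_zero]

theorem mul_uinv {A : Matrix (Fin m) (Fin m) ℂ} (hA : (A - 1) ^ m = 0) : A * uinv A = 1 := by
  have := mul_neg_geom_sum (1 - A) m
  rwa [one_sub_pow_eq_zero hA, sub_zero, sub_sub_cancel] at this

theorem uinv_mul {A : Matrix (Fin m) (Fin m) ℂ} (hA : (A - 1) ^ m = 0) : uinv A * A = 1 := by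
  have := geom_sum_mul_neg (1 - A) m
  rwa [one_sub_pow_eq_zero hA, sub_zero, sub_sub_cancel] at this

/-- The unit given by a unipotent matrix. -/
def uunit (A : Matrix (Fin m) (Fin m) ℂ) (hA : (A - 1) ^ m = 0) : (Matrix (Fin m) (Fin m) ℂ)ˣ :=
  ⟨A, uinv A, mul_uinv hA, uinv_mul hA⟩

theorem isReg_uunit {X : Type} [TopologicalSpace X] [AffVar X]
    {f : X → Matrix (Fin m) (Fin m) ℂ} (hf : IsReg f) (hu : ∀ x, (f x - 1) ^ m = 0) :
    IsReg (fun x => uunit (f x) (hu x)) :=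
  isReg_units_iff.mpr ⟨hf, isReg_uinv hf⟩

end Power

variable {G : Type} [Group G] [TopologicalSpace G] [AffVar G] [AlgGrp G]

/-- Loops in a connected group of unipotent matrices are null homotopic. -/
theorem homotopic_refl_of_unipotent (hG : core G = ⊤) {m : ℕ}
    (ψ : G →* (Matrix (Fin m) (Fin m) ℂ)ˣ) (hψ : IsReg ψ) (hi : Function.Injective ψ)
    (hu : ∀ x, ((ψ x).1 - 1) ^ m = 0) (γ : Path (1 : G) 1) : γ.Homotopic (Path.refl 1) := by
  have hn := isNice_univ hG
  have := hn.irred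
  have hN : IsZarSubgroup ψ.range := ⟨IsNice.isZar (by
    rw [MonoidHom.coe_range, ← Set.image_univ]
    exact hn.image hψ)⟩
  have hψ' : IsReg fun x => (ψ x).1 := isReg_units_val.comp hψ
  have hpow : ∀ x (n : ℕ), cpow (ψ x).1 n = (ψ (x ^ n)).1 := fun x n => by
    rw [cpow_natCast (hu x), map_pow, Units.val_pow_eq_pow_val]
  have hc : ∀ x, IsReg (cpow (ψ x).1) := fun x => isReg_cpow (IsReg.const _) IsReg.id
  have hnil : ∀ x r, (cpow (ψ x).1 r - 1) ^ m = 0 := by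
    intro x r
    have hz := isZar_setOf_eq (isReg_matrix_pow (isReg_matrix_sub (hc x) (IsReg.const 1)) m)
      (IsReg.const (0 : Matrix (Fin m) (Fin m) ℂ))
    have := hz.eq_univ_of_natCast fun n => by
      rw [Set.mem_ofPred_eq, hpow]
      exact hu _
    exact (Set.ext_iff.mp this r).mpr trivial
  have hmem : ∀ x r, uunit _ (hnil x r) ∈ ψ.range := by
    intro x r
    have hz := hN.isZar.preimage (isReg_uunit (hc x) (hnil x))
    have := hz.eq_univ_of_natCast fun n => ⟨x ^ n, Units.ext (hpow x n).symm⟩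
    exact (Set.ext_iff.mp this r).mpr trivial
  let φ : G ≃* ψ.range := MonoidHom.ofInjective hi
  have hφ : IsReg φ := isReg_subgroup_iff.mpr hψ
  have hφs : IsReg φ.symm := isReg_of_comp hφ φ.surjective φ.symm.toMonoidHom (by
    convert IsReg.id (X := G) using 1
    ext x
    exact φ.symm_apply_apply x)
  let F : G × ℂ → G := fun p => φ.symm ⟨_, hmem p.1 p.2⟩
  have hF : IsReg F := hφs.comp (isReg_subgroup_iff.mpr
    (isReg_uunit (isReg_cpow (hψ'.comp IsReg.fst) IsReg.snd) fun p : G × ℂ => hnil p.1 p.2))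
  have hFn : ∀ x (n : ℕ), F (x, n) = x ^ n := fun x n =>
    φ.symm_apply_eq.mpr (Subtype.ext (Units.ext (hpow x n)))
  have hF1 : ∀ x, F (x, 1) = x := fun x => by simpa using hFn x 1
  have hF0 : ∀ x, F (x, 0) = 1 := fun x => by simpa using hFn x 0
  have h1F : ∀ r, F (1, r) = 1 := by
    intro r
    have hz := isZar_setOf_eq (hF.comp ((IsReg.const (1 : G)).prodMk (IsReg.id (X := ℂ))))
      (IsReg.const (1 : G))
    have := hz.eq_univ_of_natCast fun n => by
      rw [Set.mem_ofPred_eq]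
      exact (hFn 1 n).trans (one_pow n)
    exact (Set.ext_iff.mp this r).mpr trivial
  refine ⟨⟨⟨⟨fun p => F (γ p.2, 1 - ((p.1 : ℝ) : ℂ)), hF.continuous.comp (by fun_prop)⟩, ?_, ?_⟩, ?_⟩⟩
  · intro t
    simp [hF1]
  · intro t
    simp [hF0]
  · rintro t x (rfl | rfl) <;> simp [h1F]

end AlgGrp

/-! ### Embedded affine algebraic groups -/

namespace AffAlgGroup

open AffVar AlgGrp

variable {G H : AffAlgGroup} {X : Type} [TopologicalSpace X] [AffVar X]

theorem isReg_polyEval {n : ℕ} (p : MvPolynomial (Fin n) ℂ) : IsReg (fun x : Pt n => eval x p) :=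
  isReg_eval (fun i => IsReg.apply i) p

theorem Gp_closed (G : AffAlgGroup) (y : Pt G.n)
    (hy : ∀ f ∈ RegFun (Pt G.n), (∀ x : G.Gp, f x.1 = 0) → f y = 0) :
    ∃ x : G.Gp, x.1 = y := by
  obtain ⟨S, hS⟩ := G.isAlgebraic
  refine ⟨⟨y, ?_⟩, rfl⟩
  rw [hS]
  refine fun p hp => hy _ (isReg_complex_iff.mp (isReg_polyEval p)) fun x =>
    (Set.ext_iff.mp hS x.1).mp x.2 p hp

theorem isInducing_Gp_val (G : AffAlgGroup) :
    Topology.IsInducing (Subtype.val : G.Gp → Pt G.n) := ⟨rfl⟩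

instance : AffVar G.Gp :=
  ofMap (Subtype.val : G.Gp → Pt G.n) (isInducing_Gp_val G) Subtype.val_injective (Gp_closed G)

theorem isReg_Gp_iff {f : X → G.Gp} : IsReg f ↔ IsReg (fun x => (f x).1) :=
  isReg_ofMap_iff (X := G.Gp) (e := Subtype.val) (isInducing_Gp_val G) Subtype.val_injective
    (Gp_closed G) f

theorem isReg_Gp_val : IsReg (fun x : G.Gp => x.1) := isReg_Gp_iff.mp IsReg.id

/-- Regular maps on the points of an affine algebraic group are the restrictions of polynomial
maps. -/
theorem isReg_iff_polynomial {m : ℕ} {f : G.Gp → Pt m} :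
    IsReg f ↔ ∃ P : Fin m → MvPolynomial (Fin G.n) ℂ, ∀ x i, f x i = eval x.1 (P i) := by
  constructor
  · intro hf
    have : ∀ i, ∃ p : MvPolynomial (Fin G.n) ℂ, ∀ x, f x i = eval x.1 p := fun i => by
      obtain ⟨g, hg, he⟩ := isReg_complex_iff.mp ((IsReg.apply i).comp hf)
      obtain ⟨p, hp⟩ := exists_eq_eval_of_isReg (isReg_complex_iff.mpr hg)
      exact ⟨p, fun x => by rw [← hp]; exact (congrFun he x).symm⟩
    choose P hP using this
    exact ⟨P, fun x i => hP i x⟩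
  · rintro ⟨P, hP⟩
    refine IsReg.pi fun i => ?_
    simp only [hP]
    exact (isReg_polyEval (P i)).comp isReg_Gp_val

theorem isReg_of_isRegularOn {m : ℕ} {f : Pt G.n → Pt m} (hf : IsRegularOn G.carrier f) :
    IsReg (fun x : G.Gp => f x.1) := by
  obtain ⟨P, hP⟩ := hf
  exact isReg_iff_polynomial.mpr ⟨P, fun x => hP x.1 x.2⟩

theorem isRegularOn_of_isReg {m : ℕ} {f : Pt G.n → Pt m} (hf : IsReg (fun x : G.Gp => f x.1)) :
    IsRegularOn G.carrier f := by
  obtain ⟨P, hP⟩ := isReg_iff_polynomial.mp hf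
  exact ⟨P, fun x hx => hP ⟨x, hx⟩⟩

instance : AlgGrp G.Gp where
  mul := by
    obtain ⟨P, hP⟩ := G.mul_regular
    refine isReg_Gp_iff.mpr (IsReg.pi fun i => ?_)
    have h : ∀ p : G.Gp × G.Gp, (p.1 * p.2).1 i = eval (Fin.append p.1.1 p.2.1) (P i) := by
      intro p
      have hl : Pt.left (Fin.append p.1.1 p.2.1) = p.1.1 := funext fun i => Fin.append_left _ _ i
      have hr : Pt.right (Fin.append p.1.1 p.2.1) = p.2.1 := funext fun i => Fin.append_right _ _ i
      have := hP (Fin.append p.1.1 p.2.1) ⟨by rw [hl]; exact p.1.2, by rw [hr]; exact p.2.2⟩ i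
      simp only [hl, hr] at this
      exact this
    simp only [h]
    refine isReg_eval (fun j => ?_) (P i)
    refine Fin.addCases (fun j => ?_) (fun j => ?_) j
    · simp only [Fin.append_left]
      exact (IsReg.apply j).comp (isReg_Gp_val.comp IsReg.fst)
    · simp only [Fin.append_right]
      exact (IsReg.apply j).comp (isReg_Gp_val.comp IsReg.snd)
  inv := isReg_Gp_iff.mpr (isReg_of_isRegularOn G.inv_regular)

theorem isAlgebraicSet_of_isZar {V : Set G.Gp} (hV : IsZar V) :
    IsAlgebraicSet (Subtype.val '' V : Set (Pt G.n)) := by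
  refine ⟨{p | ∀ x ∈ V, eval x.1 p = 0}, Set.Subset.antisymm ?_ fun y hy => ?_⟩
  · rintro _ ⟨x, hx, rfl⟩ p hp
    exact hp x hx
  · have hvan : ∀ f ∈ RegFun (Pt G.n), (∀ x ∈ V, f x.1 = 0) → f y = 0 := fun f hf h0 => by
      obtain ⟨p, hp⟩ := exists_eq_eval_of_isReg (isReg_complex_iff.mpr hf)
      rw [hp]
      exact hy p fun x hx => by rw [← hp]; exact h0 x hx
    obtain ⟨z, rfl⟩ := Gp_closed G y fun f hf h0 => hvan f hf fun x _ => h0 x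
    refine ⟨z, hV ?_, rfl⟩
    rintro _ ⟨f, hf, rfl⟩ h0
    exact hvan f hf h0

theorem core_eq_top_of_isConnected (hG : G.IsConnected) : core G.Gp = ⊤ := by
  refine core_eq_top_of_connected fun V W hV hW hVW hd => ?_
  have hsub : ∀ V : Set G.Gp, G.carrier ⊆ Subtype.val '' V → V = Set.univ := fun V h =>
    Set.eq_univ_of_forall fun x => by
      obtain ⟨y, hy, he⟩ := h x.2
      rwa [← Subtype.ext he]
  refine (hG _ _ (isAlgebraicSet_of_isZar hV) (isAlgebraicSet_of_isZar hW) (fun x hx => ?_)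
    (Set.eq_empty_of_forall_notMem ?_)).imp (hsub V) (hsub W)
  · have : (⟨x, hx⟩ : G.Gp) ∈ V ∪ W := hVW ▸ trivial
    exact this.imp (fun h => ⟨_, h, rfl⟩) fun h => ⟨_, h, rfl⟩
  · rintro _ ⟨-, ⟨x, hx, rfl⟩, y, hy, he⟩
    have : x ∈ V ∩ W := ⟨hx, (Subtype.ext he : y = x) ▸ hy⟩
    rwa [hd] at this

end AffAlgGroup

namespace AlgGroupHom

open AffVar AffAlgGroup

variable {G H : AffAlgGroup}

theorem isReg_toGpHom (f : AlgGroupHom G H) : IsReg f.toGpHom :=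
  isReg_Gp_iff.mpr (isReg_of_isRegularOn f.regular)

/-- The morphism of algebraic groups given by a regular homomorphism on points. -/
def ofGpHom (s : G.Gp →* H.Gp) (hs : IsReg s) : AlgGroupHom G H :=
  open Classical in
  have h : ∀ x : G.Gp, (if hx : x.1 ∈ G.carrier then (s ⟨x.1, hx⟩).1 else 0) = (s x).1 :=
    fun x => dif_pos x.2
  { toFun := fun x => if hx : x ∈ G.carrier then (s ⟨x, hx⟩).1 else 0
    maps_to := fun {x} hx => by
      rw [h ⟨x, hx⟩]
      exact (s _).2
    map_mul := fun {x y} hx hy => by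
      rw [h ⟨x, hx⟩, h ⟨y, hy⟩]
      exact (h (⟨x, hx⟩ * ⟨y, hy⟩ : G.Gp)).trans (congrArg Subtype.val (s.map_mul _ _))
    regular := isRegularOn_of_isReg (by
      simp only [h]
      exact isReg_Gp_val.comp hs) }

theorem ofGpHom_apply (s : G.Gp →* H.Gp) (hs : IsReg s) (x : G.Gp) :
    (ofGpHom s hs).toFun x.1 = (s x).1 := dif_pos x.2

end AlgGroupHom

namespace AlgSubgroup

open AffVar AlgGrp AffAlgGroup

variable {G H : AffAlgGroup}

instance (K : AlgSubgroup G) : IsZarSubgroup K.toSubgroup := by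
  obtain ⟨S, hS⟩ := K.isAlgebraic
  refine ⟨fun x hx => (Set.ext_iff.mp hS x.1).mpr fun p hp => ?_⟩
  exact hx (fun y => eval y.1 p)
    (isReg_complex_iff.mp ((isReg_polyEval p).comp isReg_Gp_val))
    fun y hy => (Set.ext_iff.mp hS y.1).mp hy p hp

/-- The points of an algebraic subgroup, as a subgroup and as an algebraic group. -/
def toGrpHom (K : AlgSubgroup G) : K.toSubgroup →* K.toGrp.Gp :=
  MonoidHom.mk' (fun x => ⟨x.1.1, x.2⟩) fun _ _ => rfl

theorem isReg_toGrpHom (K : AlgSubgroup G) : IsReg K.toGrpHom :=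
  isReg_Gp_iff.mpr ((isReg_Gp_val (G := G)).comp (isReg_subtype K.toSubgroup))

theorem isReg_incl (K : AlgSubgroup G) : IsReg K.incl :=
  isReg_Gp_iff.mpr (isReg_Gp_val (G := K.toGrp))

theorem core_eq_top_of_isConnected (K : AlgSubgroup G) (hK : K.toGrp.IsConnected) :
    core K.toSubgroup = ⊤ :=
  core_eq_top_of_injective K.toGrpHom K.isReg_toGrpHom
    (fun _ _ h => Subtype.ext (Subtype.ext (congrArg (fun z : K.toGrp.Gp => z.1) h)))
    (fun y => ⟨⟨⟨y.1, K.subset y.2⟩, y.2⟩, rfl⟩) (AffAlgGroup.core_eq_top_of_isConnected hK)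

/-- A morphism injective on an algebraic subgroup identifies it with its image. -/
theorem exists_restrict (f : AlgGroupHom H G) (K : AlgSubgroup H) (L : AlgSubgroup G)
    (hi : Set.InjOn f.toFun K.carrier) (himg : f.toFun '' K.carrier = L.carrier) :
    ∃ r : K.toSubgroup →* L.toGrp.Gp, IsReg r ∧ Function.Injective r ∧ Function.Surjective r ∧
      ∀ x, (r x).1 = f.toFun x.1.1 := by
  refine ⟨MonoidHom.mk' (fun x => ⟨f.toFun x.1.1, himg.subset ⟨_, x.2, rfl⟩⟩) fun x y =>
    Subtype.ext (f.map_mul x.1.2 y.1.2), ?_, ?_, ?_, fun _ => rfl⟩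
  · exact isReg_Gp_iff.mpr ((isReg_of_isRegularOn f.regular).comp (isReg_subtype K.toSubgroup))
  · exact fun x y h => Subtype.ext (Subtype.ext (hi x.2 y.2
      (congrArg (fun z : L.toGrp.Gp => z.1) h)))
  · intro y
    obtain ⟨x, hx, he⟩ := himg.superset y.2
    exact ⟨⟨⟨x, K.subset hx⟩, hx⟩, Subtype.ext he⟩

end AlgSubgroup

namespace AffAlgGroup

open AffVar AlgGrp

theorem sub_one_pow_eq_zero_of_unitriangular {m : ℕ} {A : Matrix (Fin m) (Fin m) ℂ}
    (h1 : ∀ i, A i i = 1) (h0 : ∀ i j, j < i → A i j = 0) : (A - 1) ^ m = 0 := by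
  have h := A.aeval_self_charpoly
  rw [A.charpoly_of_isUpperTriangular fun i j hij => h0 i j hij] at h
  simpa [h1] using h

/-- The faithful representation of a unipotent group by unipotent matrices. -/
theorem IsUnipotent.exists_rep {G : AffAlgGroup} (hG : G.IsUnipotent) :
    ∃ (m : ℕ) (ψ : G.Gp →* (Matrix (Fin m) (Fin m) ℂ)ˣ), IsReg ψ ∧ Function.Injective ψ ∧
      ∀ x, ((ψ x).1 - 1) ^ m = 0 := by
  obtain ⟨m, φ, hreg, hinj, htri, hmul⟩ := hG
  let A : G.Gp → Matrix (Fin m) (Fin m) ℂ := fun x => Matrix.of (matEntry (φ x.1))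
  have hA : ∀ x, (A x - 1) ^ m = 0 := fun x =>
    sub_one_pow_eq_zero_of_unitriangular (htri x.1 x.2).1 (htri x.1 x.2).2
  have hAmul : ∀ x y, A (x * y) = A x * A y := fun x y => by
    ext i j
    have : A (x * y) i j = matEntry (φ (G.mul x.1 y.1)) i j := rfl
    rw [this, hmul _ x.2 _ y.2, Matrix.mul_apply]
    simp only [matEntry, matMulPt, Equiv.symm_apply_apply]
    rfl
  refine ⟨m, MonoidHom.mk' (fun x => uunit (A x) (hA x)) fun x y => Units.ext (hAmul x y), ?_, ?_,
    hA⟩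
  · refine isReg_uunit (isReg_matrix fun i j => ?_) hA
    exact (IsReg.apply (finProdFinEquiv (i, j))).comp (isReg_of_isRegularOn hreg)
  · intro x y h
    have h' : A x = A y := congrArg Units.val h
    refine Subtype.ext (hinj x.2 y.2 (funext fun k => ?_))
    obtain ⟨⟨i, j⟩, rfl⟩ := finProdFinEquiv.surjective k
    exact congrFun (congrFun h' i) j

end AffAlgGroup

namespace AlgExtension

open AffVar AlgGrp AffAlgGroup

variable {G A : AffAlgGroup} {ρ : AlgAction G A}

/-- An extension by a torus with trivial action is central. -/
theorem exists_torusExt (hA : A.IsTorus) (hρ : ρ.IsTrivial) (e : AlgExtension G A ρ) :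
    ∃ (k : ℕ) (X : TorusExt k e.E.Gp G.Gp), X.q = e.q.toGpHom := by
  obtain ⟨k, φ, hmem, hinj, hsurj, -, hmul, hreg, -⟩ := hA
  let φ' : Torus k →* A.Gp := MonoidHom.mk' (fun u => ⟨φ u, hmem u⟩) fun u v =>
    Subtype.ext (hmul u v)
  have hφ' : IsReg φ' := by
    refine isReg_Gp_iff.mpr (IsReg.pi fun i => ?_)
    obtain ⟨P, hP⟩ := hreg i
    have : (fun u : Torus k => (φ' u).1 i) = fun u => eval
      (Sum.elim (fun j => (u j : ℂ)) (fun j => ((u j)⁻¹ : ℂˣ))) P := funext hP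
    rw [this]
    refine isReg_eval (fun j => ?_) P
    rcases j with j | j
    · exact isReg_units_val.comp (IsReg.apply j)
    · exact isReg_units_inv_val.comp (IsReg.apply j)
  refine ⟨k, ⟨e.i.toGpHom.comp φ', e.q.toGpHom, e.i.isReg_toGpHom.comp hφ', e.q.isReg_toGpHom,
    fun u v h => ?_, fun g => ?_, fun x => ?_, fun u x => ?_⟩, rfl⟩
  · exact hinj (e.i_inj (hmem u) (hmem v) (congrArg (fun z : e.E.Gp => z.1) h))
  · obtain ⟨x, hx, he⟩ := e.q_surj g.1 g.2
    exact ⟨⟨x, hx⟩, Subtype.ext he⟩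
  · have h1 : e.q.toGpHom x = 1 ↔ e.q.toFun x.1 = G.one :=
      ⟨fun h => congrArg (fun z : G.Gp => z.1) h, fun h => Subtype.ext h⟩
    rw [h1, e.exact x.1 x.2]
    constructor
    · rintro ⟨a, ha, he⟩
      obtain ⟨u, rfl⟩ := hsurj a ha
      exact ⟨u, Subtype.ext he⟩
    · rintro ⟨u, rfl⟩
      exact ⟨φ u, hmem u, rfl⟩
  · have h := e.conj_compat x.1 x.2 (φ u) (hmem u)
    rw [hρ _ (e.q.maps_to x.2) _ (hmem u)] at h
    have h' : x * (e.i.toGpHom (φ' u) * x⁻¹) = e.i.toGpHom (φ' u) := Subtype.ext h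
    rw [← mul_assoc, mul_inv_eq_iff_eq_mul] at h'
    exact h'.symm

end AlgExtension

/-- For any extension `1 → A_s → Ĝ → G → 1` of a connected
algebraic group `G` by a torus `A_s` (trivial action), the pullback of the
extension along the canonical covering `q_G : G̃ → G` splits; equivalently,
`q_G` lifts to a morphism `G̃ → Ĝ`. -/
theorem pullback_of_torus_extension_to_cover_splits
    (G : AffAlgGroup) (hG : G.IsConnected) (LD : LeviDecomposition G)
    (CD : CoveringData G LD)
    (As : AffAlgGroup) (hAs : As.IsTorus)
    (ρ : AlgAction G As) (hρ : ρ.IsTrivial)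
    (e : AlgExtension G As ρ) :
    ∃ s : AlgGroupHom CD.Gt e.E,
      ∀ x ∈ CD.Gt.carrier, e.q.toFun (s.toFun x) = CD.qG.toFun x := by
  open AffVar AlgGrp AffAlgGroup in
  obtain ⟨k, X, hX⟩ := e.exists_torusExt hAs hρ
  have hp := CD.qG.isReg_toGpHom
  have : CD.Gu'.toSubgroup.Normal := ⟨fun x hx g => by
    have := CD.Gu'_normal g.1 g.2 x.1 hx
    rw [mul_assoc]
    exact this⟩
  obtain ⟨rU, hrU, hrUi, hrUs, -⟩ := AlgSubgroup.exists_restrict CD.qG CD.Gu' LD.Gu CD.qG_Gu'_inj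
    CD.qG_Gu'_img
  obtain ⟨rZ, hrZ, hrZi, hrZs, -⟩ := AlgSubgroup.exists_restrict CD.qG CD.Zc CD.Z CD.qG_Zc_inj
    CD.qG_Zc_img
  have hUc := core_eq_top_of_injective rU hrU hrUi hrUs
    (core_eq_top_of_isConnected LD.Gu_radical.2.1)
  have hZc := core_eq_top_of_injective rZ hrZ hrZi hrZs
    (core_eq_top_of_isConnected CD.Z_connected)
  have hSc := CD.Gs.core_eq_top_of_isConnected CD.Gs_connected
  obtain ⟨m, ψ, hψ, hψi, hψu⟩ := LD.Gu_radical.2.2.1.exists_rep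
  obtain ⟨sU, hsU, hqU, hχ⟩ := X.exists_lift_of_simplyConnected hUc
    (p := CD.qG.toGpHom.comp CD.Gu'.toSubgroup.subtype) (hp.comp (isReg_subtype _))
    (homotopic_refl_of_unipotent hUc (ψ.comp rU) (hψ.comp hrU) (hψi.comp hrUi) fun x => hψu _)
  obtain ⟨sZ, hsZ, hqZ⟩ := X.exists_lift_of_comm hZc
    (p := CD.qG.toGpHom.comp CD.Zc.toSubgroup.subtype) (hp.comp (isReg_subtype _)) fun x y => by
      refine hrZi ?_
      rw [map_mul, map_mul]
      exact Subtype.ext (CD.Z_central _ (rZ x).2 _ (CD.Z_sub (rZ y).2))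
  obtain ⟨sS, hsS, hqS, -⟩ := X.exists_lift_of_simplyConnected
    (core_eq_top_of_isConnected CD.Gs_connected) (p := CD.qG.toGpHom.comp CD.Gs.incl)
    (hp.comp CD.Gs.isReg_incl) fun γ => Path.Homotopic.Quotient.eq.mp
      (CD.Gs_simplyConnected (.mk γ))
  obtain ⟨s, hs, hqs⟩ := X.exists_lift_of_decomp (p := CD.qG.toGpHom) hUc hZc hSc
    (fun x hx y hy => Subtype.ext (CD.Zc_Gs_comm _ hx _ hy))
    (fun x => by
      obtain ⟨u, hu, z, hz, t, ht, hx⟩ := CD.decomp x.1 x.2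
      exact ⟨⟨⟨u, CD.Gu'.subset hu⟩, hu⟩, ⟨⟨z, CD.Zc.subset hz⟩, hz⟩, ⟨⟨t, CD.Gs.subset ht⟩, ht⟩,
        Subtype.ext hx⟩)
    (fun u z t h => Subtype.ext (Subtype.ext ((Set.ext_iff.mp CD.levi_inter u.1.1).mp
      ⟨u.2, z.1.1, z.2, t.1.1, t.2, congrArg (fun y : CD.Gt.Gp => y.1) h⟩)))
    (fun z t h => Subtype.ext (Subtype.ext ((Set.ext_iff.mp CD.Zc_Gs_inter z.1.1).mp
      ⟨z.2, h ▸ t.2⟩)))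
    (sS := sS.comp CD.Gs.toGrpHom) hsU hsZ (hsS.comp CD.Gs.isReg_toGrpHom) hqU hqZ
    (fun x => hqS (CD.Gs.toGrpHom x)) hχ
  refine ⟨AlgGroupHom.ofGpHom s hs, fun x hx => ?_⟩
  rw [AlgGroupHom.ofGpHom_apply s hs ⟨x, hx⟩]
  have := hqs ⟨x, hx⟩
  rw [hX] at this
  exact congrArg (fun y : G.Gp => y.1) this
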